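/- Let N ≥ 2 be an integer, r ∈ ℕ, D ⊆ ℝ^{N−1} an open connected set, and β ∈ C^∞(D) such that inf_D β < 0 < sup_D β and Σ_{0≤|ζ|≤r} |D^ζ β(y)| > 0 for every y ∈ D (the sum being over multi-indices ζ ∈ ℕ^{N−1} with |ζ| ≤ r). Fix a bounded open set D' with closure contained in D and a constant M > 0. Then there exists C > 0, depending only on N, r, D, D', β and M, such that: for all real numbers a < a' < b' < b with (a'−a)^{−1} ≤ M, (b−b')^{−1} ≤ M and b'−a' ≤ M, for every measurable γ : (a,b)×D → ℝ with |γ| ≤ M almost everywhere, and for every bounded distributional solution u : (a,b)×D → [0,∞) of Δ_y u + β(y) u_x + γ(x,y) u = 0, one has ess sup_{(a',b')×D'} u ≤ C · ess inf_{(a',b')×D'} u. -/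

import Mathlib

open MeasureTheory Set Metric

noncomputable section

/-- `ℝ^{N-1}`, the space of the variable `y`. -/
abbrev Euc (N : ℕ) : Type := EuclideanSpace ℝ (Fin (N - 1))

/-- The partial derivative `∂φ/∂x` of a function on `ℝ × ℝ^{N-1}`. -/
def dX {N : ℕ} (φ : ℝ × Euc N → ℝ) (p : ℝ × Euc N) : ℝ :=
  fderiv ℝ φ p (1, 0)

/-- The Laplacian `Δ_y` in the `y`-variables. -/
def lapY {N : ℕ} (φ : ℝ × Euc N → ℝ) (p : ℝ × Euc N) : ℝ :=
  ∑ i : Fin (N - 1),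
    fderiv ℝ (fun q => fderiv ℝ φ q ((0 : ℝ), EuclideanSpace.single i (1 : ℝ))) p
      ((0 : ℝ), EuclideanSpace.single i (1 : ℝ))

/-- `u` is a distributional solution of `Δ_y u + β(y) u_x + γ(x,y) u = 0` on `S`:
for every test function `φ ∈ C_c^∞(S)`, `∫_S u · (Δ_y φ − β φ_x + γ φ) = 0`. -/
def IsDistribSolution {N : ℕ} (S : Set (ℝ × Euc N)) (β : Euc N → ℝ)
    (γ u : ℝ × Euc N → ℝ) : Prop :=
  ∀ φ : ℝ × Euc N → ℝ, ContDiff ℝ (⊤ : ℕ∞) φ → HasCompactSupport φ → tsupport φ ⊆ S →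
    ∫ p in S, u p * (lapY φ p - β p.2 * dX φ p + γ p * φ p) = 0

/-- Iterated partial derivatives of `β` along a list of coordinate directions. -/
def partialsAlong {N : ℕ} (β : Euc N → ℝ) : List (Fin (N - 1)) → (Euc N → ℝ)
  | [] => β
  | i :: l => fun y => fderiv ℝ (partialsAlong β l) y (EuclideanSpace.single i (1 : ℝ))

/-- The list of directions encoded by a multi-index `ζ` (direction `i` repeated `ζ i` times). -/
def multiIndexList {N r : ℕ} (ζ : Fin (N - 1) → Fin (r + 1)) : List (Fin (N - 1)) :=
  (List.finRange (N - 1)).flatMap fun i => List.replicate (ζ i : ℕ) i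

/-- `Σ_{0 ≤ |ζ| ≤ r} |D^ζ β(y)|`: the sum over all multi-indices `ζ ∈ ℕ^{N-1}` with `|ζ| ≤ r`
of the absolute values of the corresponding partial derivatives of `β` at `y`.  (A multi-index
with `|ζ| ≤ r` has all entries `≤ r`, hence is the same as an element of the displayed finset.) -/
def hormanderSum (N r : ℕ) (β : Euc N → ℝ) (y : Euc N) : ℝ :=
  ∑ ζ ∈ Finset.univ.filter (fun ζ : Fin (N - 1) → Fin (r + 1) => ∑ i, (ζ i : ℕ) ≤ r),
    |partialsAlong β (multiIndexList ζ) y|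

/-! ### Directional derivatives -/

section Calculus

variable {N : ℕ}

/-- The derivative of `f` in the fixed direction `e`. -/
def dir (e : ℝ × Euc N) (f : ℝ × Euc N → ℝ) (p : ℝ × Euc N) : ℝ := fderiv ℝ f p e

/-- The unit vector of the variable `x`. -/
def eX : ℝ × Euc N := (1, 0)

/-- The unit vector of the variable `y_i`. -/
def eY (i : Fin (N - 1)) : ℝ × Euc N := (0, EuclideanSpace.single i (1 : ℝ))

lemma dX_eq (f : ℝ × Euc N → ℝ) : dX f = dir eX f := rfl

lemma lapY_eq (f : ℝ × Euc N → ℝ) (p : ℝ × Euc N) :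
    lapY f p = ∑ i, dir (eY i) (dir (eY i) f) p := rfl

/-- The squared norm of the gradient in the `y`-variables. -/
def gradSq (f : ℝ × Euc N → ℝ) (p : ℝ × Euc N) : ℝ := ∑ i, (dir (eY i) f p) ^ 2

/-- The operator `Δ_y + β(y) ∂_x`. -/
def opL (β : Euc N → ℝ) (f : ℝ × Euc N → ℝ) (p : ℝ × Euc N) : ℝ :=
  lapY f p + β p.2 * dX f p

lemma gradSq_nonneg (f : ℝ × Euc N → ℝ) (p : ℝ × Euc N) : 0 ≤ gradSq f p :=
  Finset.sum_nonneg fun _ _ => sq_nonneg _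

lemma contDiff_dir {n : ℕ} {f : ℝ × Euc N → ℝ} (hf : ContDiff ℝ (n + 1) f) (e : ℝ × Euc N) :
    ContDiff ℝ n (dir e f) :=
  (hf.fderiv_right (m := n) le_rfl).clm_apply contDiff_const

lemma ContDiff.dir_one {f : ℝ × Euc N → ℝ} (hf : ContDiff ℝ 2 f) (e : ℝ × Euc N) :
    ContDiff ℝ 1 (dir e f) :=
  contDiff_dir (n := 1) (by exact_mod_cast hf) e

lemma ContDiff.continuous_dir {f : ℝ × Euc N → ℝ} (hf : ContDiff ℝ 1 f) (e : ℝ × Euc N) :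
    Continuous (dir e f) :=
  (contDiff_dir (n := 0) (by exact_mod_cast hf) e).continuous

lemma ContDiff.one_of_two {f : ℝ × Euc N → ℝ} (hf : ContDiff ℝ 2 f) : ContDiff ℝ 1 f :=
  hf.of_le (by norm_num)

lemma continuous_lapY {f : ℝ × Euc N → ℝ} (hf : ContDiff ℝ 2 f) : Continuous (lapY f) := by
  show Continuous fun p => ∑ i, dir (eY i) (dir (eY i) f) p
  exact continuous_finsetSum _ fun i _ => (hf.dir_one _).continuous_dir _

lemma continuous_gradSq {f : ℝ × Euc N → ℝ} (hf : ContDiff ℝ 1 f) : Continuous (gradSq f) :=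
  continuous_finsetSum _ fun _ _ => (hf.continuous_dir _).pow 2

lemma continuous_opL {β : Euc N → ℝ} (hβ : Continuous β) {f : ℝ × Euc N → ℝ}
    (hf : ContDiff ℝ 2 f) : Continuous (opL β f) :=
  (continuous_lapY hf).add ((hβ.comp continuous_snd).mul (hf.one_of_two.continuous_dir _))

lemma dir_mul {f g : ℝ × Euc N → ℝ} {p : ℝ × Euc N} (hf : DifferentiableAt ℝ f p)
    (hg : DifferentiableAt ℝ g p) (e : ℝ × Euc N) :
    dir e (fun q => f q * g q) p = dir e f p * g p + f p * dir e g p := by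
  unfold dir
  rw [fderiv_fun_mul hf hg]
  simp
  ring

lemma dir_sub {f g : ℝ × Euc N → ℝ} {p : ℝ × Euc N} (hf : DifferentiableAt ℝ f p)
    (hg : DifferentiableAt ℝ g p) (e : ℝ × Euc N) :
    dir e (fun q => f q - g q) p = dir e f p - dir e g p := by
  unfold dir
  rw [fderiv_fun_sub hf hg]
  simp

lemma dir_const_mul {f : ℝ × Euc N → ℝ} {p : ℝ × Euc N} (hf : DifferentiableAt ℝ f p)
    (c : ℝ) (e : ℝ × Euc N) : dir e (fun q => c * f q) p = c * dir e f p := by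
  unfold dir
  rw [fderiv_const_mul hf]
  simp

lemma dir_comp {Ψ : ℝ → ℝ} {c : ℝ} {f : ℝ × Euc N → ℝ} {p : ℝ × Euc N}
    (hΨ : HasDerivAt Ψ c (f p)) (hf : DifferentiableAt ℝ f p) (e : ℝ × Euc N) :
    dir e (fun q => Ψ (f q)) p = c * dir e f p := by
  unfold dir
  have := (hΨ.comp_hasFDerivAt p hf.hasFDerivAt).fderiv
  rw [show (fun q => Ψ (f q)) = Ψ ∘ f from rfl, this]
  simp

lemma dir_shift (f : ℝ × Euc N → ℝ) (s p e : ℝ × Euc N) :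
    dir e (fun q => f (q + s)) p = dir e f (p + s) := by
  unfold dir
  rw [fderiv_comp_add_right]

lemma lapY_shift (f : ℝ × Euc N → ℝ) (s p : ℝ × Euc N) :
    lapY (fun q => f (q + s)) p = lapY f (p + s) := by
  simp only [lapY_eq]
  refine Finset.sum_congr rfl fun i _ => ?_
  rw [show dir (eY i) (fun q => f (q + s)) = fun q => dir (eY i) f (q + s) from
    funext fun q => dir_shift f s q _]
  exact dir_shift _ s p _

lemma opL_shift_x (β : Euc N → ℝ) (f : ℝ × Euc N → ℝ) (t : ℝ) (p : ℝ × Euc N) :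
    opL β (fun q => f (q + (t, 0))) p = opL β f (p + (t, 0)) := by
  simp [opL, lapY_shift, dX_eq, dir_shift]

lemma ContDiff.diffAt {f : ℝ × Euc N → ℝ} (hf : ContDiff ℝ 1 f) (p : ℝ × Euc N) :
    DifferentiableAt ℝ f p := (hf.differentiable one_ne_zero) p

lemma lapY_sub {f g : ℝ × Euc N → ℝ} (hf : ContDiff ℝ 2 f) (hg : ContDiff ℝ 2 g)
    (p : ℝ × Euc N) : lapY (fun q => f q - g q) p = lapY f p - lapY g p := by
  simp only [lapY_eq, ← Finset.sum_sub_distrib]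
  refine Finset.sum_congr rfl fun i _ => ?_
  rw [show dir (eY i) (fun q => f q - g q) = fun q => dir (eY i) f q - dir (eY i) g q from
    funext fun q => dir_sub (hf.one_of_two.diffAt q) (hg.one_of_two.diffAt q) _]
  exact dir_sub ((hf.dir_one _).diffAt p) ((hg.dir_one _).diffAt p) _

lemma lapY_const_mul {f : ℝ × Euc N → ℝ} (hf : ContDiff ℝ 2 f) (c : ℝ) (p : ℝ × Euc N) :
    lapY (fun q => c * f q) p = c * lapY f p := by
  simp only [lapY_eq, Finset.mul_sum]
  refine Finset.sum_congr rfl fun i _ => ?_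
  rw [show dir (eY i) (fun q => c * f q) = fun q => c * dir (eY i) f q from
    funext fun q => dir_const_mul (hf.one_of_two.diffAt q) c _]
  exact dir_const_mul ((hf.dir_one _).diffAt p) c _

lemma opL_sub (β : Euc N → ℝ) {f g : ℝ × Euc N → ℝ} (hf : ContDiff ℝ 2 f)
    (hg : ContDiff ℝ 2 g) (p : ℝ × Euc N) :
    opL β (fun q => f q - g q) p = opL β f p - opL β g p := by
  simp only [opL, lapY_sub hf hg, dX_eq,
    dir_sub (hf.one_of_two.diffAt p) (hg.one_of_two.diffAt p)]
  ring

lemma opL_const_mul (β : Euc N → ℝ) {f : ℝ × Euc N → ℝ} (hf : ContDiff ℝ 2 f) (c : ℝ)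
    (p : ℝ × Euc N) : opL β (fun q => c * f q) p = c * opL β f p := by
  simp only [opL, lapY_const_mul hf, dX_eq, dir_const_mul (hf.one_of_two.diffAt p)]
  ring

lemma lapY_comp {Ψ Ψ' Ψ'' : ℝ → ℝ} (h1 : ∀ s, HasDerivAt Ψ (Ψ' s) s)
    (h2 : ∀ s, HasDerivAt Ψ' (Ψ'' s) s) {f : ℝ × Euc N → ℝ} (hf : ContDiff ℝ 2 f)
    (p : ℝ × Euc N) :
    lapY (fun q => Ψ (f q)) p = Ψ' (f p) * lapY f p + Ψ'' (f p) * gradSq f p := by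
  simp only [lapY_eq, gradSq, Finset.mul_sum, ← Finset.sum_add_distrib]
  refine Finset.sum_congr rfl fun i _ => ?_
  rw [show dir (eY i) (fun q => Ψ (f q)) = fun q => Ψ' (f q) * dir (eY i) f q from
    funext fun q => dir_comp (h1 _) (hf.one_of_two.diffAt q) _]
  have hd : DifferentiableAt ℝ (fun q => Ψ' (f q)) p :=
    (h2 (f p)).differentiableAt.comp p (hf.one_of_two.diffAt p)
  rw [dir_mul hd ((hf.dir_one _).diffAt p), dir_comp (h2 _) (hf.one_of_two.diffAt p)]
  ring

lemma opL_comp (β : Euc N → ℝ) {Ψ Ψ' Ψ'' : ℝ → ℝ} (h1 : ∀ s, HasDerivAt Ψ (Ψ' s) s)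
    (h2 : ∀ s, HasDerivAt Ψ' (Ψ'' s) s) {f : ℝ × Euc N → ℝ} (hf : ContDiff ℝ 2 f)
    (p : ℝ × Euc N) :
    opL β (fun q => Ψ (f q)) p = Ψ' (f p) * opL β f p + Ψ'' (f p) * gradSq f p := by
  simp only [opL, lapY_comp h1 h2 hf, dX_eq, dir_comp (h1 _) (hf.one_of_two.diffAt p)]
  ring

lemma gradSq_comp {Ψ Ψ' : ℝ → ℝ} (h1 : ∀ s, HasDerivAt Ψ (Ψ' s) s)
    {f : ℝ × Euc N → ℝ} (hf : ContDiff ℝ 1 f) (p : ℝ × Euc N) :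
    gradSq (fun q => Ψ (f q)) p = (Ψ' (f p)) ^ 2 * gradSq f p := by
  simp only [gradSq, dir_comp (h1 _) (hf.diffAt p), Finset.mul_sum, mul_pow]

/-! ### Integration by parts -/

lemma HasCompactSupport.dir {f : ℝ × Euc N → ℝ} (hf : HasCompactSupport f) (e : ℝ × Euc N) :
    HasCompactSupport (dir e f) := by
  refine (hf.fderiv (𝕜 := ℝ)).mono fun p hp => ?_
  simp only [Function.mem_support, _root_.dir] at hp ⊢
  intro h
  exact hp (by simp [h])

instance isAddHaarMeasure_volume_prod_euc :
    (volume : Measure (ℝ × Euc N)).IsAddHaarMeasure :=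
  inferInstanceAs ((volume : Measure ℝ).prod (volume : Measure (Euc N))).IsAddHaarMeasure

lemma integral_mul_dir {f g : ℝ × Euc N → ℝ} (hf : ContDiff ℝ 1 f) (hg : ContDiff ℝ 1 g)
    (hc : HasCompactSupport f) (e : ℝ × Euc N) :
    ∫ p, f p * dir e g p = - ∫ p, dir e f p * g p := by
  refine integral_mul_fderiv_eq_neg_fderiv_mul_of_integrable (𝕜 := ℝ) ?_ ?_ ?_
    (fun p _ => hf.diffAt p) (fun p _ => hg.diffAt p)
  · exact ((hf.continuous_dir e).mul hg.continuous).integrable_of_hasCompactSupport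
      ((hc.dir e).mul_right)
  · exact (hf.continuous.mul (hg.continuous_dir e)).integrable_of_hasCompactSupport
      (hc.mul_right)
  · exact (hf.continuous.mul hg.continuous).integrable_of_hasCompactSupport (hc.mul_right)

lemma integral_mul_lapY {f g : ℝ × Euc N → ℝ} (hf : ContDiff ℝ 1 f) (hg : ContDiff ℝ 2 g)
    (hc : HasCompactSupport f) :
    ∫ p, f p * lapY g p = - ∑ i, ∫ p, dir (eY i) f p * dir (eY i) g p := by
  simp only [lapY_eq, Finset.mul_sum]
  rw [integral_finsetSum, ← Finset.sum_neg_distrib]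
  · exact Finset.sum_congr rfl fun i _ => integral_mul_dir hf (hg.dir_one _) hc _
  · intro i _
    exact (hf.continuous.mul ((hg.dir_one _).continuous_dir _)).integrable_of_hasCompactSupport
      hc.mul_right

/-- The formal adjoint of `Δ_y + β ∂_x` is `Δ_y - β ∂_x`. -/
lemma integral_mul_opL {β : Euc N → ℝ} (hβ : ContDiff ℝ 1 β) {f g : ℝ × Euc N → ℝ}
    (hf : ContDiff ℝ 2 f) (hg : ContDiff ℝ 2 g) (hc : HasCompactSupport f) :
    ∫ p, f p * opL β g p = ∫ p, g p * opL (fun y => - β y) f p := by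
  have hβ' : ContDiff ℝ 1 (fun p : ℝ × Euc N => β p.2) := hβ.comp contDiff_snd
  have hf1 := hf.one_of_two
  have hg1 := hg.one_of_two
  have hbc : HasCompactSupport (fun p : ℝ × Euc N => f p * β p.2) := hc.mul_right
  have hdb : ∀ p : ℝ × Euc N, dir eX (fun p : ℝ × Euc N => β p.2) p = 0 := by
    intro p
    unfold dir eX
    have hd : DifferentiableAt ℝ β p.2 := (hβ.differentiable one_ne_zero) _
    have : HasFDerivAt (fun p : ℝ × Euc N => β p.2)
      ((fderiv ℝ β p.2).comp (ContinuousLinearMap.snd ℝ ℝ (Euc N))) p :=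
      hd.hasFDerivAt.comp p hasFDerivAt_snd
    rw [this.fderiv]
    simp
  have h1 : ∫ p, f p * lapY g p = ∫ p, g p * lapY f p := by
    rw [integral_mul_lapY hf1 hg hc]
    simp only [lapY_eq, Finset.mul_sum]
    rw [integral_finsetSum, ← Finset.sum_neg_distrib]
    · refine Finset.sum_congr rfl fun i _ => ?_
      have := integral_mul_dir (hf.dir_one (eY i)) hg1 (hc.dir _) (eY i)
      rw [this, neg_neg]
      exact integral_congr_ae (Filter.Eventually.of_forall fun p => mul_comm _ _)
    · intro i _
      exact (hg1.continuous.mul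
        ((hf.dir_one _).continuous_dir _)).integrable_of_hasCompactSupport
        ((hc.dir _).dir _).mul_left
  have h2 : ∫ p, f p * (β p.2 * dX g p) = ∫ p, g p * (- β p.2 * dX f p) := by
    have := integral_mul_dir (hf1.mul hβ') hg1 hbc eX
    simp only [← mul_assoc, dX_eq]
    rw [this, ← integral_neg]
    refine integral_congr_ae (Filter.Eventually.of_forall fun p => ?_)
    simp only
    rw [dir_mul (hf1.diffAt p) (hβ'.diffAt p), hdb]
    ring
  have i1 : Integrable fun p => f p * lapY g p :=
    (hf.continuous.mul (continuous_lapY hg)).integrable_of_hasCompactSupport hc.mul_right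
  have i2 : Integrable fun p => f p * (β p.2 * dX g p) :=
    (hf.continuous.mul (hβ'.continuous.mul
      (hg1.continuous_dir _))).integrable_of_hasCompactSupport hc.mul_right
  have hcl : HasCompactSupport (lapY f) := by
    refine HasCompactSupport.intro hc fun p hp => ?_
    rw [lapY_eq]
    refine Finset.sum_eq_zero fun i _ => ?_
    refine image_eq_zero_of_notMem_tsupport fun h => hp ?_
    have hs : ∀ (g : ℝ × Euc N → ℝ), tsupport (dir (eY i) g) ⊆ tsupport g := fun g =>
      closure_minimal (fun q hq => by
        by_contra hcon
        refine hq ?_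
        have := image_eq_zero_of_notMem_tsupport (f := fderiv ℝ g)
          fun h => hcon (tsupport_fderiv_subset ℝ h)
        simp [dir, this]) (isClosed_tsupport g)
    exact hs _ (hs _ h)
  have i3 : Integrable fun p => g p * lapY f p :=
    (hg.continuous.mul (continuous_lapY hf)).integrable_of_hasCompactSupport hcl.mul_left
  have i4 : Integrable fun p => g p * (- β p.2 * dX f p) :=
    (hg.continuous.mul (hβ'.continuous.neg.mul
      (hf1.continuous_dir _))).integrable_of_hasCompactSupport
        (hc.dir eX).mul_left.mul_left
  simp only [opL, mul_add]
  rw [integral_add i1 i2, integral_add i3 i4, h1, h2]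

end Calculus

/-! ### The truncated powers -/

section Truncation

lemma hasDerivAt_max_zero_pow {k : ℕ} (hk : 2 ≤ k) (s : ℝ) :
    HasDerivAt (fun s : ℝ => max s 0 ^ k) (k * max s 0 ^ (k - 1)) s := by
  rcases lt_trichotomy s 0 with hs | hs | hs
  · have h : (fun s : ℝ => max s 0 ^ k) =ᶠ[nhds s] fun _ => 0 := by
      filter_upwards [Iio_mem_nhds hs] with x hx
      rw [max_eq_right (le_of_lt hx), zero_pow (by omega)]
    rw [max_eq_right hs.le, zero_pow (by omega), mul_zero]
    exact (hasDerivAt_const s (0 : ℝ)).congr_of_eventuallyEq h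
  · subst hs
    rw [max_self, zero_pow (by omega), mul_zero, ← hasDerivWithinAt_univ,
      ← Iic_union_Ici (a := (0 : ℝ))]
    refine HasDerivWithinAt.union ?_ ?_
    · refine (hasDerivWithinAt_const (0 : ℝ) _ (0 : ℝ)).congr (fun x hx => ?_) ?_
      · rw [max_eq_right hx, zero_pow (by omega)]
      · simp [show k ≠ 0 by omega]
    · have := (hasDerivAt_pow k (0 : ℝ)).hasDerivWithinAt (s := Ici 0)
      rw [zero_pow (by omega), mul_zero] at this
      refine this.congr (fun x hx => ?_) ?_
      · rw [max_eq_left hx]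
      · simp
  · have h : (fun s : ℝ => max s 0 ^ k) =ᶠ[nhds s] fun x => x ^ k := by
      filter_upwards [Ioi_mem_nhds hs] with x hx
      rw [max_eq_left (le_of_lt hx)]
    rw [max_eq_left hs.le]
    exact (hasDerivAt_pow k s).congr_of_eventuallyEq h

/-- The cube of the positive part. -/
def cube (s : ℝ) : ℝ := max s 0 ^ 3

lemma hasDerivAt_cube (s : ℝ) : HasDerivAt cube (3 * max s 0 ^ 2) s := by
  have := hasDerivAt_max_zero_pow (k := 3) (by norm_num) s
  norm_num at this
  exact this

lemma hasDerivAt_cube_deriv (s : ℝ) :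
    HasDerivAt (fun s : ℝ => 3 * max s 0 ^ 2) (6 * max s 0) s := by
  have := (hasDerivAt_max_zero_pow (k := 2) le_rfl s).const_mul 3
  rwa [show (3 : ℝ) * ((2 : ℕ) * max s 0 ^ (2 - 1)) = 6 * max s 0 by norm_num; ring] at this

lemma contDiff_cube : ContDiff ℝ 2 cube := by
  have h1 : deriv cube = fun s => 3 * max s 0 ^ 2 := funext fun s => (hasDerivAt_cube s).deriv
  have h2 : deriv (fun s : ℝ => 3 * max s 0 ^ 2) = fun s => 6 * max s 0 :=
    funext fun s => (hasDerivAt_cube_deriv s).deriv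
  have h3 : ContDiff ℝ 1 (fun s : ℝ => 3 * max s 0 ^ 2) := by
    rw [contDiff_one_iff_deriv, h2]
    exact ⟨fun s => (hasDerivAt_cube_deriv s).differentiableAt, by fun_prop⟩
  rw [show (2 : WithTop ℕ∞) = 1 + 1 by norm_num, contDiff_succ_iff_deriv, h1]
  exact ⟨fun s => (hasDerivAt_cube s).differentiableAt, by simp, h3⟩

lemma cube_nonneg (s : ℝ) : 0 ≤ cube s := pow_nonneg (le_max_right _ _) _

lemma cube_of_nonpos {s : ℝ} (hs : s ≤ 0) : cube s = 0 := by simp [cube, max_eq_right hs]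

lemma cube_of_nonneg {s : ℝ} (hs : 0 ≤ s) : cube s = s ^ 3 := by simp [cube, max_eq_left hs]

lemma cube_mono : Monotone cube := fun _ _ h =>
  pow_le_pow_left₀ (le_max_right _ _) (max_le_max_right _ h) _

end Truncation

section Tools

variable {N : ℕ}

/-! ### Integrals over balls -/

lemma Continuous.integrableOn_ball {f : ℝ × Euc N → ℝ} (hf : Continuous f) (p : ℝ × Euc N)
    (R : ℝ) : IntegrableOn f (ball p R) :=
  (hf.continuousOn.integrableOn_compact (isCompact_closedBall p R)).mono_set
    ball_subset_closedBall

lemma setIntegral_ball_nonneg {f : ℝ × Euc N → ℝ} {p : ℝ × Euc N} {R : ℝ}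
    (hf : ∀ x ∈ ball p R, 0 ≤ f x) : 0 ≤ ∫ x in ball p R, f x :=
  setIntegral_nonneg measurableSet_ball hf

lemma setIntegral_ball_mono {f g : ℝ × Euc N → ℝ} (hf : Continuous f) (hg : Continuous g)
    {p : ℝ × Euc N} {R : ℝ} (h : ∀ x ∈ ball p R, f x ≤ g x) :
    ∫ x in ball p R, f x ≤ ∫ x in ball p R, g x :=
  setIntegral_mono_on (hf.integrableOn_ball p R) (hg.integrableOn_ball p R) measurableSet_ball h

lemma setIntegral_ball_mono_set {f : ℝ × Euc N → ℝ} (hf : Continuous f) (h0 : ∀ x, 0 ≤ f x)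
    {p : ℝ × Euc N} {R R' : ℝ} (h : R ≤ R') :
    ∫ x in ball p R, f x ≤ ∫ x in ball p R', f x :=
  setIntegral_mono_set (hf.integrableOn_ball p R') (Filter.Eventually.of_forall h0)
    (LE.le.eventuallyLE (ball_subset_ball h))

lemma setIntegral_shift_le_of_forall_mem {f : ℝ × Euc N → ℝ} (hf : Continuous f)
    (h0 : ∀ x, 0 ≤ f x) {A : Set (ℝ × Euc N)} {q s : ℝ × Euc N} {R' : ℝ}
    (h : ∀ x ∈ A, x + s ∈ ball q R') :
    ∫ x in A, f (x + s) ≤ ∫ x in ball q R', f x := by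
  have hmp := measurePreserving_add_right (volume : Measure (ℝ × Euc N)) s
  rw [← hmp.setIntegral_preimage_emb (measurableEmbedding_addRight s) f (ball q R')]
  refine setIntegral_mono_set ?_ (Filter.Eventually.of_forall fun x => h0 _)
    (LE.le.eventuallyLE fun x hx => h x hx)
  exact (hmp.integrableOn_comp_preimage (f := f) (measurableEmbedding_addRight s)).2
    (hf.integrableOn_ball q R')

lemma add_mem_ball_of_mem {p s x : ℝ × Euc N} {R R' : ℝ} (h : R + ‖s‖ ≤ R')
    (hx : x ∈ ball p R) : x + s ∈ ball p R' := by
  rw [mem_ball, dist_eq_norm] at hx ⊢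
  calc ‖x + s - p‖ = ‖(x - p) + s‖ := by congr 1; abel
    _ ≤ ‖x - p‖ + ‖s‖ := norm_add_le _ _
    _ < R' := by linarith

/-- Translating a nonnegative function costs at most an enlargement of the ball. -/
lemma setIntegral_ball_shift_le {f : ℝ × Euc N → ℝ} (hf : Continuous f) (h0 : ∀ x, 0 ≤ f x)
    {p s : ℝ × Euc N} {R R' : ℝ} (h : R + ‖s‖ ≤ R') :
    ∫ x in ball p R, f (x + s) ≤ ∫ x in ball p R', f x :=
  setIntegral_shift_le_of_forall_mem hf h0 fun _ hx => add_mem_ball_of_mem h hx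

lemma abs_integral_le_setIntegral_ball {F G : ℝ × Euc N → ℝ} (hF : Continuous F)
    (hG : Continuous G) {p : ℝ × Euc N} {R : ℝ} (h : ∀ x ∈ ball p R, |F x| ≤ G x)
    (h0 : ∀ x ∉ ball p R, F x = 0) : |∫ x, F x| ≤ ∫ x in ball p R, G x := by
  rw [← setIntegral_eq_integral_of_forall_compl_eq_zero h0]
  refine (abs_integral_le_integral_abs).trans ?_
  exact setIntegral_ball_mono hF.abs hG h

lemma sq_intervalIntegral_le {f : ℝ → ℝ} (hf : Continuous f) :
    (∫ s in (0 : ℝ)..1, f s) ^ 2 ≤ ∫ s in (0 : ℝ)..1, f s ^ 2 := by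
  set c := ∫ s in (0 : ℝ)..1, f s with hc
  have h : 0 ≤ ∫ s in (0 : ℝ)..1, (f s - c) ^ 2 :=
    intervalIntegral.integral_nonneg zero_le_one fun s _ => sq_nonneg _
  have e : ∫ s in (0 : ℝ)..1, (f s - c) ^ 2 = (∫ s in (0 : ℝ)..1, f s ^ 2) - c ^ 2 := by
    have : ∀ s, (f s - c) ^ 2 = f s ^ 2 - (2 * c * f s - c ^ 2) := fun s => by ring
    simp only [this]
    rw [intervalIntegral.integral_sub, intervalIntegral.integral_sub,
      intervalIntegral.integral_const_mul, ← hc]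
    · simp; ring
    all_goals exact Continuous.intervalIntegrable (by fun_prop) _ _
  linarith

lemma shift_sub_eq_intervalIntegral {f : ℝ × Euc N → ℝ} (hf : ContDiff ℝ 1 f)
    (p e : ℝ × Euc N) :
    f (p + e) - f p = ∫ θ in (0 : ℝ)..1, dir e f (p + θ • e) := by
  have h : ∀ θ ∈ uIcc (0 : ℝ) 1,
      HasDerivAt (fun θ : ℝ => f (p + θ • e)) (dir e f (p + θ • e)) θ := by
    intro θ _
    have h1 : HasDerivAt (fun θ : ℝ => p + θ • e) e θ := by
      simpa using ((hasDerivAt_id θ).smul_const e).const_add p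
    exact (hf.diffAt _).hasFDerivAt.comp_hasDerivAt θ h1
  rw [intervalIntegral.integral_eq_sub_of_hasDerivAt h]
  · simp
  · exact ((hf.continuous_dir e).comp (by fun_prop)).intervalIntegrable _ _

lemma setIntegral_intervalIntegral_shift_le {G : ℝ × Euc N → ℝ} (hG : Continuous G)
    (h0 : ∀ x, 0 ≤ G x) {p e : ℝ × Euc N} {R R' : ℝ} (h : R + ‖e‖ ≤ R') :
    ∫ x in ball p R, (∫ θ in (0 : ℝ)..1, G (x + θ • e)) ≤ ∫ x in ball p R', G x := by
  simp only [intervalIntegral.integral_of_le zero_le_one]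
  rw [integral_integral_swap]
  · have hle : ∀ θ ∈ Ioc (0 : ℝ) 1,
        ∫ x in ball p R, G (x + θ • e) ≤ ∫ x in ball p R', G x := by
      intro θ hθ
      refine setIntegral_ball_shift_le hG h0 ?_
      rw [norm_smul, Real.norm_of_nonneg hθ.1.le]
      nlinarith [norm_nonneg e, hθ.2]
    calc ∫ θ in Ioc (0 : ℝ) 1, ∫ x in ball p R, G (x + θ • e)
        ≤ ∫ θ in Ioc (0 : ℝ) 1, ∫ x in ball p R', G x := by
          refine setIntegral_mono_on ?_ ?_ measurableSet_Ioc hle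
          · have hc : Continuous fun θ : ℝ => ∫ x in closedBall p R ∩ ball p R, G (x + θ • e) := by
              rw [show closedBall p R ∩ ball p R = ball p R from
                inter_eq_right.2 ball_subset_closedBall]
              have := continuous_parametric_integral_of_continuous
                (μ := volume.restrict (ball p R)) (f := fun (θ : ℝ) x => G (x + θ • e))
                (s := closedBall p R) (by fun_prop) (isCompact_closedBall p R)
              rwa [Measure.restrict_restrict measurableSet_closedBall,
                show closedBall p R ∩ ball p R = ball p R from
                inter_eq_right.2 ball_subset_closedBall] at this
            rw [show closedBall p R ∩ ball p R = ball p R from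
                inter_eq_right.2 ball_subset_closedBall] at hc
            exact (hc.continuousOn.integrableOn_compact isCompact_Icc).mono_set Ioc_subset_Icc_self
          · exact integrableOn_const (by simp)
      _ = ∫ x in ball p R', G x := by simp
  · rw [Measure.prod_restrict]
    refine IntegrableOn.mono_set (t := closedBall p R ×ˢ Icc (0 : ℝ) 1) ?_
      (prod_mono ball_subset_closedBall Ioc_subset_Icc_self)
    refine ContinuousOn.integrableOn_compact ((isCompact_closedBall p R).prod isCompact_Icc) ?_
    exact Continuous.continuousOn (by fun_prop)

/-- The `L²` difference quotient in a direction is controlled by the derivative. -/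
lemma setIntegral_sq_shift_sub_le {f : ℝ × Euc N → ℝ} (hf : ContDiff ℝ 1 f)
    {p e : ℝ × Euc N} {R R' : ℝ} (h : R + ‖e‖ ≤ R') :
    ∫ x in ball p R, (f (x + e) - f x) ^ 2 ≤ ∫ x in ball p R', (dir e f x) ^ 2 := by
  refine le_trans ?_ (setIntegral_intervalIntegral_shift_le (G := fun x => dir e f x ^ 2)
    ((hf.continuous_dir e).pow 2) (fun x => sq_nonneg _) h)
  refine setIntegral_ball_mono ?_ ?_ fun x _ => ?_
  · have := hf.continuous
    fun_prop
  · refine intervalIntegral.continuous_parametric_intervalIntegral_of_continuous' ?_ 0 1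
    have := hf.continuous_dir e
    simp only [Function.uncurry_def]
    fun_prop
  · rw [shift_sub_eq_intervalIntegral hf]
    have := hf.continuous_dir e
    exact sq_intervalIntegral_le (by fun_prop)

lemma dir_snd_eq_sum {f : ℝ × Euc N → ℝ} (p : ℝ × Euc N) (z : Euc N) :
    dir (0, z) f p = ∑ i, z i * dir (eY i) f p := by
  have hz : ((0 : ℝ), z) = ∑ i, z i • (eY i : ℝ × Euc N) := by
    have h1 : z = ∑ i, z i • EuclideanSpace.single i (1 : ℝ) := by
      ext j
      simp [Finset.sum_apply, Pi.single_apply]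
    refine Prod.ext ?_ ?_
    · simp [Prod.fst_sum, eY]
    · rw [Prod.snd_sum]
      simpa [eY] using h1
  unfold dir
  rw [hz, map_sum]
  simp

lemma sq_dir_snd_le {f : ℝ × Euc N → ℝ} (p : ℝ × Euc N) (z : Euc N) :
    (dir (0, z) f p) ^ 2 ≤ ‖z‖ ^ 2 * gradSq f p := by
  rw [dir_snd_eq_sum, EuclideanSpace.norm_sq_eq]
  simpa [gradSq] using Finset.sum_mul_sq_le_sq_mul_sq Finset.univ (fun i => z i)
    (fun i => dir (eY i) f p)

lemma setIntegral_sq_shift_snd_sub_le {f : ℝ × Euc N → ℝ} (hf : ContDiff ℝ 1 f)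
    {p : ℝ × Euc N} {z : Euc N} {R R' : ℝ} (h : R + ‖z‖ ≤ R') :
    ∫ x in ball p R, (f (x + (0, z)) - f x) ^ 2 ≤ ‖z‖ ^ 2 * ∫ x in ball p R', gradSq f x := by
  refine (setIntegral_sq_shift_sub_le hf (e := (0, z)) (R' := R') ?_).trans ?_
  · simpa [Prod.norm_def] using h
  · rw [← integral_const_mul]
    refine setIntegral_ball_mono ((hf.continuous_dir _).pow 2)
      (continuous_const.mul (continuous_gradSq hf)) fun x _ => sq_dir_snd_le x z

/-- Mean value inequality for the pairing of translates with a compactly supported function. -/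
lemma integral_mul_shift_sub_le {K f : ℝ × Euc N → ℝ} (hK : Continuous K)
    (hKc : HasCompactSupport K) (hf : ContDiff ℝ 1 f) {t X : ℝ} (ht : 0 ≤ t)
    (hX : ∀ s ∈ Icc 0 t, ∫ p, K p * dir eX f (p + (s, 0)) ≤ X) :
    ∫ p, K p * (f (p + (t, 0)) - f p) ≤ t * X := by
  have hcf := hf.continuous
  have hcd := hf.continuous_dir eX
  have hinteg : ∀ h : ℝ × Euc N → ℝ, Continuous h → Integrable fun p => K p * h p :=
    fun h hh => (hK.mul hh).integrable_of_hasCompactSupport hKc.mul_right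
  have hderiv : ∀ s : ℝ, HasDerivAt (fun s : ℝ => ∫ p, K p * f (p + (s, 0)))
      (∫ p, K p * dir eX f (p + (s, 0))) s := by
    intro s
    obtain ⟨C, hC⟩ := ((isCompact_closedBall s 1).prod hKc.isCompact).exists_bound_of_continuousOn
      (f := fun z : ℝ × (ℝ × Euc N) => K z.2 * dir eX f (z.2 + (z.1, 0)))
      (Continuous.continuousOn (by fun_prop))
    refine (hasDerivAt_integral_of_dominated_loc_of_deriv_le
      (F' := fun s p => K p * dir eX f (p + (s, 0)))
      (bound := (tsupport K).indicator fun _ => C) (ball_mem_nhds s one_pos) ?_ ?_ ?_ ?_ ?_ ?_).2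
    · exact Filter.Eventually.of_forall fun s =>
        (hinteg _ (by fun_prop : Continuous fun p => f (p + (s, 0)))).aestronglyMeasurable
    · exact hinteg _ (by fun_prop : Continuous fun p => f (p + (s, 0)))
    · exact (hinteg _ (by fun_prop :
        Continuous fun p => dir eX f (p + (s, 0)))).aestronglyMeasurable
    · refine Filter.Eventually.of_forall fun p s' hs' => ?_
      by_cases hp : p ∈ tsupport K
      · rw [indicator_of_mem hp]
        exact hC (s', p) ⟨ball_subset_closedBall hs', hp⟩
      · rw [indicator_of_notMem hp, image_eq_zero_of_notMem_tsupport hp]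
        simp
    · exact (integrable_indicator_iff hKc.isCompact.measurableSet).2
        (integrableOn_const hKc.isCompact.measure_lt_top.ne)
    · refine Filter.Eventually.of_forall fun p s' _ => ?_
      refine HasDerivAt.const_mul _ ?_
      have h1 : HasDerivAt (fun s : ℝ => p + ((s, 0) : ℝ × Euc N)) eX s' := by
        have := ((hasDerivAt_id s').prodMk (hasDerivAt_const s' (0 : Euc N))).const_add p
        simpa [eX] using this
      exact (hf.diffAt _).hasFDerivAt.comp_hasDerivAt s' h1
  have hcont : ContinuousOn (fun s : ℝ => ∫ p, K p * f (p + (s, 0))) (Icc 0 t) :=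
    fun s _ => (hderiv s).continuousAt.continuousWithinAt
  have hmain := (convex_Icc 0 t).image_sub_le_mul_sub_of_deriv_le hcont
    (fun s _ => (hderiv s).differentiableAt.differentiableWithinAt) (C := X)
    (fun s hs => by
      rw [(hderiv s).deriv]
      exact hX s (interior_subset hs))
    0 (left_mem_Icc.2 ht) t (right_mem_Icc.2 ht) ht
  simp only [mul_sub]
  rw [integral_sub (hinteg _ (by fun_prop : Continuous fun p => f (p + (t, 0)))) (hinteg _ hcf)]
  simp only [show ((0 : ℝ), (0 : Euc N)) = 0 from rfl, add_zero, sub_zero] at hmain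
  linarith

end Tools

section Cutoff

variable {N : ℕ}

/-! ### Quadratic functions -/

/-- The quadratic function `c - A (x - x₀)² - B |y - y₀|²`. -/
def quad (c A B : ℝ) (p₀ p : ℝ × Euc N) : ℝ :=
  c - A * (p.1 - p₀.1) ^ 2 - B * ‖p.2 - p₀.2‖ ^ 2

lemma contDiff_quad {n : WithTop ℕ∞} (c A B : ℝ) (p₀ : ℝ × Euc N) :
    ContDiff ℝ n (quad c A B p₀) := by
  unfold quad
  have h : ContDiff ℝ n fun p : ℝ × Euc N => ‖p.2 - p₀.2‖ ^ 2 :=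
    (contDiff_snd.sub contDiff_const).norm_sq ℝ
  have h' : ContDiff ℝ n fun p : ℝ × Euc N => (p.1 - p₀.1) ^ 2 :=
    (contDiff_fst.sub contDiff_const).pow 2
  exact (contDiff_const.sub (contDiff_const.mul h')).sub (contDiff_const.mul h)

lemma dir_quad (c A B : ℝ) (p₀ p e : ℝ × Euc N) :
    dir e (quad c A B p₀) p
      = -(2 * A * (p.1 - p₀.1) * e.1) - 2 * B * inner ℝ (p.2 - p₀.2) e.2 := by
  have h1 : HasFDerivAt (fun p : ℝ × Euc N => p.1 - p₀.1)
      (ContinuousLinearMap.fst ℝ ℝ (Euc N)) p := hasFDerivAt_fst.sub_const _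
  have h2 : HasFDerivAt (fun p : ℝ × Euc N => p.2 - p₀.2)
      (ContinuousLinearMap.snd ℝ ℝ (Euc N)) p := hasFDerivAt_snd.sub_const _
  have h := (((h1.pow 2).const_mul A).const_sub c).sub (h2.norm_sq.const_mul B)
  unfold dir
  rw [(show HasFDerivAt (quad c A B p₀) _ p from h).fderiv]
  simp [inner_sub_left]
  ring

lemma dir_eX_quad (c A B : ℝ) (p₀ p : ℝ × Euc N) :
    dir eX (quad c A B p₀) p = -(2 * A * (p.1 - p₀.1)) := by
  simp [dir_quad, eX]

lemma dir_eY_quad (c A B : ℝ) (p₀ p : ℝ × Euc N) (i : Fin (N - 1)) :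
    dir (eY i) (quad c A B p₀) p = -(2 * B * (p.2 - p₀.2) i) := by
  simp [dir_quad, eY, EuclideanSpace.inner_single_right]

lemma lapY_quad (c A B : ℝ) (p₀ p : ℝ × Euc N) :
    lapY (quad c A B p₀) p = -(2 * B * (N - 1 : ℕ)) := by
  rw [lapY_eq]
  have : ∀ i : Fin (N - 1), dir (eY i) (dir (eY i) (quad c A B p₀)) p = -(2 * B) := by
    intro i
    rw [show dir (eY i) (quad c A B p₀) = fun p => -(2 * B * (p.2 - p₀.2) i) from
      funext fun p => dir_eY_quad c A B p₀ p i]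
    have h : HasFDerivAt (fun p : ℝ × Euc N => -(2 * B * (p.2 - p₀.2) i))
        (-((2 * B) • ((EuclideanSpace.proj i : Euc N →L[ℝ] ℝ).comp
          (ContinuousLinearMap.snd ℝ ℝ (Euc N))))) p := by
      have h2 : HasFDerivAt (fun p : ℝ × Euc N => p.2 - p₀.2)
        (ContinuousLinearMap.snd ℝ ℝ (Euc N)) p := hasFDerivAt_snd.sub_const _
      exact (((EuclideanSpace.proj i : Euc N →L[ℝ] ℝ).hasFDerivAt.comp p h2).const_mul _).neg
    unfold dir
    rw [h.fderiv]
    simp [eY]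
  simp only [this]
  simp
  ring

lemma gradSq_quad (c A B : ℝ) (p₀ p : ℝ × Euc N) :
    gradSq (quad c A B p₀) p = 4 * B ^ 2 * ‖p.2 - p₀.2‖ ^ 2 := by
  simp only [gradSq, dir_eY_quad, EuclideanSpace.norm_sq_eq, Finset.mul_sum]
  refine Finset.sum_congr rfl fun i _ => ?_
  rw [Real.norm_eq_abs, sq_abs]
  ring

/-! ### Cutoff functions -/

lemma deriv_smoothTransition_nonneg (s : ℝ) : 0 ≤ deriv Real.smoothTransition s :=
  Real.smoothTransition.monotone.deriv_nonneg

lemma deriv_smoothTransition_eq_zero {s : ℝ} (h : s ≤ 0 ∨ 1 ≤ s) :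
    deriv Real.smoothTransition s = 0 := by
  rcases h with h | h
  · refine IsLocalMin.deriv_eq_zero (Filter.Eventually.of_forall fun x => ?_)
    rw [Real.smoothTransition.zero_of_nonpos h]
    exact Real.smoothTransition.nonneg x
  · refine IsLocalMax.deriv_eq_zero (Filter.Eventually.of_forall fun x => ?_)
    rw [Real.smoothTransition.one_of_one_le h]
    exact Real.smoothTransition.le_one x

lemma deriv_deriv_smoothTransition_eq_zero {s : ℝ} (h : s ≤ 0 ∨ 1 ≤ s) :
    deriv (deriv Real.smoothTransition) s = 0 := by
  refine IsLocalMin.deriv_eq_zero (Filter.Eventually.of_forall fun x => ?_)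
  rw [deriv_smoothTransition_eq_zero h]
  exact deriv_smoothTransition_nonneg x

lemma contDiff_deriv_smoothTransition : ContDiff ℝ 1 (deriv Real.smoothTransition) := by
  have h : ContDiff ℝ (1 + 1) Real.smoothTransition :=
    Real.smoothTransition.contDiff.of_le (m := 1 + 1) (n := ((2 : ℕ∞) : WithTop ℕ∞))
      (by norm_num)
  exact (contDiff_succ_iff_deriv.1 h).2.2

lemma exists_bound_of_eq_zero {f : ℝ → ℝ} (hf : Continuous f)
    (h : ∀ s, s ≤ 0 ∨ 1 ≤ s → f s = 0) : ∃ C ≥ 0, ∀ s, |f s| ≤ C := by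
  obtain ⟨C, hC⟩ := (isCompact_Icc (a := (0 : ℝ)) (b := 1)).exists_bound_of_continuousOn
    hf.continuousOn
  have hC0 : 0 ≤ C := (norm_nonneg _).trans (hC 0 (by simp))
  refine ⟨C, hC0, fun s => ?_⟩
  by_cases hs : s ∈ Icc (0 : ℝ) 1
  · exact hC s hs
  · rw [h s, abs_zero]
    · exact hC0
    · rw [mem_Icc, not_and_or, not_le, not_le] at hs
      exact hs.imp le_of_lt le_of_lt

lemma mem_ball_prod_iff {p₀ p : ℝ × Euc N} {R : ℝ} :
    p ∈ ball p₀ R ↔ |p.1 - p₀.1| < R ∧ ‖p.2 - p₀.2‖ < R := by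
  rw [mem_ball, dist_eq_norm, Prod.norm_def, max_lt_iff]
  simp [Real.norm_eq_abs]

lemma mem_closedBall_prod_iff {p₀ p : ℝ × Euc N} {R : ℝ} :
    p ∈ closedBall p₀ R ↔ |p.1 - p₀.1| ≤ R ∧ ‖p.2 - p₀.2‖ ≤ R := by
  rw [mem_closedBall, dist_eq_norm, Prod.norm_def, max_le_iff]
  simp [Real.norm_eq_abs]

/-- Cutoff functions between concentric balls, with bounds on their derivatives. -/
structure IsCutoff (C : ℝ) (p₀ : ℝ × Euc N) (R R' : ℝ) (χ : ℝ × Euc N → ℝ) : Prop where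
  contDiff : ContDiff ℝ 2 χ
  nonneg : ∀ p, 0 ≤ χ p
  le_one : ∀ p, χ p ≤ 1
  eq_one : ∀ p ∈ closedBall p₀ R, χ p = 1
  eq_zero : ∀ p ∉ ball p₀ R', χ p = 0
  dirX_le : ∀ p, |dir eX χ p| ≤ C * ((R' - R)⁻¹) ^ 4
  dirY_le : ∀ p i, |dir (eY i) χ p| ≤ C * ((R' - R)⁻¹) ^ 4
  lapY_le : ∀ p, |lapY χ p| ≤ C * ((R' - R)⁻¹) ^ 4
  lapY_eq_zero : ∀ p ∉ ball p₀ R', lapY χ p = 0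

lemma IsCutoff.dir_eq_zero {C : ℝ} {p₀ : ℝ × Euc N} {R R' : ℝ} {χ : ℝ × Euc N → ℝ}
    (h : IsCutoff C p₀ R R' χ) {p : ℝ × Euc N} (hp : p ∉ ball p₀ R') (e : ℝ × Euc N) :
    dir e χ p = 0 := by
  have : IsLocalMin χ p := Filter.Eventually.of_forall fun q => by
    rw [h.eq_zero p hp]; exact h.nonneg q
  simp [dir, this.fderiv_eq_zero]

lemma IsCutoff.hasCompactSupport {C : ℝ} {p₀ : ℝ × Euc N} {R R' : ℝ} {χ : ℝ × Euc N → ℝ}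
    (h : IsCutoff C p₀ R R' χ) : HasCompactSupport χ :=
  HasCompactSupport.intro (isCompact_closedBall p₀ R') fun p hp =>
    h.eq_zero p fun hp' => hp (ball_subset_closedBall hp')

lemma exists_isCutoff (N : ℕ) : ∃ C ≥ (1 : ℝ), ∀ (p₀ : ℝ × Euc N) (R R' : ℝ), 0 < R → R < R' →
    R' ≤ 1 → ∃ χ, IsCutoff C p₀ R R' χ := by
  set S := Real.smoothTransition
  obtain ⟨C₁, hC₁, hS₁⟩ := exists_bound_of_eq_zero contDiff_deriv_smoothTransition.continuous
    fun s => deriv_smoothTransition_eq_zero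
  obtain ⟨C₂, hC₂, hS₂⟩ := exists_bound_of_eq_zero
    (contDiff_deriv_smoothTransition.continuous_deriv le_rfl)
    fun s => deriv_deriv_smoothTransition_eq_zero
  have hSd : ∀ s, HasDerivAt S (deriv S s) s := fun s =>
    ((Real.smoothTransition.contDiff (n := 1)).differentiable (by simp) s).hasDerivAt
  have hSdd : ∀ s, HasDerivAt (deriv S) (deriv (deriv S) s) s := fun s =>
    (contDiff_deriv_smoothTransition.differentiable one_ne_zero s).hasDerivAt
  have hS2 : ContDiff ℝ 2 S := Real.smoothTransition.contDiff (n := 2)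
  set n : ℝ := ((N - 1 : ℕ) : ℝ)
  have hn : 0 ≤ n := Nat.cast_nonneg _
  refine ⟨1 + 2 * C₁ + 2 * C₁ * n + 4 * C₂, by nlinarith [mul_nonneg hC₁ hn],
    fun p₀ R R' hR hRR' hR' => ?_⟩
  set k := (R' ^ 2 - R ^ 2)⁻¹ with hk
  set G := (R' - R)⁻¹ with hG
  have hd : 0 < R' - R := sub_pos.2 hRR'
  have hd2 : (R' - R) ^ 2 ≤ R' ^ 2 - R ^ 2 := by nlinarith
  have hden : 0 < R' ^ 2 - R ^ 2 := lt_of_lt_of_le (by positivity) hd2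
  have hk0 : 0 < k := inv_pos.2 hden
  have hG1 : 1 ≤ G := (one_le_inv₀ hd).2 (by linarith)
  have hkG : k ≤ G ^ 2 := by
    rw [hk, hG, inv_pow]
    exact inv_anti₀ (by positivity) hd2
  have hG24 : G ^ 2 ≤ G ^ 4 := pow_le_pow_right₀ hG1 (by norm_num)
  have hk4 : k ≤ G ^ 4 := hkG.trans hG24
  have hkk : k ^ 2 ≤ G ^ 4 := by nlinarith [sq_nonneg G]
  have hG4 : 0 ≤ G ^ 4 := by positivity
  set a : ℝ × Euc N → ℝ := quad (k * R' ^ 2) k 0 p₀ with ha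
  set b : ℝ × Euc N → ℝ := quad (k * R' ^ 2) 0 k p₀ with hb
  have ha2 : ContDiff ℝ 2 a := contDiff_quad _ _ _ _
  have hb2 : ContDiff ℝ 2 b := contDiff_quad _ _ _ _
  have hav : ∀ p, a p = k * (R' ^ 2 - (p.1 - p₀.1) ^ 2) := fun p => by simp [ha, quad]; ring
  have hbv : ∀ p, b p = k * (R' ^ 2 - ‖p.2 - p₀.2‖ ^ 2) := fun p => by simp [hb, quad]; ring
  have hF : ContDiff ℝ 2 fun p => S (a p) := hS2.comp ha2
  have hGG : ContDiff ℝ 2 fun p => S (b p) := hS2.comp hb2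
  have hS0 : ∀ s, 0 ≤ S s := Real.smoothTransition.nonneg
  have hS1 : ∀ s, S s ≤ 1 := Real.smoothTransition.le_one
  have hFi : ∀ i p, dir (eY i) (fun p => S (a p)) p = 0 := fun i p => by
    rw [dir_comp (hSd _) (ha2.one_of_two.diffAt p), ha, dir_eY_quad]; simp
  have hGx : ∀ p, dir eX (fun p => S (b p)) p = 0 := fun p => by
    rw [dir_comp (hSd _) (hb2.one_of_two.diffAt p), hb, dir_eX_quad]; simp
  have hFx : ∀ p, |dir eX (fun p => S (a p)) p| ≤ 2 * C₁ * k := fun p => by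
    rw [dir_comp (hSd _) (ha2.one_of_two.diffAt p)]
    by_cases hp : |p.1 - p₀.1| ≤ 1
    · rw [ha, dir_eX_quad, abs_mul, abs_neg, abs_mul, abs_of_pos (by positivity : 0 < 2 * k)]
      have h1 := hS₁ (a p)
      calc _ ≤ C₁ * (2 * k * 1) := by gcongr
        _ = _ := by ring
    · have : a p ≤ 0 := by
        rw [hav]
        have : 1 < |p.1 - p₀.1| := not_le.1 hp
        have h2 : 1 ≤ (p.1 - p₀.1) ^ 2 := by rw [← sq_abs]; nlinarith
        exact mul_nonpos_of_nonneg_of_nonpos hk0.le (by nlinarith)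
      rw [deriv_smoothTransition_eq_zero (Or.inl this)]
      simp; positivity
  have hcases : ∀ p, ‖p.2 - p₀.2‖ ≤ 1 ∨ b p ≤ 0 := fun p => by
    by_cases hp : ‖p.2 - p₀.2‖ ≤ 1
    · exact Or.inl hp
    · right
      rw [hbv]
      exact mul_nonpos_of_nonneg_of_nonpos hk0.le (by nlinarith [not_le.1 hp])
  have hGi : ∀ i p, |dir (eY i) (fun p => S (b p)) p| ≤ 2 * C₁ * k := fun i p => by
    rw [dir_comp (hSd _) (hb2.one_of_two.diffAt p)]
    rcases hcases p with hp | hp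
    · rw [hb, dir_eY_quad, abs_mul, abs_neg, abs_mul, abs_of_pos (by positivity : 0 < 2 * k)]
      have h1 := hS₁ (b p)
      have h2 : |(p.2 - p₀.2) i| ≤ 1 := (PiLp.norm_apply_le (p.2 - p₀.2) i).trans hp
      calc _ ≤ C₁ * (2 * k * 1) := by gcongr
        _ = _ := by ring
    · rw [deriv_smoothTransition_eq_zero (Or.inl hp)]
      simp; positivity
  have hGlap : ∀ p, |lapY (fun p => S (b p)) p| ≤ 2 * C₁ * n * k + 4 * C₂ * k ^ 2 := fun p => by
    rw [lapY_comp hSd hSdd hb2]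
    rcases hcases p with hp | hp
    · rw [hb, lapY_quad, gradSq_quad]
      refine (abs_add_le _ _).trans ?_
      rw [abs_mul, abs_mul, abs_neg, abs_of_nonneg (by positivity : 0 ≤ 2 * k * n),
        abs_of_nonneg (by positivity : 0 ≤ 4 * k ^ 2 * ‖p.2 - p₀.2‖ ^ 2)]
      have h1 := hS₁ (b p)
      have h2 := hS₂ (b p)
      calc _ ≤ C₁ * (2 * k * n) + C₂ * (4 * k ^ 2 * 1 ^ 2) := by gcongr
        _ = _ := by ring
    · rw [deriv_smoothTransition_eq_zero (Or.inl hp),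
        deriv_deriv_smoothTransition_eq_zero (Or.inl hp)]
      simp; positivity
  have hYi : ∀ i p, dir (eY i) (fun p => S (a p) * S (b p)) p
      = S (a p) * dir (eY i) (fun p => S (b p)) p := fun i p => by
    rw [dir_mul (hF.one_of_two.diffAt p) (hGG.one_of_two.diffAt p), hFi]; ring
  have hl : ∀ p, lapY (fun p => S (a p) * S (b p)) p = S (a p) * lapY (fun p => S (b p)) p := by
      intro p
      simp only [lapY_eq, Finset.mul_sum]
      refine Finset.sum_congr rfl fun i _ => ?_
      rw [show dir (eY i) (fun p => S (a p) * S (b p))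
        = fun p => S (a p) * dir (eY i) (fun p => S (b p)) p from funext (hYi i),
        dir_mul (hF.one_of_two.diffAt p) ((hGG.dir_one _).diffAt p), hFi]
      ring
  have hzero : ∀ p ∉ ball p₀ R', a p ≤ 0 ∨ b p ≤ 0 := fun p hp => by
    rw [mem_ball_prod_iff, not_and_or, not_lt, not_lt] at hp
    rcases hp with hp | hp
    · left
      rw [hav]
      have h2 : R' ^ 2 ≤ (p.1 - p₀.1) ^ 2 := by rw [← sq_abs (p.1 - p₀.1)]; nlinarith
      exact mul_nonpos_of_nonneg_of_nonpos hk0.le (by linarith)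
    · right
      rw [hbv]
      exact mul_nonpos_of_nonneg_of_nonpos hk0.le (by nlinarith)
  refine ⟨fun p => S (a p) * S (b p), ⟨hF.mul hGG, fun p => mul_nonneg (hS0 _) (hS0 _),
    fun p => mul_le_one₀ (hS1 _) (hS0 _) (hS1 _), fun p hp => ?_, fun p hp => ?_,
    fun p => ?_, fun p i => ?_, fun p => ?_, fun p hp => ?_⟩⟩
  · rw [mem_closedBall_prod_iff] at hp
    have h1 : 1 ≤ a p := by
      rw [hav, hk, ← div_eq_inv_mul, le_div_iff₀ hden]
      have := sq_le_sq' (by linarith [abs_le.1 hp.1, abs_nonneg (p.1 - p₀.1)]) (abs_le.1 hp.1).2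
      linarith
    have h2 : 1 ≤ b p := by
      rw [hbv, hk, ← div_eq_inv_mul, le_div_iff₀ hden]
      nlinarith [norm_nonneg (p.2 - p₀.2)]
    simp only [S]
    rw [Real.smoothTransition.one_of_one_le h1, Real.smoothTransition.one_of_one_le h2, one_mul]
  · simp only [S]
    rcases hzero p hp with h | h <;> simp [Real.smoothTransition.zero_of_nonpos h]
  · rw [dir_mul (hF.one_of_two.diffAt p) (hGG.one_of_two.diffAt p), hGx, mul_zero, add_zero,
      abs_mul, abs_of_nonneg (hS0 (b p))]
    have h1 := hFx p
    calc _ ≤ (2 * C₁ * k) * 1 := mul_le_mul h1 (hS1 _) (hS0 _) (by positivity)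
      _ ≤ (2 * C₁ * G ^ 4) * 1 := by gcongr
      _ ≤ _ := by nlinarith [mul_nonneg hC₁ hn, mul_nonneg (mul_nonneg hC₁ hn) hG4, mul_nonneg hC₂ hG4]
  · rw [hYi, abs_mul, abs_of_nonneg (hS0 (a p))]
    have h1 := hGi i p
    calc _ ≤ 1 * (2 * C₁ * k) := mul_le_mul (hS1 _) h1 (abs_nonneg _) zero_le_one
      _ ≤ 1 * (2 * C₁ * G ^ 4) := by gcongr
      _ ≤ _ := by nlinarith [mul_nonneg hC₁ hn, mul_nonneg (mul_nonneg hC₁ hn) hG4, mul_nonneg hC₂ hG4]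
  · rw [hl, abs_mul, abs_of_nonneg (hS0 (a p))]
    have h1 := hGlap p
    calc _ ≤ 1 * (2 * C₁ * n * k + 4 * C₂ * k ^ 2) :=
          mul_le_mul (hS1 _) h1 (abs_nonneg _) zero_le_one
      _ ≤ 1 * (2 * C₁ * n * G ^ 4 + 4 * C₂ * G ^ 4) := by gcongr
      _ ≤ _ := by nlinarith [mul_nonneg hC₁ hG4]
  · rw [hl]
    rcases hzero p hp with h | h
    · simp only [S]
      rw [Real.smoothTransition.zero_of_nonpos h, zero_mul]
    · rw [lapY_comp hSd hSdd hb2, deriv_smoothTransition_eq_zero (Or.inl h),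
        deriv_deriv_smoothTransition_eq_zero (Or.inl h)]
      simp

end Cutoff

section Nikolskii

variable {N : ℕ}

/-- `β` is of class `C¹`, and `β` and its gradient are bounded by `B`. -/
structure BoundedDrift (β : Euc N → ℝ) (B : ℝ) : Prop where
  contDiff : ContDiff ℝ 1 β
  one_le : 1 ≤ B
  abs_le : ∀ y, |β y| ≤ B
  norm_fderiv_le : ∀ y, ‖fderiv ℝ β y‖ ≤ B

/-- A quantitative finite type condition: near every point of `W`, at every scale `σ`, one of
finitely many shifts moves to a point at which `β` is at least `c σ ^ j` in absolute value. -/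
structure FiniteType (β : Euc N → ℝ) (W : Set (Euc N)) (Z : Finset (Euc N)) (ρ c : ℝ) (j : ℕ) :
    Prop where
  rho_pos : 0 < ρ
  rho_le : ρ ≤ 1
  c_pos : 0 < c
  norm_le : ∀ ζ ∈ Z, ‖ζ‖ ≤ 1
  exists_le : ∀ y ∈ W, ∀ σ ∈ Ioc 0 ρ, ∃ ζ ∈ Z, c * σ ^ j ≤ |β (y + σ • ζ)|

/-- The energy density attached to `Δ_y + β ∂_x`. -/
def energy (β : Euc N → ℝ) (w : ℝ × Euc N → ℝ) (p : ℝ × Euc N) : ℝ :=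
  |opL β w p| + gradSq w p + w p ^ 2

lemma energy_nonneg (β : Euc N → ℝ) (w : ℝ × Euc N → ℝ) (p : ℝ × Euc N) : 0 ≤ energy β w p := by
  have := gradSq_nonneg w p
  unfold energy
  positivity

lemma continuous_energy {β : Euc N → ℝ} (hβ : Continuous β) {w : ℝ × Euc N → ℝ}
    (hw : ContDiff ℝ 2 w) : Continuous (energy β w) :=
  ((continuous_opL hβ hw).abs.add (continuous_gradSq hw.one_of_two)).add (hw.continuous.pow 2)

lemma sq_le_energy (β : Euc N → ℝ) (w : ℝ × Euc N → ℝ) (p : ℝ × Euc N) :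
    w p ^ 2 + gradSq w p ≤ energy β w p := by
  unfold energy
  linarith [abs_nonneg (opL β w p)]

lemma sq_dir_le_gradSq (w : ℝ × Euc N → ℝ) (i : Fin (N - 1)) (p : ℝ × Euc N) :
    dir (eY i) w p ^ 2 ≤ gradSq w p :=
  Finset.single_le_sum (f := fun i => dir (eY i) w p ^ 2) (fun _ _ => sq_nonneg _)
    (Finset.mem_univ i)

lemma dir_comp_snd {β : Euc N → ℝ} (hβ : ContDiff ℝ 1 β) (p e : ℝ × Euc N) :
    dir e (fun p : ℝ × Euc N => β p.2) p = fderiv ℝ β p.2 e.2 := by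
  have hd : DifferentiableAt ℝ β p.2 := (hβ.differentiable one_ne_zero) _
  have : HasFDerivAt (fun p : ℝ × Euc N => β p.2)
    ((fderiv ℝ β p.2).comp (ContinuousLinearMap.snd ℝ ℝ (Euc N))) p :=
    hd.hasFDerivAt.comp p hasFDerivAt_snd
  unfold dir
  rw [this.fderiv]
  simp

lemma BoundedDrift.abs_dir_le {β : Euc N → ℝ} {B : ℝ} (hβ : BoundedDrift β B) (p : ℝ × Euc N)
    (i : Fin (N - 1)) : |dir (eY i) (fun p : ℝ × Euc N => β p.2) p| ≤ B := by
  rw [dir_comp_snd hβ.contDiff]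
  refine ((fderiv ℝ β p.2).le_opNorm _).trans ?_
  simpa [eY] using hβ.norm_fderiv_le p.2

lemma norm_mk_zero (s : ℝ) : ‖((s, 0) : ℝ × Euc N)‖ = |s| := by simp [Prod.norm_def]

lemma norm_zero_mk (z : Euc N) : ‖((0, z) : ℝ × Euc N)‖ = ‖z‖ := by simp [Prod.norm_def]

lemma sub_sq_le_two_mul (a b : ℝ) : (a - b) ^ 2 ≤ 2 * a ^ 2 + 2 * b ^ 2 := by
  nlinarith [sq_nonneg (a + b)]

set_option maxHeartbeats 1000000 in
/-- Translates in `x` of a function of finite energy are close in a weighted `L²` space. -/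
lemma exists_weighted_shift_bound (N : ℕ) (B : ℝ) : ∃ C ≥ (1 : ℝ), ∀ (β : Euc N → ℝ),
    BoundedDrift β B → ∀ (w : ℝ × Euc N → ℝ), ContDiff ℝ 2 w → ∀ (p₀ : ℝ × Euc N) (R R' t : ℝ),
    0 < R → R < R' → R' ≤ 1 → (∀ p ∈ ball p₀ R', |w p| ≤ 8) → 0 ≤ t → t ≤ (R' - R) / 4 →
    ∫ p in ball p₀ (R + (R' - R) / 4), (β p.2 * (w (p + (t, 0)) - w p)) ^ 2
      ≤ t * (C * (R' - R)⁻¹ ^ 4 * ∫ p in ball p₀ R', energy β w p) := by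
  obtain ⟨Cc, hCc, hcut⟩ := exists_isCutoff N
  set n : ℝ := ((N - 1 : ℕ) : ℝ)
  have hn : 0 ≤ n := Nat.cast_nonneg _
  refine ⟨1 + 16 * |B| + 5 * n * |B| * (256 * Cc + 1), ?_, ?_⟩
  · have : 0 ≤ 5 * n * |B| * (256 * Cc + 1) := by positivity
    linarith [abs_nonneg B]
  intro β hβ w hw p₀ R R' t hR hRR' hR' hw8 ht htg
  have hB0 : 0 < B := by linarith [hβ.one_le]
  rw [abs_of_pos hB0]
  set g := R' - R with hg
  have hg0 : 0 < g := sub_pos.2 hRR'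
  set G := g⁻¹ with hG
  have hG1 : 1 ≤ G := (one_le_inv₀ hg0).2 (by linarith)
  have hG4 : 1 ≤ G ^ 4 := one_le_pow₀ hG1
  obtain ⟨η, hη⟩ := hcut p₀ (R + g / 4) (R + g / 2) (by linarith) (by linarith) (by linarith)
  have hgg : (R + g / 2 - (R + g / 4))⁻¹ ^ 4 = 256 * G ^ 4 := by
    rw [show R + g / 2 - (R + g / 4) = g / 4 by ring, hG, inv_div, div_pow, inv_pow]
    norm_num
    ring
  have hηY := hη.dirY_le
  rw [hgg] at hηY
  set k₁ := B * (256 * Cc * G ^ 4 + 1) with hk₁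
  have hCG : 0 ≤ 256 * Cc * G ^ 4 := by positivity
  have hk₁B : B ≤ k₁ := by nlinarith
  set b : ℝ × Euc N → ℝ := fun p => β p.2 with hb
  have hb1 : ContDiff ℝ 1 b := hβ.contDiff.comp contDiff_snd
  set D : ℝ × Euc N → ℝ := fun p => w (p + (t, 0)) - w p with hD
  have hw1 := hw.one_of_two
  have hwt : ∀ s : ℝ, ContDiff ℝ 2 fun p => w (p + (s, 0)) := fun s =>
    hw.comp (contDiff_id.add contDiff_const)
  have hD2 : ContDiff ℝ 2 D := (hwt t).sub hw
  have hη1 := hη.contDiff.one_of_two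
  set κ : ℝ × Euc N → ℝ := fun p => η p * b p with hκ
  have hκ1 : ContDiff ℝ 1 κ := hη1.mul hb1
  set K : ℝ × Euc N → ℝ := fun p => κ p * D p with hK
  have hK1 : ContDiff ℝ 1 K := hκ1.mul hD2.one_of_two
  have hKc : HasCompactSupport K := hη.hasCompactSupport.mul_right.mul_right
  set f : ℝ × Euc N → ℝ := fun p => b p * w p with hf
  have hf1 : ContDiff ℝ 1 f := hb1.mul hw1
  set e := energy β w with he
  have hec : Continuous e := continuous_energy hβ.contDiff.continuous hw
  have he0 : ∀ p, 0 ≤ e p := energy_nonneg β w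
  set E := ∫ p in ball p₀ R', e p with hE
  have hE0 : 0 ≤ E := setIntegral_ball_nonneg fun p _ => he0 p
  have hLc : Continuous (opL β w) := continuous_opL hβ.contDiff.continuous hw
  have hshift : ∀ s : ℝ, 0 ≤ s → s ≤ t → ∫ p in ball p₀ (R + g / 2), e (p + (s, 0)) ≤ E :=
    fun s hs hst => setIntegral_ball_shift_le hec he0 (by
      rw [norm_mk_zero, abs_of_nonneg hs]; linarith)
  have hmem : ∀ s : ℝ, 0 ≤ s → s ≤ t → ∀ p ∈ ball p₀ (R + g / 2), p + (s, 0) ∈ ball p₀ R' := by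
    intro s hs hst p hp
    rw [mem_ball_prod_iff] at hp ⊢
    refine ⟨?_, by simpa using lt_of_lt_of_le hp.2 (by linarith)⟩
    calc |(p + ((s, 0) : ℝ × Euc N)).1 - p₀.1| = |(p.1 - p₀.1) + s| := by
          simp; congr 1; ring
      _ ≤ |p.1 - p₀.1| + |s| := abs_add_le _ _
      _ < R' := by rw [abs_of_nonneg hs]; linarith [hp.1]
  -- the main bound
  have hX : ∀ s ∈ Icc 0 t, ∫ p, K p * dir eX f (p + (s, 0))
      ≤ (16 * B + 5 * n * k₁) * E := by
    intro s hs
    have hf' : ∀ p, dir eX f (p + (s, 0))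
        = opL β w (p + (s, 0)) - lapY (fun q => w (q + (s, 0))) p := by
      intro p
      rw [lapY_shift, hf, dir_mul (hb1.diffAt _) (hw1.diffAt _), hb, dir_comp_snd hβ.contDiff]
      simp [opL, dX_eq, eX]
    have hdK : ∀ i p, dir (eY i) K p
        = (dir (eY i) η p * b p + η p * dir (eY i) b p) * D p + κ p * dir (eY i) D p := by
      intro i p
      rw [hK, dir_mul (hκ1.diffAt p) (hD2.one_of_two.diffAt p), hκ,
        dir_mul (hη1.diffAt p) (hb1.diffAt p)]
    set F : ℝ × Euc N → ℝ := fun p => K p * opL β w (p + (s, 0))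
      + ∑ i, dir (eY i) K p * dir (eY i) (fun q => w (q + (s, 0))) p with hF
    have hcs : Continuous fun p : ℝ × Euc N => opL β w (p + (s, 0)) := hLc.comp (by fun_prop)
    have hint1 : Integrable fun p => K p * opL β w (p + (s, 0)) :=
      (hK1.continuous.mul hcs).integrable_of_hasCompactSupport hKc.mul_right
    have hci : ∀ i, Continuous fun p => dir (eY i) K p * dir (eY i) (fun q => w (q + (s, 0))) p :=
      fun i => (hK1.continuous_dir _).mul ((hwt s).one_of_two.continuous_dir _)
    have hint2 : ∀ i, Integrable fun p =>
        dir (eY i) K p * dir (eY i) (fun q => w (q + (s, 0))) p := fun i =>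
      (hci i).integrable_of_hasCompactSupport (hKc.dir _).mul_right
    have hFc : Continuous F :=
      (hK1.continuous.mul hcs).add (continuous_finsetSum _ fun i _ => hci i)
    have hIF : ∫ p, K p * dir eX f (p + (s, 0)) = ∫ p, F p := by
      simp only [hf', mul_sub, hF]
      rw [integral_sub hint1, integral_mul_lapY hK1 (hwt s) hKc, integral_add hint1,
        integral_finsetSum]
      · ring
      · exact fun i _ => hint2 i
      · exact integrable_finsetSum _ fun i _ => hint2 i
      · exact (hK1.continuous.mul (continuous_lapY (hwt s))).integrable_of_hasCompactSupport
          hKc.mul_right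
    have hκB : ∀ p, |κ p| ≤ B := fun p => by
      rw [hκ, abs_mul, abs_of_nonneg (hη.nonneg p)]
      calc η p * |b p| ≤ 1 * B := mul_le_mul (hη.le_one p) (hβ.abs_le _) (abs_nonneg _) zero_le_one
        _ = B := one_mul _
    have hκ0 : ∀ p ∉ ball p₀ (R + g / 2), κ p = 0 := fun p hp => by simp [hκ, hη.eq_zero p hp]
    have hbound : ∀ p ∈ ball p₀ (R + g / 2), |F p| ≤ 16 * B * e (p + (s, 0))
        + n * (k₁ * (2 * e (p + (t, 0)) + 2 * e p + e (p + (s, 0)))) := by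
      intro p hp
      have hDp : |D p| ≤ 16 := by
        have h1 := hw8 _ (hmem t ht le_rfl p hp)
        have h2 := hw8 p (ball_subset_ball (by linarith) hp)
        exact (abs_sub _ _).trans (by linarith)
      have hLe : |opL β w (p + (s, 0))| ≤ e (p + (s, 0)) := by
        have := gradSq_nonneg w (p + (s, 0))
        simp only [he, energy]
        linarith [sq_nonneg (w (p + (s, 0)))]
      have hfirst : |K p * opL β w (p + (s, 0))| ≤ 16 * B * e (p + (s, 0)) := by
        rw [abs_mul, hK, abs_mul]
        calc |κ p| * |D p| * |opL β w (p + (s, 0))| ≤ B * 16 * e (p + (s, 0)) := by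
              gcongr
              exact hκB p
          _ = _ := by ring
      have hterm : ∀ i ∈ Finset.univ, |dir (eY i) K p * dir (eY i) (fun q => w (q + (s, 0))) p|
          ≤ k₁ * (2 * e (p + (t, 0)) + 2 * e p + e (p + (s, 0))) := by
        intro i _
        rw [abs_mul, hdK, dir_shift]
        set d₁ := dir (eY i) w (p + (s, 0))
        set d₂ := dir (eY i) D p with hd₂
        have hd₂e : d₂ = dir (eY i) w (p + (t, 0)) - dir (eY i) w p := by
          rw [hd₂, hD, dir_sub ((hwt t).one_of_two.diffAt p) (hw1.diffAt p), dir_shift]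
        have hc : |dir (eY i) η p * b p + η p * dir (eY i) b p| ≤ k₁ := by
          refine (abs_add_le _ _).trans ?_
          rw [abs_mul, abs_mul, abs_of_nonneg (hη.nonneg p)]
          have h1 : |dir (eY i) η p| * |b p| ≤ (Cc * (256 * G ^ 4)) * B :=
            mul_le_mul (hηY p i) (hβ.abs_le _) (abs_nonneg _) (by positivity)
          have h2 : η p * |dir (eY i) b p| ≤ 1 * B :=
            mul_le_mul (hη.le_one p) (hβ.abs_dir_le p i) (abs_nonneg _) zero_le_one
          rw [hk₁]
          linarith
        have hk₁0 : 0 ≤ k₁ := hB0.le.trans hk₁B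
        have hAB : |(dir (eY i) η p * b p + η p * dir (eY i) b p) * D p + κ p * d₂|
            ≤ k₁ * (|D p| + |d₂|) := by
          refine (abs_add_le _ _).trans ?_
          rw [abs_mul, abs_mul, mul_add]
          gcongr
          exact (hκB p).trans hk₁B
        have hq1 := sq_le_energy β w (p + (s, 0))
        have hq2 := sq_le_energy β w (p + (t, 0))
        have hq3 := sq_le_energy β w p
        have hr1 : d₁ ^ 2 ≤ _ := sq_dir_le_gradSq w i (p + (s, 0))
        have hr2 := sq_dir_le_gradSq w i (p + (t, 0))
        have hr3 := sq_dir_le_gradSq w i p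
        have hDe : D p ^ 2 ≤ 2 * w (p + (t, 0)) ^ 2 + 2 * w p ^ 2 := by
          exact sub_sq_le_two_mul _ _
        have hd₂q : d₂ ^ 2 ≤ 2 * dir (eY i) w (p + (t, 0)) ^ 2 + 2 * dir (eY i) w p ^ 2 := by
          rw [hd₂e]; exact sub_sq_le_two_mul _ _
        calc _ ≤ k₁ * (|D p| + |d₂|) * |d₁| := by gcongr
          _ = k₁ * (|D p| * |d₁| + |d₂| * |d₁|) := by ring
          _ ≤ k₁ * (2 * e (p + (t, 0)) + 2 * e p + e (p + (s, 0))) := by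
            refine mul_le_mul_of_nonneg_left ?_ hk₁0
            have i1 := two_mul_le_add_sq |D p| |d₁|
            have i2 := two_mul_le_add_sq |d₂| |d₁|
            rw [sq_abs, sq_abs] at i1 i2
            linarith [sq_nonneg (w (p + (s, 0))), sq_nonneg (D p), sq_nonneg d₂]
      have hsum := (Finset.abs_sum_le_sum_abs (fun i => dir (eY i) K p *
        dir (eY i) (fun q => w (q + (s, 0))) p) Finset.univ).trans (Finset.sum_le_card_nsmul _ _ _ hterm)
      rw [Finset.card_univ, Fintype.card_fin, nsmul_eq_mul] at hsum
      exact (abs_add_le _ _).trans (add_le_add hfirst hsum)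
    have hzero : ∀ p ∉ ball p₀ (R + g / 2), F p = 0 := by
      intro p hp
      have h0 : ∀ i, dir (eY i) K p = 0 := by
        intro i
        have hη0 : dir (eY i) η p = 0 := hη.dir_eq_zero hp _
        rw [hdK, hη0, hκ0 p hp, hη.eq_zero p hp]
        simp
      have hK0 : K p = 0 := by simp [hK, hκ0 p hp]
      simp only [hF, h0, hK0, zero_mul, Finset.sum_const_zero, add_zero]
    rw [hIF]
    have hes : ∀ s : ℝ, Continuous fun p : ℝ × Euc N => e (p + (s, 0)) :=
      fun s => hec.comp (by fun_prop)
    refine (le_abs_self _).trans ((abs_integral_le_setIntegral_ball hFc ?_ hbound hzero).trans ?_)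
    · have h1 := hes s
      have h2 := hes t
      fun_prop
    · have I1 := (hes s).integrableOn_ball p₀ (R + g / 2)
      have I2 := (hes t).integrableOn_ball p₀ (R + g / 2)
      have I3 := hec.integrableOn_ball p₀ (R + g / 2)
      have J1 := hshift s hs.1 hs.2
      have J2 := hshift t ht le_rfl
      have J3 : ∫ p in ball p₀ (R + g / 2), e p ≤ E :=
        setIntegral_ball_mono_set hec he0 (by linarith)
      have I23 : IntegrableOn (fun p => 2 * e (p + (t, 0)) + 2 * e p) (ball p₀ (R + g / 2)) :=
        (I2.const_mul 2).add (I3.const_mul 2)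
      have I123 : IntegrableOn (fun p => 2 * e (p + (t, 0)) + 2 * e p + e (p + (s, 0)))
        (ball p₀ (R + g / 2)) := I23.add I1
      rw [integral_add (I1.const_mul _), integral_const_mul, integral_const_mul,
        integral_const_mul, integral_add I23 I1,
        integral_add (I2.const_mul _) (I3.const_mul _), integral_const_mul, integral_const_mul]
      · have hnk : 0 ≤ n * k₁ := mul_nonneg hn (hB0.le.trans hk₁B)
        nlinarith
      · exact (I123.const_mul _).const_mul _
  have hmain := integral_mul_shift_sub_le hK1.continuous hKc hf1 ht hX
  have hle : ∫ p in ball p₀ (R + g / 4), (β p.2 * (w (p + (t, 0)) - w p)) ^ 2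
      ≤ ∫ p, K p * (f (p + (t, 0)) - f p) := by
    have hfc := hf1.continuous
    have hKf : ∀ p, K p * (f (p + (t, 0)) - f p) = η p * (β p.2 * (w (p + (t, 0)) - w p)) ^ 2 := by
      intro p
      simp [hK, hκ, hf, hb, hD]
      ring
    rw [integral_congr_ae (Filter.Eventually.of_forall hKf)]
    have hi : Integrable fun p => η p * (β p.2 * (w (p + (t, 0)) - w p)) ^ 2 := by
      refine Continuous.integrable_of_hasCompactSupport ?_ hη.hasCompactSupport.mul_right
      have h1 := hη.contDiff.continuous
      have h2 := hw.continuous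
      have h3 := hβ.contDiff.continuous
      fun_prop
    calc _ = ∫ p in ball p₀ (R + g / 4), η p * (β p.2 * (w (p + (t, 0)) - w p)) ^ 2 := by
          refine setIntegral_congr_fun measurableSet_ball fun p hp => ?_
          rw [hη.eq_one p (ball_subset_closedBall hp), one_mul]
      _ ≤ _ := setIntegral_le_integral hi (Filter.Eventually.of_forall fun p =>
          mul_nonneg (hη.nonneg p) (sq_nonneg _))
  refine hle.trans (hmain.trans (mul_le_mul_of_nonneg_left ?_ ht))
  refine mul_le_mul_of_nonneg_right ?_ hE0
  have h1 : 16 * B ≤ 16 * B * G ^ 4 := le_mul_of_one_le_right (by positivity) hG4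
  have h2 : k₁ ≤ B * (256 * Cc + 1) * G ^ 4 := by rw [hk₁]; nlinarith
  have h3 : 5 * n * k₁ ≤ 5 * n * (B * (256 * Cc + 1) * G ^ 4) := by gcongr
  nlinarith

end Nikolskii

section ShiftBound

variable {N : ℕ}

lemma add_sq_le_two_mul (a b : ℝ) : (a + b) ^ 2 ≤ 2 * a ^ 2 + 2 * b ^ 2 := by
  nlinarith [sq_nonneg (a - b)]

lemma sq_le_of_three_terms (d b e f k : ℝ) (hk : 0 < k) (hb : k * |d| ≤ |b|) (x : ℝ)
    (hx : x = d - (e - f)) : x ^ 2 ≤ 2 * k⁻¹ ^ 2 * b ^ 2 + 4 * e ^ 2 + 4 * f ^ 2 := by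
  have h1 := sub_sq_le_two_mul d (e - f)
  have h2 := sub_sq_le_two_mul e f
  have h3 : d ^ 2 ≤ k⁻¹ ^ 2 * b ^ 2 := by
    rw [← mul_pow, ← sq_abs d, ← sq_abs (k⁻¹ * b), abs_mul, abs_of_pos (inv_pos.2 hk)]
    refine pow_le_pow_left₀ (abs_nonneg _) ?_ 2
    rw [inv_mul_eq_div, le_div_iff₀ hk]
    linarith
  rw [hx]
  linarith

set_option maxHeartbeats 1000000 in
/-- Translates in `x` of a function of finite energy are close in `L²`. -/
lemma FiniteType.exists_shift_bound {β : Euc N → ℝ} {B : ℝ} (hβ : BoundedDrift β B)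
    {W : Set (Euc N)} {Z : Finset (Euc N)} {ρ c : ℝ} {j : ℕ} (hF : FiniteType β W Z ρ c j) :
    ∃ C ≥ (1 : ℝ), ∀ (w : ℝ × Euc N → ℝ), ContDiff ℝ 2 w →
    ∀ (p₀ : ℝ × Euc N) (R R' σ t : ℝ), 0 < R → R < R' → R' ≤ 1 →
    (∀ p ∈ ball p₀ R', |w p| ≤ 8) → (∀ p ∈ ball p₀ R', p.2 ∈ W) → 0 < σ → σ ≤ ρ →
    σ ≤ (R' - R) / 4 → 0 ≤ t → t ≤ σ ^ (2 * j + 2) →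
    ∫ p in ball p₀ R, (w (p + (t, 0)) - w p) ^ 2
      ≤ C * (R' - R)⁻¹ ^ 4 * σ ^ 2 * ∫ p in ball p₀ R', energy β w p := by
  obtain ⟨C₁, hC₁, hC⟩ := exists_weighted_shift_bound N B
  have hc := hF.c_pos
  refine ⟨1 + (Z.card : ℝ) * (2 * c⁻¹ ^ 2 * C₁ + 8), ?_, ?_⟩
  · have : 0 ≤ (Z.card : ℝ) * (2 * c⁻¹ ^ 2 * C₁ + 8) := by positivity
    linarith
  intro w hw p₀ R R' σ t hR hRR' hR' hw8 hW hσ hσρ hσg ht htσ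
  have hσ1 : σ ≤ 1 := hσρ.trans hF.rho_le
  have htσ' : t ≤ σ := htσ.trans (pow_le_of_le_one hσ.le hσ1 (by omega))
  have hwb := hC β hβ w hw p₀ R R' t hR hRR' hR' hw8 ht (htσ'.trans hσg)
  set g := R' - R with hg
  have hg0 : 0 < g := sub_pos.2 hRR'
  set G := g⁻¹ with hG
  have hG1 : 1 ≤ G := (one_le_inv₀ hg0).2 (by linarith)
  have hG4 : 1 ≤ G ^ 4 := one_le_pow₀ hG1
  have hec : Continuous (energy β w) := continuous_energy hβ.contDiff.continuous hw
  set E := ∫ p in ball p₀ R', energy β w p with hE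
  have hE0 : 0 ≤ E := setIntegral_ball_nonneg fun p _ => energy_nonneg β w p
  have hwc := hw.continuous
  have hβc := hβ.contDiff.continuous
  set k := c * σ ^ j with hk
  have hk0 : 0 < k := by positivity
  set bD : ℝ × Euc N → ℝ := fun p => (β p.2 * (w (p + (t, 0)) - w p)) ^ 2 with hbD
  have hbDc : Continuous bD := by fun_prop
  set f : Euc N → ℝ × Euc N → ℝ := fun ζ p => (w (p + (0, σ • ζ)) - w p) ^ 2 with hf
  have hfc : ∀ ζ, Continuous (f ζ) := fun ζ => by fun_prop
  set S : Euc N → ℝ × Euc N → ℝ := fun ζ p =>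
    2 * k⁻¹ ^ 2 * bD (p + (0, σ • ζ)) + 4 * f ζ (p + (t, 0)) + 4 * f ζ p with hS
  have hbDs : ∀ ζ : Euc N, Continuous fun p => bD (p + (0, σ • ζ)) :=
    fun ζ => hbDc.comp (by fun_prop)
  have hfs : ∀ ζ : Euc N, Continuous fun p => f ζ (p + (t, 0)) :=
    fun ζ => (hfc ζ).comp (by fun_prop)
  have hSc : ∀ ζ, Continuous (S ζ) := fun ζ =>
    ((continuous_const.mul (hbDs ζ)).add (continuous_const.mul (hfs ζ))).add
      (continuous_const.mul (hfc ζ))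
  have hS0 : ∀ ζ p, 0 ≤ S ζ p := fun ζ p => by simp only [hS, hbD, hf]; positivity
  have hpt : ∀ p ∈ ball p₀ R, (w (p + (t, 0)) - w p) ^ 2 ≤ ∑ ζ ∈ Z, S ζ p := by
    intro p hp
    obtain ⟨ζ, hζ, hle⟩ := hF.exists_le p.2 (hW p (ball_subset_ball hRR'.le hp)) σ ⟨hσ, hσρ⟩
    refine le_trans ?_ (Finset.single_le_sum (f := fun ζ => S ζ p) (fun ζ _ => hS0 ζ p) hζ)
    simp only [hS, hbD, hf]
    refine sq_le_of_three_terms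
      (w (p + (0, σ • ζ) + (t, 0)) - w (p + (0, σ • ζ))) _ _ _ k hk0 ?_ _ ?_
    · rw [abs_mul]
      exact mul_le_mul_of_nonneg_right hle (abs_nonneg _)
    · rw [add_right_comm p (0, σ • ζ) (t, 0)]
      ring
  have hnorm : ∀ ζ ∈ Z, ‖((0, σ • ζ) : ℝ × Euc N)‖ ≤ g / 4 := fun ζ hζ => by
    rw [norm_zero_mk, norm_smul, Real.norm_of_nonneg hσ.le]
    nlinarith [hF.norm_le ζ hζ]
  have hgrad : ∫ p in ball p₀ R', gradSq w p ≤ E :=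
    setIntegral_ball_mono (continuous_gradSq hw.one_of_two) hec fun p _ => by
      linarith [sq_le_energy β w p, sq_nonneg (w p)]
  have hgrad0 : 0 ≤ ∫ p in ball p₀ R', gradSq w p :=
    setIntegral_ball_nonneg fun p _ => gradSq_nonneg w p
  have hfb : ∀ ζ ∈ Z, ∀ r : ℝ, r ≤ R + g / 4 → ∫ p in ball p₀ r, f ζ p ≤ σ ^ 2 * E := by
    intro ζ hζ r hr
    refine (setIntegral_sq_shift_snd_sub_le hw.one_of_two (z := σ • ζ) (R' := R') ?_).trans ?_
    · have := hnorm ζ hζ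
      rw [norm_zero_mk] at this
      linarith
    · have h1 : ‖σ • ζ‖ ^ 2 ≤ σ ^ 2 := by
        refine pow_le_pow_left₀ (norm_nonneg _) ?_ 2
        rw [norm_smul, Real.norm_of_nonneg hσ.le]
        nlinarith [hF.norm_le ζ hζ]
      exact mul_le_mul h1 hgrad hgrad0 (by positivity)
  have hSb : ∀ ζ ∈ Z, ∫ p in ball p₀ R, S ζ p
      ≤ (2 * c⁻¹ ^ 2 * C₁ + 8) * (G ^ 4 * σ ^ 2 * E) := by
    intro ζ hζ
    have I1 := (hbDs ζ).integrableOn_ball p₀ R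
    have I2 := (hfs ζ).integrableOn_ball p₀ R
    have I3 := (hfc ζ).integrableOn_ball p₀ R
    have I12 : IntegrableOn (fun p => 2 * k⁻¹ ^ 2 * bD (p + (0, σ • ζ)) + 4 * f ζ (p + (t, 0)))
      (ball p₀ R) := (I1.const_mul _).add (I2.const_mul _)
    simp only [hS]
    rw [integral_add I12 (I3.const_mul _), integral_add (I1.const_mul _) (I2.const_mul _),
      integral_const_mul, integral_const_mul, integral_const_mul]
    have J1 : ∫ p in ball p₀ R, bD (p + (0, σ • ζ)) ≤ t * (C₁ * G ^ 4 * E) :=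
      (setIntegral_ball_shift_le hbDc (fun p => sq_nonneg _)
        (by linarith [hnorm ζ hζ] : R + ‖((0, σ • ζ) : ℝ × Euc N)‖ ≤ R + g / 4)).trans hwb
    have J2 : ∫ p in ball p₀ R, f ζ (p + (t, 0)) ≤ σ ^ 2 * E := by
      refine (setIntegral_ball_shift_le (hfc ζ) (fun p => sq_nonneg _) (R' := R + g / 4) ?_).trans
        (hfb ζ hζ _ le_rfl)
      rw [norm_mk_zero, abs_of_nonneg ht]
      linarith
    have J3 := hfb ζ hζ R (by linarith)
    have hkt : k⁻¹ ^ 2 * t ≤ c⁻¹ ^ 2 * σ ^ 2 := by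
      calc k⁻¹ ^ 2 * t ≤ k⁻¹ ^ 2 * σ ^ (2 * j + 2) := by gcongr
        _ = c⁻¹ ^ 2 * σ ^ 2 := by
          rw [hk]
          field_simp
          ring
    have K1 : 2 * k⁻¹ ^ 2 * ∫ p in ball p₀ R, bD (p + (0, σ • ζ))
        ≤ 2 * (c⁻¹ ^ 2 * σ ^ 2) * (C₁ * G ^ 4 * E) := by
      calc _ ≤ 2 * k⁻¹ ^ 2 * (t * (C₁ * G ^ 4 * E)) := by gcongr
        _ = 2 * (k⁻¹ ^ 2 * t) * (C₁ * G ^ 4 * E) := by ring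
        _ ≤ _ := by gcongr
    have K2 : σ ^ 2 * E ≤ G ^ 4 * σ ^ 2 * E := by
      rw [mul_assoc]
      exact le_mul_of_one_le_left (by positivity) hG4
    linarith
  calc ∫ p in ball p₀ R, (w (p + (t, 0)) - w p) ^ 2 ≤ ∫ p in ball p₀ R, ∑ ζ ∈ Z, S ζ p :=
        setIntegral_ball_mono (by fun_prop) (continuous_finsetSum _ fun ζ _ => hSc ζ) hpt
    _ = ∑ ζ ∈ Z, ∫ p in ball p₀ R, S ζ p :=
        integral_finsetSum _ fun ζ _ => (hSc ζ).integrableOn_ball p₀ R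
    _ ≤ Z.card • ((2 * c⁻¹ ^ 2 * C₁ + 8) * (G ^ 4 * σ ^ 2 * E)) :=
        Finset.sum_le_card_nsmul _ _ _ hSb
    _ ≤ _ := by
      rw [nsmul_eq_mul]
      have : 0 ≤ G ^ 4 * σ ^ 2 * E := by positivity
      linarith

/-- General translates of a function of finite energy are close in `L²`. -/
lemma FiniteType.exists_full_shift_bound {β : Euc N → ℝ} {B : ℝ} (hβ : BoundedDrift β B)
    {W : Set (Euc N)} {Z : Finset (Euc N)} {ρ c : ℝ} {j : ℕ} (hF : FiniteType β W Z ρ c j) :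
    ∃ C ≥ (1 : ℝ), ∀ (w : ℝ × Euc N → ℝ), ContDiff ℝ 2 w →
    ∀ (p₀ : ℝ × Euc N) (R R' σ : ℝ) (s : ℝ × Euc N), 0 < R → R < R' → R' ≤ 1 →
    (∀ p ∈ ball p₀ R', |w p| ≤ 8) → (∀ p ∈ ball p₀ R', p.2 ∈ W) → 0 < σ → σ ≤ ρ →
    σ ≤ (R' - R) / 8 → 0 ≤ s.1 → ‖s‖ ≤ σ ^ (2 * j + 2) →
    ∫ p in ball p₀ R, (w (p + s) - w p) ^ 2
      ≤ C * (R' - R)⁻¹ ^ 4 * σ ^ 2 * ∫ p in ball p₀ R', energy β w p := by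
  obtain ⟨C, hC1, hC⟩ := hF.exists_shift_bound hβ
  refine ⟨32 * C + 2, by linarith, ?_⟩
  intro w hw p₀ R R' σ s hR hRR' hR' hw8 hW hσ hσρ hσg hs1 hsσ
  have hσ1 : σ ≤ 1 := hσρ.trans hF.rho_le
  have hsσ' : ‖s‖ ≤ σ := hsσ.trans (pow_le_of_le_one hσ.le hσ1 (by omega))
  have hsx : s.1 ≤ σ ^ (2 * j + 2) := by
    have := (norm_fst_le s).trans hsσ
    rwa [Real.norm_of_nonneg hs1] at this
  have hsy : ‖s.2‖ ≤ σ := (norm_snd_le s).trans hsσ'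
  set g := R' - R with hg
  have hg0 : 0 < g := sub_pos.2 hRR'
  have hG1 : 1 ≤ g⁻¹ := (one_le_inv₀ hg0).2 (by linarith)
  have hG4 : 1 ≤ g⁻¹ ^ 4 := one_le_pow₀ hG1
  have hec : Continuous (energy β w) := continuous_energy hβ.contDiff.continuous hw
  set E := ∫ p in ball p₀ R', energy β w p with hE
  have hE0 : 0 ≤ E := setIntegral_ball_nonneg fun p _ => energy_nonneg β w p
  have hwc := hw.continuous
  have hx : ∫ p in ball p₀ (R + g / 2), (w (p + (s.1, 0)) - w p) ^ 2
      ≤ 16 * C * g⁻¹ ^ 4 * σ ^ 2 * E := by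
    refine (hC w hw p₀ (R + g / 2) R' σ s.1 (by linarith) (by linarith) hR' hw8 hW hσ hσρ
      (by linarith) hs1 hsx).trans (le_of_eq ?_)
    rw [show R' - (R + g / 2) = g / 2 by rw [hg]; ring, inv_div, div_pow, inv_pow]
    ring
  have hy : ∫ p in ball p₀ R, (w (p + (0, s.2)) - w p) ^ 2 ≤ g⁻¹ ^ 4 * σ ^ 2 * E := by
    refine (setIntegral_sq_shift_snd_sub_le hw.one_of_two (z := s.2) (R' := R')
      (by linarith)).trans ?_
    have hgrad : ∫ p in ball p₀ R', gradSq w p ≤ E :=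
      setIntegral_ball_mono (continuous_gradSq hw.one_of_two) hec fun p _ => by
        linarith [sq_le_energy β w p, sq_nonneg (w p)]
    have h1 : ‖s.2‖ ^ 2 ≤ σ ^ 2 := pow_le_pow_left₀ (norm_nonneg _) hsy 2
    calc _ ≤ σ ^ 2 * E := mul_le_mul h1 hgrad
            (setIntegral_ball_nonneg fun p _ => gradSq_nonneg w p) (by positivity)
      _ ≤ _ := by
        rw [mul_assoc]
        exact le_mul_of_one_le_left (by positivity) hG4
  set F : ℝ × Euc N → ℝ := fun p => (w (p + (s.1, 0)) - w p) ^ 2 with hFd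
  set H : ℝ × Euc N → ℝ := fun p => (w (p + (0, s.2)) - w p) ^ 2 with hHd
  have hFc : Continuous F := by fun_prop
  have hHc : Continuous H := by fun_prop
  have hFs : Continuous fun p => F (p + (0, s.2)) := hFc.comp (by fun_prop)
  have hpt : ∀ p, (w (p + s) - w p) ^ 2 ≤ 2 * F (p + (0, s.2)) + 2 * H p := by
    intro p
    have : p + s = p + (0, s.2) + (s.1, 0) := by
      rw [add_assoc]
      simp
    have h := add_sq_le_two_mul (w (p + (0, s.2) + (s.1, 0)) - w (p + (0, s.2)))
      (w (p + (0, s.2)) - w p)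
    rw [← this] at h
    simp only [hFd, hHd]
    rw [← this]
    calc _ = _ := by ring
      _ ≤ _ := h
  have hFi : ∫ p in ball p₀ R, F (p + (0, s.2)) ≤ 16 * C * g⁻¹ ^ 4 * σ ^ 2 * E := by
    refine (setIntegral_ball_shift_le hFc (fun p => sq_nonneg _) ?_).trans hx
    rw [norm_zero_mk]
    linarith
  calc _ ≤ ∫ p in ball p₀ R, (2 * F (p + (0, s.2)) + 2 * H p) :=
        setIntegral_ball_mono (by fun_prop) (by fun_prop) fun p _ => hpt p
    _ = 2 * (∫ p in ball p₀ R, F (p + (0, s.2))) + 2 * ∫ p in ball p₀ R, H p := by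
        rw [integral_add ((hFs.integrableOn_ball p₀ R).const_mul 2)
          ((hHc.integrableOn_ball p₀ R).const_mul 2), integral_const_mul, integral_const_mul]
    _ ≤ _ := by linarith

end ShiftBound

section DeGiorgi

variable {N : ℕ}

lemma integrable_prod_ball {F : ℝ × Euc N → ℝ × Euc N → ℝ} (hF : Continuous (Function.uncurry F))
    (a b : ℝ × Euc N) (r r' : ℝ) : Integrable (Function.uncurry F)
      ((volume.restrict (ball a r)).prod (volume.restrict (ball b r'))) := by
  rw [Measure.prod_restrict]
  exact (hF.continuousOn.integrableOn_compact ((isCompact_closedBall a r).prod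
    (isCompact_closedBall b r'))).mono_set (prod_mono ball_subset_closedBall ball_subset_closedBall)

/-- A function that is `L²`-close to many of its translates has small `L²` norm if its `L¹` norm
is small. -/
lemma measureReal_mul_setIntegral_sq_le {w : ℝ × Euc N → ℝ} (hw : Continuous w)
    (h0 : ∀ p, 0 ≤ w p) {p₀ q : ℝ × Euc N} {R R' δ X : ℝ} (hRR' : R ≤ R')
    (hmem : ∀ p ∈ ball p₀ R, ∀ s ∈ ball q δ, p + s ∈ ball p₀ R')
    (hX : ∀ s ∈ ball q δ, ∫ p in ball p₀ R, (w (p + s) - w p) ^ 2 ≤ X) :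
    volume.real (ball q δ) * ∫ p in ball p₀ R, w p ^ 2
      ≤ 2 * (∫ p in ball p₀ R', w p) ^ 2 + volume.real (ball q δ) * X := by
  set I := ∫ p in ball p₀ R', w p with hI
  have hI0 : 0 ≤ I := setIntegral_ball_nonneg fun p _ => h0 p
  have hinteg := integrable_prod_ball (F := fun p s => w p * w (p + s)) (by fun_prop) p₀ q R δ
  set J : ℝ × Euc N → ℝ := fun s => ∫ p in ball p₀ R, w p * w (p + s) with hJ
  have hJi : IntegrableOn J (ball q δ) := hinteg.integral_prod_right
  have hper : ∀ s ∈ ball q δ, ∫ p in ball p₀ R, w p ^ 2 ≤ 2 * J s + X := by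
    intro s hs
    have I1 : IntegrableOn (fun p => w p * w (p + s)) (ball p₀ R) :=
      Continuous.integrableOn_ball (by fun_prop) _ _
    have I2 : IntegrableOn (fun p => (w (p + s) - w p) ^ 2) (ball p₀ R) :=
      Continuous.integrableOn_ball (by fun_prop) _ _
    calc ∫ p in ball p₀ R, w p ^ 2
        ≤ ∫ p in ball p₀ R, (2 * (w p * w (p + s)) + (w (p + s) - w p) ^ 2) :=
          setIntegral_ball_mono (by fun_prop) (by fun_prop) fun p _ => by
            nlinarith [sq_nonneg (w (p + s))]
      _ = 2 * J s + ∫ p in ball p₀ R, (w (p + s) - w p) ^ 2 := by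
          rw [integral_add (I1.const_mul 2) I2, integral_const_mul]
      _ ≤ _ := by linarith [hX s hs]
  have hfin : volume (ball q δ) ≠ ⊤ := measure_ball_lt_top.ne
  have hsum : volume.real (ball q δ) * ∫ p in ball p₀ R, w p ^ 2
      ≤ ∫ s in ball q δ, (2 * J s + X) := by
    rw [← smul_eq_mul, ← setIntegral_const]
    exact setIntegral_mono_on (integrableOn_const hfin) ((hJi.const_mul 2).add
      (integrableOn_const hfin)) measurableSet_ball hper
  have hswap : ∫ s in ball q δ, J s ≤ I * I := by
    have e : ∫ s in ball q δ, J s = ∫ p in ball p₀ R, ∫ s in ball q δ, w p * w (p + s) :=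
      (integral_integral_swap hinteg).symm
    rw [e]
    have hle : ∀ p ∈ ball p₀ R, ∫ s in ball q δ, w p * w (p + s) ≤ w p * I := by
      intro p hp
      rw [integral_const_mul]
      refine mul_le_mul_of_nonneg_left ?_ (h0 p)
      have := setIntegral_shift_le_of_forall_mem hw h0 (A := ball q δ) (q := p₀) (s := p) (R' := R')
        fun s hs => by rw [add_comm]; exact hmem p hp s hs
      simpa only [add_comm] using this
    calc _ ≤ ∫ p in ball p₀ R, w p * I :=
          setIntegral_mono_on hinteg.integral_prod_left ((hw.integrableOn_ball _ _).mul_const _)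
            measurableSet_ball hle
      _ = (∫ p in ball p₀ R, w p) * I := integral_mul_const _ _
      _ ≤ I * I := by
        gcongr
        exact setIntegral_ball_mono_set hw h0 hRR'
  rw [integral_add (hJi.const_mul 2) (integrableOn_const hfin), integral_const_mul,
    setIntegral_const, smul_eq_mul] at hsum
  nlinarith

lemma energy_bound_scalar {m L A g : ℝ} (hm0 : 0 ≤ m) (hm2 : m ≤ 2) (hL : |L| ≤ A) (hg : 0 ≤ g) :
    |3 * m ^ 2 * L + 6 * m * g| + (3 * m ^ 2) ^ 2 * g + (m ^ 3) ^ 2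
      ≤ 13 * (3 * m ^ 2 * L + 6 * m * g) + (168 * A + 64) := by
  obtain ⟨h1, h2⟩ := abs_le.1 hL
  have hm4 : m ^ 2 ≤ 4 := by nlinarith
  have hm8 : m ^ 3 ≤ 8 := by nlinarith
  have hA : 0 ≤ A := (abs_nonneg L).trans hL
  have h3 : m ^ 2 * |L| ≤ 4 * A := mul_le_mul hm4 hL (abs_nonneg _) (by norm_num)
  have h3' : -(4 * A) ≤ m ^ 2 * L := by
    have := neg_abs_le (m ^ 2 * L)
    rw [abs_mul, abs_of_nonneg (sq_nonneg m)] at this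
    linarith
  have h4 : m ^ 3 * (m * g) ≤ 8 * (m * g) := mul_le_mul_of_nonneg_right hm8 (by positivity)
  have h5 : (m ^ 3) ^ 2 ≤ 64 := by nlinarith [pow_nonneg hm0 3]
  have h6 : |3 * m ^ 2 * L + 6 * m * g| ≤ 3 * (m ^ 2 * |L|) + 6 * (m * g) := by
    refine (abs_add_le _ _).trans (le_of_eq ?_)
    rw [abs_mul, abs_of_nonneg (by positivity : 0 ≤ 3 * m ^ 2),
      abs_of_nonneg (by positivity : 0 ≤ 6 * m * g)]
    ring
  nlinarith

/-- The part of a ball on which `v` exceeds the level `l`. -/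
def superlevel (v : ℝ × Euc N → ℝ) (l : ℝ) (p₀ : ℝ × Euc N) (R : ℝ) : Set (ℝ × Euc N) :=
  {p | l < v p} ∩ ball p₀ R

lemma measurableSet_superlevel {v : ℝ × Euc N → ℝ} (hv : Continuous v) (l : ℝ)
    (p₀ : ℝ × Euc N) (R : ℝ) : MeasurableSet (superlevel v l p₀ R) :=
  ((isOpen_lt continuous_const hv).inter isOpen_ball).measurableSet

lemma volume_superlevel_ne_top (v : ℝ × Euc N → ℝ) (l : ℝ) (p₀ : ℝ × Euc N) (R : ℝ) :
    volume (superlevel v l p₀ R) ≠ ⊤ :=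
  ((measure_mono inter_subset_right).trans_lt measure_ball_lt_top).ne

/-- The truncation `max (v - l) 0 ^ 3`. -/
def trunc (v : ℝ × Euc N → ℝ) (l : ℝ) (p : ℝ × Euc N) : ℝ := cube (v p - l)

lemma contDiff_trunc {v : ℝ × Euc N → ℝ} (hv : ContDiff ℝ 2 v) (l : ℝ) :
    ContDiff ℝ 2 (trunc v l) := contDiff_cube.comp (hv.sub contDiff_const)

lemma trunc_nonneg (v : ℝ × Euc N → ℝ) (l : ℝ) (p : ℝ × Euc N) : 0 ≤ trunc v l p := cube_nonneg _

lemma trunc_le {v : ℝ × Euc N → ℝ} {l : ℝ} {p : ℝ × Euc N} (hl : -1 ≤ l) (hv : |v p| ≤ 1) :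
    trunc v l p ≤ 8 := by
  have h2 : v p - l ≤ 2 := by linarith [(abs_le.1 hv).2]
  calc trunc v l p ≤ cube 2 := cube_mono h2
    _ = 8 := by rw [cube_of_nonneg (by norm_num)]; norm_num

lemma opL_trunc (β : Euc N → ℝ) {v : ℝ × Euc N → ℝ} (hv : ContDiff ℝ 2 v) (l : ℝ)
    (p : ℝ × Euc N) : opL β (trunc v l) p
      = 3 * max (v p - l) 0 ^ 2 * opL β v p + 6 * max (v p - l) 0 * gradSq v p := by
  have h1 : ∀ s, HasDerivAt (fun s => cube (s - l)) (3 * max (s - l) 0 ^ 2) s := fun s =>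
    (hasDerivAt_cube (s - l)).comp_sub_const s l
  have h2 : ∀ s, HasDerivAt (fun s => 3 * max (s - l) 0 ^ 2) (6 * max (s - l) 0) s := fun s =>
    (hasDerivAt_cube_deriv (s - l)).comp_sub_const s l
  exact opL_comp β h1 h2 hv p

lemma gradSq_trunc {v : ℝ × Euc N → ℝ} (hv : ContDiff ℝ 2 v) (l : ℝ)
    (p : ℝ × Euc N) : gradSq (trunc v l) p = (3 * max (v p - l) 0 ^ 2) ^ 2 * gradSq v p := by
  have h1 : ∀ s, HasDerivAt (fun s => cube (s - l)) (3 * max (s - l) 0 ^ 2) s := fun s =>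
    (hasDerivAt_cube (s - l)).comp_sub_const s l
  exact gradSq_comp h1 hv.one_of_two p

lemma energy_trunc_le (β : Euc N → ℝ) {v : ℝ × Euc N → ℝ} (hv : ContDiff ℝ 2 v) {l A : ℝ}
    {p : ℝ × Euc N} (hl : -1 ≤ l) (hvp : |v p| ≤ 1) (hA : |opL β v p| ≤ A) :
    energy β (trunc v l) p ≤ 13 * opL β (trunc v l) p + (168 * A + 64) := by
  unfold energy
  rw [opL_trunc β hv, gradSq_trunc hv]
  exact energy_bound_scalar (le_max_right _ _)
    (max_le (by linarith [(abs_le.1 hvp).2]) (by norm_num)) hA (gradSq_nonneg _ _)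

set_option maxHeartbeats 1000000 in
/-- The energy estimate for truncations. -/
lemma BoundedDrift.exists_energy_bound {β : Euc N → ℝ} {B : ℝ} (hβ : BoundedDrift β B) {A : ℝ}
    (hA0 : 0 ≤ A) : ∃ C ≥ (1 : ℝ), ∀ (v : ℝ × Euc N → ℝ), ContDiff ℝ 2 v →
    ∀ (p₀ : ℝ × Euc N) (R R' l : ℝ), 0 < R → R < R' → R' ≤ 1 → -1 ≤ l →
    (∀ p ∈ ball p₀ R', |v p| ≤ 1) → (∀ p ∈ ball p₀ R', |opL β v p| ≤ A) →
    ∫ p in ball p₀ R, energy β (trunc v l) p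
      ≤ C * (R' - R)⁻¹ ^ 4 * volume.real (superlevel v l p₀ R') := by
  obtain ⟨Cc, hCc, hcut⟩ := exists_isCutoff N
  have hB := hβ.one_le
  refine ⟨13 * (8 * ((1 + B) * Cc)) + (168 * A + 64), ?_, ?_⟩
  · have : 0 ≤ 13 * (8 * ((1 + B) * Cc)) := by positivity
    linarith
  intro v hv p₀ R R' l hR hRR' hR' hl hv1 hvA
  obtain ⟨χ, hχ⟩ := hcut p₀ R R' hR hRR' hR'
  set G := (R' - R)⁻¹ with hG
  have hG1 : 1 ≤ G := (one_le_inv₀ (by linarith)).2 (by linarith)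
  have hG4 : 1 ≤ G ^ 4 := one_le_pow₀ hG1
  set S := superlevel v l p₀ R' with hS
  have hSm : MeasurableSet S := measurableSet_superlevel hv.continuous l p₀ R'
  have hSt : volume S ≠ ⊤ := volume_superlevel_ne_top v l p₀ R'
  set w := trunc v l with hw
  have hw2 : ContDiff ℝ 2 w := contDiff_trunc hv l
  have hβc := hβ.contDiff.continuous
  have hec : Continuous (energy β w) := continuous_energy hβc hw2
  have hLc : Continuous (opL β w) := continuous_opL hβc hw2
  have hχc := hχ.contDiff.continuous
  have hout : ∀ p, p ∉ S → p ∈ ball p₀ R' → v p - l ≤ 0 := by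
    intro p hp hpb
    by_contra hcon
    exact hp ⟨by simp only [mem_ofPred_eq]; linarith, hpb⟩
  have hind : ∀ K : ℝ, Integrable (S.indicator fun _ => K) := fun K =>
    (integrable_indicator_iff hSm).2 (integrableOn_const hSt)
  have hindI : ∀ K : ℝ, ∫ p, S.indicator (fun _ => K) p = K * volume.real S := fun K => by
    rw [integral_indicator hSm, setIntegral_const, smul_eq_mul, mul_comm]
  have hpt : ∀ p, χ p * energy β w p
      ≤ 13 * (χ p * opL β w p) + S.indicator (fun _ => 168 * A + 64) p := by
    intro p
    by_cases hpb : p ∈ ball p₀ R'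
    · by_cases hpS : p ∈ S
      · rw [indicator_of_mem hpS]
        have h := mul_le_mul_of_nonneg_left (energy_trunc_le β hv hl (hv1 p hpb) (hvA p hpb))
          (hχ.nonneg p)
        have h2 : χ p * (168 * A + 64) ≤ 1 * (168 * A + 64) :=
          mul_le_mul_of_nonneg_right (hχ.le_one p) (by positivity)
        linarith
      · rw [indicator_of_notMem hpS]
        have hm : max (v p - l) 0 = 0 := max_eq_right (hout p hpS hpb)
        simp only [energy, hw, opL_trunc β hv, gradSq_trunc hv, hm, trunc,
          cube_of_nonpos (hout p hpS hpb)]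
        simp
    · rw [hχ.eq_zero p hpb, indicator_of_notMem fun h => hpb h.2]
      simp
  have hi1 : Integrable fun p => χ p * energy β w p :=
    (hχc.mul hec).integrable_of_hasCompactSupport hχ.hasCompactSupport.mul_right
  have hi2 : Integrable fun p => χ p * opL β w p :=
    (hχc.mul hLc).integrable_of_hasCompactSupport hχ.hasCompactSupport.mul_right
  have hχL : ∀ p, |opL (fun y => -β y) χ p| ≤ (1 + B) * Cc * G ^ 4 := by
    intro p
    have h1 := hχ.lapY_le p
    have h2 := hχ.dirX_le p
    unfold opL
    refine (abs_add_le _ _).trans ?_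
    rw [abs_mul, abs_neg, dX_eq]
    have h3 : |β p.2| * |dir eX χ p| ≤ B * (Cc * G ^ 4) :=
      mul_le_mul (hβ.abs_le _) h2 (abs_nonneg _) (by linarith)
    linarith
  have hpt2 : ∀ p, w p * opL (fun y => -β y) χ p
      ≤ S.indicator (fun _ => 8 * ((1 + B) * Cc * G ^ 4)) p := by
    intro p
    by_cases hpb : p ∈ ball p₀ R'
    · by_cases hpS : p ∈ S
      · rw [indicator_of_mem hpS]
        calc w p * opL (fun y => -β y) χ p ≤ w p * |opL (fun y => -β y) χ p| :=
              mul_le_mul_of_nonneg_left (le_abs_self _) (trunc_nonneg v l p)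
          _ ≤ _ := mul_le_mul (trunc_le hl (hv1 p hpb)) (hχL p) (abs_nonneg _) (by norm_num)
      · rw [indicator_of_notMem hpS, hw, trunc, cube_of_nonpos (hout p hpS hpb), zero_mul]
    · rw [indicator_of_notMem fun h => hpb h.2]
      simp only [opL, hχ.lapY_eq_zero p hpb, dX_eq, hχ.dir_eq_zero hpb, mul_zero, add_zero, le_refl]
  have hi3 : Integrable fun p => w p * opL (fun y => -β y) χ p := by
    refine Continuous.integrable_of_hasCompactSupport (hw2.continuous.mul
      (continuous_opL hβc.neg hχ.contDiff)) (HasCompactSupport.intro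
        (isCompact_closedBall p₀ R') fun p hp => ?_)
    have hpb : p ∉ ball p₀ R' := fun h => hp (ball_subset_closedBall h)
    simp only [opL, hχ.lapY_eq_zero p hpb, dX_eq, hχ.dir_eq_zero hpb, mul_zero, add_zero]
  have hA1 : ∫ p, χ p * opL β w p ≤ 8 * ((1 + B) * Cc * G ^ 4) * volume.real S := by
    rw [integral_mul_opL hβ.contDiff hχ.contDiff hw2 hχ.hasCompactSupport, ← hindI]
    exact integral_mono hi3 (hind _) hpt2
  calc ∫ p in ball p₀ R, energy β w p = ∫ p in ball p₀ R, χ p * energy β w p := by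
        refine setIntegral_congr_fun measurableSet_ball fun p hp => ?_
        simp only [hχ.eq_one p (ball_subset_closedBall hp), one_mul]
    _ ≤ ∫ p, χ p * energy β w p := setIntegral_le_integral hi1 (Filter.Eventually.of_forall
        fun p => mul_nonneg (hχ.nonneg p) (energy_nonneg β w p))
    _ ≤ ∫ p, (13 * (χ p * opL β w p) + S.indicator (fun _ => 168 * A + 64) p) :=
        integral_mono hi1 ((hi2.const_mul 13).add (hind _)) hpt
    _ = 13 * (∫ p, χ p * opL β w p) + (168 * A + 64) * volume.real S := by
        rw [integral_add (hi2.const_mul 13) (hind _), integral_const_mul, hindI]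
    _ ≤ 13 * (8 * ((1 + B) * Cc * G ^ 4) * volume.real S)
        + (168 * A + 64) * (G ^ 4 * volume.real S) := by
        have h1 : volume.real S ≤ G ^ 4 * volume.real S :=
          le_mul_of_one_le_left measureReal_nonneg hG4
        gcongr
    _ = _ := by ring

end DeGiorgi

section Iteration

variable {N : ℕ}

/-- The volume of the unit ball of `ℝ × ℝ^{N-1}` (for the product metric). -/
def unitBallVolume (N : ℕ) : ℝ := volume.real (ball (0 : ℝ × Euc N) 1)

lemma unitBallVolume_pos (N : ℕ) : 0 < unitBallVolume N :=
  ENNReal.toReal_pos (measure_ball_pos _ _ one_pos).ne' measure_ball_lt_top.ne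

lemma measureReal_ball (p : ℝ × Euc N) {r : ℝ} (hr : 0 < r) :
    volume.real (ball p r) = r ^ Module.finrank ℝ (ℝ × Euc N) * unitBallVolume N := by
  rw [measureReal_def, Measure.addHaar_ball_of_pos volume p hr, ENNReal.toReal_mul,
    ENNReal.toReal_ofReal (by positivity)]
  rfl

lemma pow_six_mul_measureReal_superlevel_le {v : ℝ × Euc N → ℝ} (hv : ContDiff ℝ 2 v) {l s : ℝ}
    (hs : 0 ≤ s) (p₀ : ℝ × Euc N) (R : ℝ) :
    s ^ 6 * volume.real (superlevel v (l + s) p₀ R) ≤ ∫ p in ball p₀ R, trunc v l p ^ 2 := by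
  set S := superlevel v (l + s) p₀ R with hS
  have hSm : MeasurableSet S := measurableSet_superlevel hv.continuous _ p₀ R
  have hi : IntegrableOn (fun p => trunc v l p ^ 2) (ball p₀ R) :=
    ((contDiff_trunc hv l).continuous.pow 2).integrableOn_ball p₀ R
  calc s ^ 6 * volume.real S = ∫ p in S, s ^ 6 := by
        rw [setIntegral_const, smul_eq_mul, mul_comm]
    _ ≤ ∫ p in S, trunc v l p ^ 2 := by
        refine setIntegral_mono_on (integrableOn_const (volume_superlevel_ne_top _ _ _ _))
          (hi.mono_set inter_subset_right) hSm fun p hp => ?_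
        have h1 : s ≤ v p - l := by
          have : l + s < v p := hp.1
          linarith
        have h2 : s ^ 3 ≤ trunc v l p := by
          rw [← cube_of_nonneg hs]
          exact cube_mono h1
        calc s ^ 6 = (s ^ 3) ^ 2 := by ring
          _ ≤ _ := pow_le_pow_left₀ (by positivity) h2 2
    _ ≤ _ := setIntegral_mono_set hi (Filter.Eventually.of_forall fun p => sq_nonneg _)
        (LE.le.eventuallyLE inter_subset_right)

set_option maxHeartbeats 1000000 in
lemma FiniteType.exists_superlevel_step {β : Euc N → ℝ} {B : ℝ} (hβ : BoundedDrift β B)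
    {W : Set (Euc N)} {Z : Finset (Euc N)} {ρ c : ℝ} {j : ℕ} (hF : FiniteType β W Z ρ c j)
    {A : ℝ} (hA0 : 0 ≤ A) :
    ∃ C ≥ (1 : ℝ), ∀ (v : ℝ × Euc N → ℝ), ContDiff ℝ 2 v →
    ∀ (p₀ : ℝ × Euc N) (R R' l s σ : ℝ), 0 < R → R < R' → R' ≤ 1 → -1 ≤ l → 0 ≤ s →
    (∀ p ∈ ball p₀ R', |v p| ≤ 1) → (∀ p ∈ ball p₀ R', |opL β v p| ≤ A) →
    (∀ p ∈ ball p₀ R', p.2 ∈ W) → 0 < σ → σ ≤ ρ → σ ≤ (R' - R) / 16 →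
    s ^ 6 * volume.real (superlevel v (l + s) p₀ R)
      ≤ C * ((R' - R)⁻¹ ^ 8 * σ ^ 2 * volume.real (superlevel v l p₀ R')
        + (σ ^ ((2 * j + 2) * Module.finrank ℝ (ℝ × Euc N)))⁻¹
          * volume.real (superlevel v l p₀ R') ^ 2) := by
  obtain ⟨C₁, hC₁, hshift⟩ := hF.exists_full_shift_bound hβ
  obtain ⟨C₂, hC₂, hener⟩ := hβ.exists_energy_bound hA0
  set n := Module.finrank ℝ (ℝ × Euc N) with hn
  set κ := unitBallVolume N with hκ
  have hκ0 : 0 < κ := unitBallVolume_pos N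
  refine ⟨1 + 256 * C₁ * C₂ + 128 * 2 ^ n * κ⁻¹, ?_, ?_⟩
  · have : 0 ≤ 256 * C₁ * C₂ := by positivity
    have : 0 ≤ 128 * 2 ^ n * κ⁻¹ := by positivity
    linarith
  intro v hv p₀ R R' l s σ hR hRR' hR' hl hs hv1 hvA hW hσ hσρ hσg
  refine (pow_six_mul_measureReal_superlevel_le hv hs p₀ R).trans ?_
  set U := volume.real (superlevel v l p₀ R') with hU
  have hU0 : 0 ≤ U := measureReal_nonneg
  set g := R' - R with hg
  have hg0 : 0 < g := sub_pos.2 hRR'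
  have hσ1 : σ ≤ 1 := hσρ.trans hF.rho_le
  set T := σ ^ (2 * j + 2) with hT
  have hT0 : 0 < T := by positivity
  have hTσ : T ≤ σ := pow_le_of_le_one hσ.le hσ1 (by omega)
  set w := trunc v l with hw
  have hw2 : ContDiff ℝ 2 w := contDiff_trunc hv l
  set q : ℝ × Euc N := (T / 2, 0) with hq
  have hsT : ∀ s ∈ ball q (T / 2), 0 ≤ s.1 ∧ ‖s‖ ≤ T := by
    intro s hs
    have hs' := hs
    rw [mem_ball_prod_iff] at hs
    constructor
    · have := (abs_lt.1 hs.1).1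
      simp only [hq] at this
      linarith
    · have h1 : ‖s‖ ≤ ‖s - q‖ + ‖q‖ := by simpa using norm_add_le (s - q) q
      rw [mem_ball, dist_eq_norm] at hs'
      rw [hq, norm_mk_zero, abs_of_pos (by positivity)] at h1
      linarith
  have hw8 : ∀ p ∈ ball p₀ R', |w p| ≤ 8 := fun p hp => by
    rw [abs_of_nonneg (trunc_nonneg v l p)]
    exact trunc_le hl (hv1 p hp)
  have hE := hener v hv p₀ (R + g / 2) R' l (by linarith) (by linarith) hR' hl hv1 hvA
  rw [show R' - (R + g / 2) = g / 2 by rw [hg]; ring] at hE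
  have hX : ∀ s ∈ ball q (T / 2), ∫ p in ball p₀ R, (w (p + s) - w p) ^ 2
      ≤ 256 * C₁ * C₂ * (g⁻¹ ^ 8 * σ ^ 2 * U) := by
    intro s hs
    have h := hshift w hw2 p₀ R (R + g / 2) σ s hR (by linarith) (by linarith)
      (fun p hp => hw8 p (ball_subset_ball (by linarith) hp))
      (fun p hp => hW p (ball_subset_ball (by linarith) hp)) hσ hσρ (by linarith)
      (hsT s hs).1 (hsT s hs).2
    rw [show R + g / 2 - R = g / 2 by ring] at h
    refine h.trans ?_
    calc _ ≤ C₁ * (g / 2)⁻¹ ^ 4 * σ ^ 2 * (C₂ * (g / 2)⁻¹ ^ 4 * U) := by gcongr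
      _ = _ := by
        rw [inv_div]
        field_simp
        ring
  have hI : ∫ p in ball p₀ R', w p ≤ 8 * U := by
    have hSm := measurableSet_superlevel hv.continuous l p₀ R'
    have hst := volume_superlevel_ne_top v l p₀ R'
    calc ∫ p in ball p₀ R', w p
        ≤ ∫ p in ball p₀ R', (superlevel v l p₀ R').indicator (fun _ => (8 : ℝ)) p := by
          refine setIntegral_mono_on (hw2.continuous.integrableOn_ball _ _)
            ((integrable_indicator_iff hSm).2 (integrableOn_const hst)).integrableOn
            measurableSet_ball fun p hp => ?_
          by_cases hpS : p ∈ superlevel v l p₀ R'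
          · rw [indicator_of_mem hpS]
            exact trunc_le hl (hv1 p hp)
          · rw [indicator_of_notMem hpS]
            refine (cube_of_nonpos ?_).le
            by_contra hcon
            exact hpS ⟨by simp only [mem_ofPred_eq]; linarith, hp⟩
      _ = 8 * U := by
          rw [setIntegral_indicator hSm, inter_eq_right.2 (show superlevel v l p₀ R' ⊆ ball p₀ R' from
            inter_subset_right), setIntegral_const,
            smul_eq_mul, mul_comm]
  have hI0 : 0 ≤ ∫ p in ball p₀ R', w p := setIntegral_ball_nonneg fun p _ => trunc_nonneg v l p
  have hmain := measureReal_mul_setIntegral_sq_le hw2.continuous (trunc_nonneg v l) hRR'.le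
    (p₀ := p₀) (q := q) (δ := T / 2) (fun p hp s hs => add_mem_ball_of_mem
      (by linarith [(hsT s hs).2] : R + ‖s‖ ≤ R') hp) hX
  have hvol : volume.real (ball q (T / 2)) = (T / 2) ^ n * κ := measureReal_ball q (by positivity)
  have hvol0 : 0 < volume.real (ball q (T / 2)) := by rw [hvol]; positivity
  have hvinv : (volume.real (ball q (T / 2)))⁻¹ = 2 ^ n * κ⁻¹ * (σ ^ ((2 * j + 2) * n))⁻¹ := by
    rw [hvol, div_pow, pow_mul, ← hT]
    field_simp
  set V := volume.real (ball q (T / 2)) with hV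
  have hdiv : ∫ p in ball p₀ R, w p ^ 2
      ≤ V⁻¹ * (2 * (∫ p in ball p₀ R', w p) ^ 2) + 256 * C₁ * C₂ * (g⁻¹ ^ 8 * σ ^ 2 * U) := by
    have := mul_le_mul_of_nonneg_left hmain (inv_nonneg.2 hvol0.le)
    rwa [inv_mul_cancel_left₀ hvol0.ne', mul_add, inv_mul_cancel_left₀ hvol0.ne'] at this
  have hI2 : 2 * (∫ p in ball p₀ R', w p) ^ 2 ≤ 128 * U ^ 2 := by nlinarith
  have hfin : V⁻¹ * (2 * (∫ p in ball p₀ R', w p) ^ 2)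
      ≤ 128 * 2 ^ n * κ⁻¹ * ((σ ^ ((2 * j + 2) * n))⁻¹ * U ^ 2) := by
    calc _ ≤ V⁻¹ * (128 * U ^ 2) := by gcongr
      _ = _ := by rw [hvinv]; ring
  set a := g⁻¹ ^ 8 * σ ^ 2 * U with ha
  set b := (σ ^ ((2 * j + 2) * n))⁻¹ * U ^ 2 with hb
  have ha0 : 0 ≤ a := by positivity
  have hb0 : 0 ≤ b := by positivity
  have h1 : 0 ≤ 256 * C₁ * C₂ := by positivity
  have h2 : 0 ≤ 128 * 2 ^ n * κ⁻¹ := by positivity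
  have h3 := mul_nonneg h1 hb0
  have h4 := mul_nonneg h2 ha0
  linarith

lemma superlevel_anti {v : ℝ × Euc N → ℝ} {l l' : ℝ} (hl : l ≤ l') {p₀ : ℝ × Euc N} {R R' : ℝ}
    (hR : R ≤ R') : superlevel v l' p₀ R ⊆ superlevel v l p₀ R' :=
  inter_subset_inter (fun _ hp => lt_of_le_of_lt hl hp) (ball_subset_ball hR)

lemma iteration_scalar {C ε d τ₀ U U' : ℝ} {k m : ℕ} (hC : 1 ≤ C) (hε : 0 < ε) (hd : 0 < d)
    (hd1 : d ≤ 1) (hτ₀ : 0 < τ₀) (hU0 : 0 ≤ U)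
    (hsmall : C * (2 * 64 * 4 ^ 8) * ε⁻¹ ^ 6 * d⁻¹ ^ 8 * τ₀ ^ 2 ≤ (1 / 128) ^ (m + 2))
    (hU : U ≤ (τ₀ * (1 / 128) ^ k) ^ (m + 2))
    (hstep : (ε * (1 / 2) ^ (k + 1)) ^ 6 * U' ≤ C * ((d * (1 / 2) ^ (k + 2))⁻¹ ^ 8
      * (τ₀ * (1 / 128) ^ k) ^ 2 * U + ((τ₀ * (1 / 128) ^ k) ^ m)⁻¹ * U ^ 2)) :
    U' ≤ (τ₀ * (1 / 128) ^ (k + 1)) ^ (m + 2) := by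
  set τ := τ₀ * (1 / 128) ^ k with hτ
  have hτ0 : 0 < τ := by positivity
  have h1 : (τ ^ m)⁻¹ * U ^ 2 ≤ τ ^ 2 * U := by
    calc (τ ^ m)⁻¹ * U ^ 2 = (τ ^ m)⁻¹ * U * U := by ring
      _ ≤ (τ ^ m)⁻¹ * τ ^ (m + 2) * U := by gcongr
      _ = τ ^ 2 * U := by rw [pow_add]; field_simp
  have hdk : 1 ≤ (d * (1 / 2) ^ (k + 2))⁻¹ ^ 8 := by
    refine one_le_pow₀ ((one_le_inv₀ (by positivity)).2 ?_)
    exact mul_le_one₀ hd1 (by positivity) (pow_le_one₀ (by norm_num) (by norm_num))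
  have h2 : (ε * (1 / 2) ^ (k + 1)) ^ 6 * U'
      ≤ C * (2 * (d * (1 / 2) ^ (k + 2))⁻¹ ^ 8 * τ ^ 2 * τ ^ (m + 2)) := by
    refine hstep.trans (mul_le_mul_of_nonneg_left ?_ (by linarith))
    have h3 : τ ^ 2 * U ≤ (d * (1 / 2) ^ (k + 2))⁻¹ ^ 8 * (τ ^ 2 * U) :=
      le_mul_of_one_le_left (by positivity) hdk
    calc _ ≤ 2 * (d * (1 / 2) ^ (k + 2))⁻¹ ^ 8 * τ ^ 2 * U := by linarith
      _ ≤ _ := by gcongr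
  have hs0 : 0 < (ε * (1 / 2) ^ (k + 1)) ^ 6 := by positivity
  have h4 : U' ≤ C * (2 * (d * (1 / 2) ^ (k + 2))⁻¹ ^ 8 * τ ^ 2 * τ ^ (m + 2))
      / (ε * (1 / 2) ^ (k + 1)) ^ 6 := by
    rw [le_div_iff₀ hs0, mul_comm]
    exact h2
  have h5 : C * (2 * (d * (1 / 2) ^ (k + 2))⁻¹ ^ 8 * τ ^ 2 * τ ^ (m + 2))
      / (ε * (1 / 2) ^ (k + 1)) ^ 6
      = (C * (2 * 64 * 4 ^ 8) * ε⁻¹ ^ 6 * d⁻¹ ^ 8 * τ₀ ^ 2) * τ ^ (m + 2) := by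
    have e1 : ((1 : ℝ) / 128) ^ k = ((1 / 2) ^ k) ^ 7 := by
      rw [← pow_mul, mul_comm k 7, pow_mul]; norm_num
    have e2 : τ ^ 2 = τ₀ ^ 2 * ((1 / 2) ^ k) ^ 14 := by rw [hτ, e1]; ring
    rw [e2, pow_succ _ (k + 1), pow_succ _ k]
    set h : ℝ := (1 / 2) ^ k with hh
    have hh0 : h ≠ 0 := by positivity
    field_simp
    ring
  calc U' ≤ _ := h4
    _ = _ := h5
    _ ≤ (1 / 128) ^ (m + 2) * τ ^ (m + 2) := by gcongr
    _ = _ := by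
      rw [← mul_pow, hτ, pow_succ _ k]
      ring

set_option maxHeartbeats 1000000 in
/-- If `v` exceeds `l` only on a very small part of a ball, then `v ≤ l + ε` on the ball of half
the radius. -/
lemma FiniteType.exists_superlevel_criterion {β : Euc N → ℝ} {B : ℝ} (hβ : BoundedDrift β B)
    {W : Set (Euc N)} {Z : Finset (Euc N)} {ρ c : ℝ} {j : ℕ} (hF : FiniteType β W Z ρ c j) :
    ∃ m : ℕ, 0 < m ∧ ∀ A ε : ℝ, 0 ≤ A → 0 < ε → ∃ c₀ > (0 : ℝ),
    ∀ (v : ℝ × Euc N → ℝ), ContDiff ℝ 2 v →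
    ∀ (p₀ : ℝ × Euc N) (d l : ℝ), 0 < d → d ≤ 1 → -1 ≤ l →
    (∀ p ∈ ball p₀ d, |v p| ≤ 1) → (∀ p ∈ ball p₀ d, |opL β v p| ≤ A) →
    (∀ p ∈ ball p₀ d, p.2 ∈ W) → volume.real (superlevel v l p₀ d) ≤ c₀ * d ^ m →
    ∀ p ∈ ball p₀ (d / 2), v p ≤ l + ε := by
  set m := (2 * j + 2) * Module.finrank ℝ (ℝ × Euc N) with hm
  refine ⟨4 * (m + 2), by omega, fun A ε hA hε => ?_⟩
  obtain ⟨C, hC, hstep⟩ := hF.exists_superlevel_step hβ hA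
  have hρ := hF.rho_pos
  set K := C * (2 * 64 * 4 ^ 8) * ε⁻¹ ^ 6 with hK
  have hK0 : 0 < K := by positivity
  obtain ⟨θ, hθ0, hθρ, hθ64, hθK⟩ : ∃ θ : ℝ, 0 < θ ∧ θ ≤ ρ ∧ θ ≤ 1 / 64 ∧
      K * θ ^ 2 ≤ (1 / 128) ^ (m + 2) := by
    refine ⟨min ρ (min (1 / 64) (K⁻¹ * (1 / 128) ^ (m + 2))), by positivity, min_le_left _ _,
      (min_le_right _ _).trans (min_le_left _ _), ?_⟩
    set θ := min ρ (min (1 / 64) (K⁻¹ * (1 / 128) ^ (m + 2)))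
    have h0 : 0 < θ := by positivity
    have h1 : θ ≤ 1 / 64 := (min_le_right _ _).trans (min_le_left _ _)
    have h2 : θ ≤ K⁻¹ * (1 / 128) ^ (m + 2) := (min_le_right _ _).trans (min_le_right _ _)
    calc K * θ ^ 2 ≤ K * θ := by
          refine mul_le_mul_of_nonneg_left ?_ hK0.le
          nlinarith
      _ ≤ K * (K⁻¹ * (1 / 128) ^ (m + 2)) := by gcongr
      _ = _ := by field_simp
  refine ⟨θ ^ (m + 2), by positivity, ?_⟩
  intro v hv p₀ d l hd hd1 hl hv1 hvA hW hsmall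
  set τ₀ := θ * d ^ 4 with hτ₀
  have hτ₀0 : 0 < τ₀ := by positivity
  have hd4 : d ^ 4 ≤ d := pow_le_of_le_one hd.le hd1 (by norm_num)
  have hτ₀d : τ₀ ≤ d / 64 := by
    calc θ * d ^ 4 ≤ 1 / 64 * d := by gcongr
      _ = d / 64 := by ring
  have hτ₀ρ : τ₀ ≤ ρ := by
    calc θ * d ^ 4 ≤ θ * 1 := by gcongr; exact hd4.trans hd1
      _ ≤ ρ := by linarith
  have hsm : C * (2 * 64 * 4 ^ 8) * ε⁻¹ ^ 6 * d⁻¹ ^ 8 * τ₀ ^ 2 ≤ (1 / 128) ^ (m + 2) := by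
    have : C * (2 * 64 * 4 ^ 8) * ε⁻¹ ^ 6 * d⁻¹ ^ 8 * τ₀ ^ 2 = K * θ ^ 2 := by
      rw [hK, hτ₀]
      field_simp
    rw [this]
    exact hθK
  set R : ℕ → ℝ := fun k => d / 2 * (1 + (1 / 2) ^ k) with hR
  set L : ℕ → ℝ := fun k => l + ε * (1 - (1 / 2) ^ k) with hL
  have hhalf : ∀ k : ℕ, ((1 : ℝ) / 2) ^ k ≤ 1 := fun k => pow_le_one₀ (by norm_num) (by norm_num)
  have hRd : ∀ k, R k ≤ d := fun k => by
    simp only [hR]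
    nlinarith [hhalf k]
  have hU : ∀ k, volume.real (superlevel v (L k) p₀ (R k)) ≤ (τ₀ * (1 / 128) ^ k) ^ (m + 2) := by
    intro k
    induction k with
    | zero =>
      have e1 : R 0 = d := by simp only [hR]; ring
      have e2 : L 0 = l := by simp [hL]
      rw [e1, e2]
      refine hsmall.trans (le_of_eq ?_)
      rw [hτ₀, pow_zero, mul_one, mul_pow, ← pow_mul]
    | succ k ih =>
      have hgap : R k - R (k + 1) = d * (1 / 2) ^ (k + 2) := by
        simp only [hR]; ring
      have hLs : L (k + 1) = L k + ε * (1 / 2) ^ (k + 1) := by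
        simp only [hL]; ring
      have hτk : τ₀ * (1 / 128) ^ k ≤ τ₀ :=
        mul_le_of_le_one_right hτ₀0.le (pow_le_one₀ (by norm_num) (by norm_num))
      have h128 : ((1 : ℝ) / 128) ^ k ≤ (1 / 2) ^ k := pow_le_pow_left₀ (by norm_num) (by norm_num) k
      have hst := hstep v hv p₀ (R (k + 1)) (R k) (L k) (ε * (1 / 2) ^ (k + 1))
        (τ₀ * (1 / 128) ^ k) (by simp only [hR]; positivity)
        (by
          have : 0 < R k - R (k + 1) := by rw [hgap]; positivity
          linarith) ((hRd k).trans hd1)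
        (by
          have : 0 ≤ ε * (1 - (1 / 2) ^ k) := mul_nonneg hε.le (by linarith [hhalf k])
          simp only [hL]
          linarith) (by positivity)
        (fun p hp => hv1 p (ball_subset_ball (hRd k) hp))
        (fun p hp => hvA p (ball_subset_ball (hRd k) hp))
        (fun p hp => hW p (ball_subset_ball (hRd k) hp)) (by positivity) (hτk.trans hτ₀ρ)
        (by
          rw [hgap]
          calc τ₀ * (1 / 128) ^ k ≤ d / 64 * (1 / 2) ^ k := by gcongr
            _ = _ := by rw [pow_add]; ring)
      rw [hgap, ← hLs] at hst
      exact iteration_scalar hC hε hd hd1 hτ₀0 measureReal_nonneg hsm ih hst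
  have hzero : volume.real (superlevel v (l + ε) p₀ (d / 2)) ≤ 0 := by
    have hlim : Filter.Tendsto (fun k : ℕ => (τ₀ * (1 / 128) ^ k) ^ (m + 2)) Filter.atTop
        (nhds ((τ₀ * 0) ^ (m + 2))) :=
      ((tendsto_pow_atTop_nhds_zero_of_lt_one (by norm_num) (by norm_num)).const_mul τ₀).pow _
    rw [mul_zero, zero_pow (by omega)] at hlim
    refine ge_of_tendsto' hlim fun k => le_trans ?_ (hU k)
    refine measureReal_mono (superlevel_anti ?_ ?_) (volume_superlevel_ne_top _ _ _ _)
    · simp only [hL]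
      have : 0 ≤ ε * (1 / 2) ^ k := by positivity
      linarith
    · simp only [hR]
      have : 0 ≤ d / 2 * (1 / 2) ^ k := by positivity
      linarith
  have hnull : volume (superlevel v (l + ε) p₀ (d / 2)) = 0 := by
    have h0 := le_antisymm hzero measureReal_nonneg
    exact (measureReal_eq_zero_iff (volume_superlevel_ne_top _ _ _ _)).1 h0
  have hopen : IsOpen (superlevel v (l + ε) p₀ (d / 2)) :=
    (isOpen_lt continuous_const hv.continuous).inter isOpen_ball
  have hempty := hopen.measure_eq_zero_iff volume |>.1 hnull
  intro p hp
  by_contra hcon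
  exact (hempty ▸ (⟨not_le.1 hcon, hp⟩ : p ∈ superlevel v (l + ε) p₀ (d / 2)) :
    p ∈ (∅ : Set (ℝ × Euc N)))

end Iteration

section SupBound

variable {N : ℕ}

lemma measureReal_superlevel_mul_le {v : ℝ × Euc N → ℝ} (hv : Continuous v) {l : ℝ}
    {p₀ : ℝ × Euc N} {R : ℝ} (h0 : ∀ p ∈ ball p₀ R, 0 ≤ v p) :
    volume.real (superlevel v l p₀ R) * l ≤ ∫ p in ball p₀ R, v p := by
  have hSm := measurableSet_superlevel hv l p₀ R
  calc volume.real (superlevel v l p₀ R) * l = ∫ p in superlevel v l p₀ R, l := by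
        rw [setIntegral_const, smul_eq_mul]
    _ ≤ ∫ p in superlevel v l p₀ R, v p :=
        setIntegral_mono_on (integrableOn_const (volume_superlevel_ne_top _ _ _ _))
          ((hv.integrableOn_ball p₀ R).mono_set inter_subset_right) hSm fun p hp => le_of_lt hp.1
    _ ≤ _ := setIntegral_mono_set (hv.integrableOn_ball p₀ R)
        ((ae_restrict_iff' measurableSet_ball).2 (Filter.Eventually.of_forall h0))
        (LE.le.eventuallyLE inter_subset_right)

set_option maxHeartbeats 1000000 in
/-- The local supremum bound for nonnegative functions with `|L v| ≤ M v`. -/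
lemma FiniteType.exists_sup_bound {β : Euc N → ℝ} {B : ℝ} (hβ : BoundedDrift β B)
    {W : Set (Euc N)} {Z : Finset (Euc N)} {ρ c : ℝ} {j : ℕ} (hF : FiniteType β W Z ρ c j)
    {M d : ℝ} (hM : 0 ≤ M) (hd : 0 < d) (hd1 : d ≤ 1) :
    ∃ C > (0 : ℝ), ∀ (v : ℝ × Euc N → ℝ), ContDiff ℝ 2 v → ∀ z : ℝ × Euc N,
    (∀ p ∈ ball z d, 0 ≤ v p) → (∀ p ∈ ball z d, |opL β v p| ≤ M * v p) →
    (∀ p ∈ ball z d, p.2 ∈ W) → v z ≤ C * ∫ p in ball z d, v p := by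
  obtain ⟨m, hm, hcrit⟩ := hF.exists_superlevel_criterion hβ
  set e : ℝ := (1 / 2) ^ m / 4 with he
  have he0 : 0 < e := by positivity
  obtain ⟨c₀, hc₀, hc⟩ := hcrit M e hM he0
  refine ⟨4 * 2 ^ m * c₀⁻¹ * d⁻¹ ^ m, by positivity, ?_⟩
  intro v hv z h0 hL hW
  have hI0 : 0 ≤ ∫ p in ball z d, v p := setIntegral_ball_nonneg h0
  have hzb : z ∈ ball z d := mem_ball_self hd
  rcases (h0 z hzb).eq_or_lt with hz | hz
  · rw [← hz]
    positivity
  obtain ⟨q, hq, hmax⟩ := (isCompact_closedBall z d).exists_isMaxOn ⟨z, mem_closedBall_self hd.le⟩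
    (f := fun p => v p * (d - dist p z) ^ m)
    (Continuous.continuousOn (by have := hv.continuous; fun_prop))
  have hqz : v z * d ^ m ≤ v q * (d - dist q z) ^ m := by
    have := hmax (mem_closedBall_self hd.le : z ∈ closedBall z d)
    simpa using this
  have hqd : dist q z ≤ d := hq
  have hqd : dist q z < d := by
    refine lt_of_le_of_ne hqd fun h => ?_
    rw [h, sub_self, zero_pow hm.ne', mul_zero] at hqz
    exact absurd hqz (not_le.2 (by positivity))
  set r := d - dist q z with hr
  have hr0 : 0 < r := by linarith
  have hsub : ball q (r / 2) ⊆ ball z d := fun p hp => by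
    rw [mem_ball] at hp ⊢
    have := dist_triangle p q z
    linarith
  have hvq : 0 < v q := by
    have h1 : 0 < v q * r ^ m := lt_of_lt_of_le (by positivity) hqz
    exact (pos_iff_pos_of_mul_pos h1).2 (by positivity)
  have hle : ∀ p ∈ ball q (r / 2), v p ≤ 2 ^ m * v q := by
    intro p hp
    have hpb := hsub hp
    have h1 : v p * (d - dist p z) ^ m ≤ v q * r ^ m := hmax (ball_subset_closedBall hpb)
    rw [mem_ball] at hp
    have hrp : r / 2 ≤ d - dist p z := by
      have := dist_triangle p q z
      linarith
    have h2 : v p * (r / 2) ^ m ≤ v q * r ^ m :=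
      (mul_le_mul_of_nonneg_left (pow_le_pow_left₀ (by linarith) hrp m) (h0 p hpb)).trans h1
    rw [div_pow, ← mul_div_assoc, div_le_iff₀ (by positivity)] at h2
    have hpos : 0 < r ^ m := by positivity
    refine le_of_mul_le_mul_right (h2.trans (le_of_eq ?_)) hpos
    ring
  set V := 2 ^ m * v q with hV
  have hV0 : 0 < V := by positivity
  have hvt : ContDiff ℝ 2 fun p => V⁻¹ * v p := contDiff_const.mul hv
  have hcr : c₀ * (r / 2) ^ m ≤ volume.real (superlevel (fun p => V⁻¹ * v p) e q (r / 2)) := by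
    by_contra hcon
    have hd2 : r / 2 ≤ 1 := by
      have := dist_nonneg (x := q) (y := z)
      linarith
    have := hc _ hvt q (r / 2) e (by positivity) hd2 (by linarith) ?_ ?_
      (fun p hp => hW p (hsub hp)) (not_le.1 hcon).le q (mem_ball_self (by positivity))
    · have h1 : V⁻¹ * v q = (1 / 2) ^ m := by
        rw [hV, one_div, inv_pow]
        field_simp
      rw [h1] at this
      have : 0 < ((1 : ℝ) / 2) ^ m := by positivity
      linarith
    · intro p hp
      have h1 := h0 p (hsub hp)
      rw [abs_of_nonneg (by positivity), inv_mul_le_iff₀ hV0, mul_one]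
      exact hle p hp
    · intro p hp
      rw [opL_const_mul β hv, abs_mul, abs_of_pos (inv_pos.2 hV0), inv_mul_le_iff₀ hV0, mul_comm V]
      exact (hL p (hsub hp)).trans (mul_le_mul_of_nonneg_left (hle p hp) hM)
  have hinteg := measureReal_superlevel_mul_le (l := e) hvt.continuous (p₀ := q) (R := r / 2)
    fun p hp => mul_nonneg (inv_pos.2 hV0).le (h0 p (hsub hp))
  rw [integral_const_mul, inv_mul_eq_div, le_div_iff₀ hV0] at hinteg
  have hmono : ∫ p in ball q (r / 2), v p ≤ ∫ p in ball z d, v p :=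
    setIntegral_mono_set (hv.continuous.integrableOn_ball z d)
      ((ae_restrict_iff' measurableSet_ball).2 (Filter.Eventually.of_forall h0))
      (LE.le.eventuallyLE hsub)
  have hfin : c₀ * (r / 2) ^ m * e * V ≤ ∫ p in ball z d, v p := by
    refine le_trans ?_ (hinteg.trans hmono)
    gcongr
  have hval : c₀ * (r / 2) ^ m * e * V = c₀ * (4 * 2 ^ m)⁻¹ * (v q * r ^ m) := by
    rw [he, hV, div_pow, div_pow, one_pow]
    field_simp
  have hkey : c₀ * (4 * 2 ^ m)⁻¹ * (v z * d ^ m) ≤ ∫ p in ball z d, v p := by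
    refine le_trans ?_ (hval ▸ hfin)
    gcongr
  calc v z = 4 * 2 ^ m * c₀⁻¹ * d⁻¹ ^ m * (c₀ * (4 * 2 ^ m)⁻¹ * (v z * d ^ m)) := by
        rw [inv_pow]
        field_simp
    _ ≤ _ := by gcongr

end SupBound

section Averages

variable {N : ℕ}

lemma hasFDerivAt_segmentAverage {F : Type*} [NormedAddCommGroup F] [NormedSpace ℝ F]
    [CompleteSpace F] {f : ℝ × Euc N → F} (hf : ContDiff ℝ 1 f) (e p : ℝ × Euc N) :
    HasFDerivAt (fun p => ∫ θ in (0 : ℝ)..1, f (p + θ • e))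
      (∫ θ in (0 : ℝ)..1, fderiv ℝ f (p + θ • e)) p := by
  have hfc := hf.continuous
  have hdc : Continuous (fderiv ℝ f) := hf.continuous_fderiv one_ne_zero
  obtain ⟨C, hC⟩ := ((isCompact_closedBall p 1).prod (isCompact_Icc (a := (0 : ℝ)) (b := 1))
    ).exists_bound_of_continuousOn (f := fun z : (ℝ × Euc N) × ℝ => fderiv ℝ f (z.1 + z.2 • e))
    (Continuous.continuousOn (hdc.comp (by fun_prop)))
  refine intervalIntegral.hasFDerivAt_integral_of_dominated_of_fderiv_le (bound := fun _ => C)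
    (F' := fun p θ => fderiv ℝ f (p + θ • e))
    (ball_mem_nhds p one_pos) ?_ ?_ ?_ ?_ ?_ ?_
  · exact Filter.Eventually.of_forall fun q => Continuous.aestronglyMeasurable (by fun_prop)
  · exact Continuous.intervalIntegrable (by fun_prop) _ _
  · exact Continuous.aestronglyMeasurable (hdc.comp (by fun_prop))
  · refine Filter.Eventually.of_forall fun θ hθ q hq => hC (q, θ) ⟨ball_subset_closedBall hq, ?_⟩
    rw [uIoc_of_le zero_le_one] at hθ
    exact ⟨hθ.1.le, hθ.2⟩
  · exact intervalIntegrable_const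
  · refine Filter.Eventually.of_forall fun θ hθ q hq => ?_
    exact (hasFDerivAt_comp_add_right (θ • e)).2
      ((hf.differentiable one_ne_zero) (q + θ • e)).hasFDerivAt

/-- The average of `f` over the segment from `p` to `p + e`. -/
def segmentAverage (e : ℝ × Euc N) (f : ℝ × Euc N → ℝ) (p : ℝ × Euc N) : ℝ :=
  ∫ θ in (0 : ℝ)..1, f (p + θ • e)

lemma contDiff_one_segmentAverage {F : Type*} [NormedAddCommGroup F] [NormedSpace ℝ F]
    [CompleteSpace F] {f : ℝ × Euc N → F} (hf : ContDiff ℝ 1 f) (e : ℝ × Euc N) :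
    ContDiff ℝ 1 (fun p => ∫ θ in (0 : ℝ)..1, f (p + θ • e)) := by
  rw [contDiff_one_iff_fderiv]
  refine ⟨fun p => (hasFDerivAt_segmentAverage hf e p).differentiableAt, ?_⟩
  have : fderiv ℝ (fun p => ∫ θ in (0 : ℝ)..1, f (p + θ • e))
      = fun p => ∫ θ in (0 : ℝ)..1, fderiv ℝ f (p + θ • e) :=
    funext fun p => (hasFDerivAt_segmentAverage hf e p).fderiv
  rw [this]
  refine intervalIntegral.continuous_parametric_intervalIntegral_of_continuous' ?_ 0 1
  have hdc : Continuous (fderiv ℝ f) := hf.continuous_fderiv one_ne_zero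
  simp only [Function.uncurry_def]
  exact hdc.comp (by fun_prop)

lemma contDiff_segmentAverage {f : ℝ × Euc N → ℝ} (hf : ContDiff ℝ 2 f) (e : ℝ × Euc N) :
    ContDiff ℝ 2 (segmentAverage e f) := by
  have hf1 := hf.one_of_two
  have hdiff : ∀ p, HasFDerivAt (segmentAverage e f) _ p := hasFDerivAt_segmentAverage hf1 e
  rw [show (2 : WithTop ℕ∞) = 1 + 1 by norm_num, contDiff_succ_iff_fderiv]
  refine ⟨fun p => (hdiff p).differentiableAt, by simp, ?_⟩
  rw [show fderiv ℝ (segmentAverage e f) = fun p => ∫ θ in (0 : ℝ)..1, fderiv ℝ f (p + θ • e)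
    from funext fun p => (hdiff p).fderiv]
  exact contDiff_one_segmentAverage (hf.fderiv_right (m := 1) (by norm_num)) e

lemma dir_segmentAverage {f : ℝ × Euc N → ℝ} (hf : ContDiff ℝ 1 f) (e e' : ℝ × Euc N) :
    dir e' (segmentAverage e f) = segmentAverage e (dir e' f) := by
  funext p
  have h : HasFDerivAt (segmentAverage e f) _ p := hasFDerivAt_segmentAverage hf e p
  have hdc : Continuous (fderiv ℝ f) := hf.continuous_fderiv one_ne_zero
  unfold dir
  rw [h.fderiv, ContinuousLinearMap.intervalIntegral_apply]
  · rfl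
  · exact (hdc.comp (by fun_prop)).intervalIntegrable _ _

lemma opL_segmentAverage (β : Euc N → ℝ) {f : ℝ × Euc N → ℝ} (hf : ContDiff ℝ 2 f) (h : ℝ)
    (p : ℝ × Euc N) :
    opL β (segmentAverage (h, 0) f) p = ∫ θ in (0 : ℝ)..1, opL β f (p + θ • ((h, 0) : ℝ × Euc N)) := by
  have hf1 := hf.one_of_two
  have hc : ∀ g : ℝ × Euc N → ℝ, Continuous g →
      IntervalIntegrable (fun θ : ℝ => g (p + θ • ((h, 0) : ℝ × Euc N))) volume 0 1 := fun g hg =>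
    (hg.comp (by fun_prop)).intervalIntegrable _ _
  simp only [opL, lapY_eq, dX_eq, dir_segmentAverage hf1, dir_segmentAverage (hf.dir_one _)]
  rw [intervalIntegral.integral_add, intervalIntegral.integral_finsetSum]
  · congr 1
    simp [segmentAverage, ← intervalIntegral.integral_const_mul]
  · exact fun i _ => hc _ ((hf.dir_one _).continuous_dir _)
  · exact hc (lapY f) (continuous_lapY hf)
  · have := hc _ (hf1.continuous_dir eX)
    simpa using this.const_mul (β p.2)

lemma mul_dX_segmentAverage {f : ℝ × Euc N → ℝ} (hf : ContDiff ℝ 1 f) (h : ℝ)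
    (p : ℝ × Euc N) : h * dX (segmentAverage (h, 0) f) p = f (p + (h, 0)) - f p := by
  rw [shift_sub_eq_intervalIntegral hf, dX_eq, dir_segmentAverage hf, segmentAverage,
    ← intervalIntegral.integral_const_mul]
  refine intervalIntegral.integral_congr fun θ _ => ?_
  have : ((h, 0) : ℝ × Euc N) = h • eX := by simp [eX]
  simp only [dir]
  conv_rhs => rw [this]
  rw [map_smul, smul_eq_mul, this]

end Averages

section Modulus

variable {N : ℕ}

lemma FiniteType.exists_abs_le_of_setIntegral_sq_le {β : Euc N → ℝ} {B : ℝ}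
    (hβ : BoundedDrift β B) {W : Set (Euc N)} {Z : Finset (Euc N)} {ρ c : ℝ} {j : ℕ}
    (hF : FiniteType β W Z ρ c j) {A ε d : ℝ} (hA : 0 ≤ A) (hε : 0 < ε) (hd : 0 < d)
    (hd1 : d ≤ 1) : ∃ δ > (0 : ℝ), ∀ (v : ℝ × Euc N → ℝ), ContDiff ℝ 2 v → ∀ z : ℝ × Euc N,
    (∀ p ∈ ball z d, |v p| ≤ 1) → (∀ p ∈ ball z d, |opL β v p| ≤ A) →
    (∀ p ∈ ball z d, p.2 ∈ W) → ∫ p in ball z d, v p ^ 2 ≤ δ → |v z| ≤ ε := by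
  obtain ⟨m, -, hm⟩ := hF.exists_superlevel_criterion hβ
  obtain ⟨c₀, hc₀, hcrit⟩ := hm A (ε / 2) hA (half_pos hε)
  refine ⟨c₀ * d ^ m * (ε / 2) ^ 2, by positivity, fun v hv z h1 hL hW hinteg => ?_⟩
  have key : ∀ f : ℝ × Euc N → ℝ, ContDiff ℝ 2 f → (∀ p ∈ ball z d, |f p| ≤ 1) →
      (∀ p ∈ ball z d, |opL β f p| ≤ A) → ∫ p in ball z d, f p ^ 2 ≤ c₀ * d ^ m * (ε / 2) ^ 2 →
      f z ≤ ε := by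
    intro f hf hf1 hfL hfi
    have hvol := measureReal_superlevel_mul_le (l := (ε / 2) ^ 2) (hf.continuous.pow 2)
      (p₀ := z) (R := d) fun p _ => sq_nonneg _
    have hsub : superlevel f (ε / 2) z d ⊆ superlevel (fun p => f p ^ 2) ((ε / 2) ^ 2) z d :=
      fun p hp => ⟨pow_lt_pow_left₀ hp.1 (half_pos hε).le two_ne_zero, hp.2⟩
    have hmono := measureReal_mono hsub (volume_superlevel_ne_top _ _ _ _)
    have hle : volume.real (superlevel f (ε / 2) z d) ≤ c₀ * d ^ m := by
      refine hmono.trans (le_of_mul_le_mul_right (hvol.trans hfi) (by positivity))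
    have := hcrit f hf z d (ε / 2) hd hd1 (by linarith) hf1 hfL hW hle z
      (mem_ball_self (half_pos hd))
    linarith
  have hneg : ∀ p, (fun p => -1 * v p) p = -v p := fun p => by ring
  refine abs_le.2 ⟨?_, key v hv h1 hL hinteg⟩
  have := key (fun p => -1 * v p) (contDiff_const.mul hv) (fun p hp => ?_) (fun p hp => ?_) ?_
  · simp only [hneg] at this
    linarith
  · simpa using h1 p hp
  · rw [opL_const_mul β hv]
    simpa using hL p hp
  · simpa using hinteg

/-- `v` takes values in `[0, 1]` on `S`, the operator is bounded by `A` on it, and `S` lies over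
`W`. -/
structure UnitBounded (β : Euc N → ℝ) (W : Set (Euc N)) (A : ℝ) (v : ℝ × Euc N → ℝ)
    (S : Set (ℝ × Euc N)) : Prop where
  contDiff : ContDiff ℝ 2 v
  nonneg : ∀ p ∈ S, 0 ≤ v p
  le_one : ∀ p ∈ S, v p ≤ 1
  abs_opL_le : ∀ p ∈ S, |opL β v p| ≤ A
  snd_mem : ∀ p ∈ S, p.2 ∈ W

lemma UnitBounded.mono {β : Euc N → ℝ} {W : Set (Euc N)} {A : ℝ} {v : ℝ × Euc N → ℝ}
    {S S' : Set (ℝ × Euc N)} (h : UnitBounded β W A v S) (hS : S' ⊆ S) :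
    UnitBounded β W A v S' :=
  ⟨h.contDiff, fun p hp => h.nonneg p (hS hp), fun p hp => h.le_one p (hS hp),
    fun p hp => h.abs_opL_le p (hS hp), fun p hp => h.snd_mem p (hS hp)⟩

lemma UnitBounded.abs_le {β : Euc N → ℝ} {W : Set (Euc N)} {A : ℝ} {v : ℝ × Euc N → ℝ}
    {S : Set (ℝ × Euc N)} (h : UnitBounded β W A v S) {p : ℝ × Euc N} (hp : p ∈ S) :
    |v p| ≤ 1 := by
  rw [abs_of_nonneg (h.nonneg p hp)]
  exact h.le_one p hp

lemma UnitBounded.abs_sub_le {β : Euc N → ℝ} {W : Set (Euc N)} {A : ℝ} {v : ℝ × Euc N → ℝ}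
    {S : Set (ℝ × Euc N)} (h : UnitBounded β W A v S) {p q : ℝ × Euc N} (hp : p ∈ S)
    (hq : q ∈ S) : |v p - v q| ≤ 1 :=
  abs_sub_le_iff.2 ⟨by linarith [h.le_one p hp, h.nonneg q hq],
    by linarith [h.le_one q hq, h.nonneg p hp]⟩

lemma BoundedDrift.exists_setIntegral_energy_le {β : Euc N → ℝ} {B : ℝ} (hβ : BoundedDrift β B)
    (W : Set (Euc N)) {A d : ℝ} (hA : 0 ≤ A) (hd : 0 < d) (hd1 : d ≤ 1) :
    ∃ E > (0 : ℝ), ∀ (v : ℝ × Euc N → ℝ) (p : ℝ × Euc N), UnitBounded β W A v (ball p d) →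
      ∫ q in ball p (d / 2), energy β v q ≤ E := by
  obtain ⟨C, hC1, hC⟩ := hβ.exists_energy_bound hA
  set V := d ^ Module.finrank ℝ (ℝ × Euc N) * unitBallVolume N with hV
  have hV0 : 0 < V := mul_pos (pow_pos hd _) (unitBallVolume_pos N)
  refine ⟨C * (d - d / 2)⁻¹ ^ 4 * V + (A + 1) * V, ?_, fun v p h => ?_⟩
  · have : 0 < d - d / 2 := by linarith
    positivity
  have hdd : d / 2 < d := by linarith
  have hsub : ball p (d / 2) ⊆ ball p d := ball_subset_ball hdd.le
  have hle := hC v h.contDiff p (d / 2) d (-1) (half_pos hd) hdd hd1 le_rfl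
    (fun q hq => h.abs_le hq) h.abs_opL_le
  have hvol : volume.real (superlevel v (-1) p d) ≤ V := by
    rw [hV, ← measureReal_ball p hd]
    exact measureReal_mono inter_subset_right measure_ball_lt_top.ne
  have hvol2 : volume.real (ball p (d / 2)) ≤ V := by
    rw [hV, ← measureReal_ball p hd]
    exact measureReal_mono hsub measure_ball_lt_top.ne
  have hβc := hβ.contDiff.continuous
  have ht := contDiff_trunc h.contDiff (-1)
  have hpt : ∀ q ∈ ball p (d / 2), energy β v q ≤ energy β (trunc v (-1)) q + (A + 1) := by
    intro q hq
    have hm : 1 ≤ max (v q - -1) 0 := le_max_of_le_left (by linarith [h.nonneg q (hsub hq)])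
    have hg := gradSq_nonneg v q
    have h1 := sq_le_energy β (trunc v (-1)) q
    have h2 : gradSq v q ≤ gradSq (trunc v (-1)) q := by
      rw [gradSq_trunc h.contDiff]
      refine le_mul_of_one_le_left hg (one_le_pow₀ ?_)
      linarith [one_le_pow₀ hm (n := 2)]
    have h3 : v q ^ 2 ≤ 1 := (sq_le_one_iff_abs_le_one _).2 (h.abs_le (hsub hq))
    have h4 := h.abs_opL_le q (hsub hq)
    have h5 := sq_nonneg (trunc v (-1) q)
    unfold energy at h1 ⊢
    linarith
  calc ∫ q in ball p (d / 2), energy β v q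
      ≤ ∫ q in ball p (d / 2), (energy β (trunc v (-1)) q + (A + 1)) :=
        setIntegral_ball_mono (continuous_energy hβc h.contDiff)
          ((continuous_energy hβc ht).add continuous_const) hpt
    _ = (∫ q in ball p (d / 2), energy β (trunc v (-1)) q)
          + volume.real (ball p (d / 2)) * (A + 1) := by
        rw [integral_add ((continuous_energy hβc ht).integrableOn_ball p _)
          (continuous_const.integrableOn_ball p _)]
        simp
    _ ≤ C * (d - d / 2)⁻¹ ^ 4 * V + (A + 1) * V := by
        have : 0 < d - d / 2 := by linarith
        refine add_le_add (hle.trans ?_) ?_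
        · gcongr
        · rw [mul_comm]
          gcongr

lemma exists_pos_le_mul_sq_le {K δ s : ℝ} (hK : 0 < K) (hδ : 0 < δ) (hs : 0 < s) :
    ∃ σ > (0 : ℝ), σ ≤ s ∧ K * σ ^ 2 ≤ δ := by
  refine ⟨min (min s 1) (δ / K), by positivity, (min_le_left _ _).trans (min_le_left _ _), ?_⟩
  set σ := min (min s 1) (δ / K) with hσ
  have h0 : 0 < σ := by positivity
  have h1 : σ ≤ 1 := (min_le_left _ _).trans (min_le_right _ _)
  have h2 : σ ≤ δ / K := min_le_right _ _
  rw [le_div_iff₀ hK] at h2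
  have : σ ^ 2 ≤ σ := by nlinarith
  nlinarith

lemma FiniteType.exists_modulus_x {β : Euc N → ℝ} {B : ℝ} (hβ : BoundedDrift β B)
    {W : Set (Euc N)} {Z : Finset (Euc N)} {ρ c : ℝ} {j : ℕ} (hF : FiniteType β W Z ρ c j)
    {A ε d : ℝ} (hA : 0 ≤ A) (hε : 0 < ε) (hd : 0 < d) (hd1 : d ≤ 1) :
    ∃ τ > (0 : ℝ), ∀ (v : ℝ × Euc N → ℝ) (p : ℝ × Euc N), UnitBounded β W A v (ball p d) →
      ∀ t, 0 ≤ t → t ≤ τ → |v (p + (t, 0)) - v p| ≤ ε := by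
  obtain ⟨δ, hδ, hsq⟩ := hF.exists_abs_le_of_setIntegral_sq_le hβ (A := 2 * A) (ε := ε)
    (d := d / 4) (by linarith) hε (by linarith) (by linarith)
  obtain ⟨E, hE, henergy⟩ := hβ.exists_setIntegral_energy_le W hA hd hd1
  obtain ⟨C, hC1, hshift⟩ := hF.exists_shift_bound hβ
  have hd4 : 0 < d / 2 - d / 4 := by linarith
  obtain ⟨σ, hσ, hσs, hσδ⟩ := exists_pos_le_mul_sq_le (K := C * (d / 2 - d / 4)⁻¹ ^ 4 * E)
    (δ := δ) (s := min ρ (d / 16)) (by positivity) hδ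
    (lt_min hF.rho_pos (by linarith))
  refine ⟨min (σ ^ (2 * j + 2)) (d / 4), by positivity, fun v p h t ht0 ht => ?_⟩
  have htd : t ≤ d / 4 := ht.trans (min_le_right _ _)
  have hadd : ∀ q ∈ ball p (d / 4), q + (t, 0) ∈ ball p d := fun q hq =>
    add_mem_ball_of_mem (by rw [norm_mk_zero, abs_of_nonneg ht0]; linarith) hq
  have hmem : ∀ q ∈ ball p (d / 4), q ∈ ball p d := fun q hq =>
    ball_subset_ball (by linarith) hq
  have hsh : ContDiff ℝ 2 fun q => v (q + (t, 0)) :=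
    h.contDiff.comp (contDiff_id.add contDiff_const)
  have hmem2 : ∀ q ∈ ball p (d / 2), q ∈ ball p d := fun q hq =>
    ball_subset_ball (by linarith) hq
  refine hsq (fun q => v (q + (t, 0)) - v q) (hsh.sub h.contDiff) p
    (fun q hq => h.abs_sub_le (hadd q hq) (hmem q hq)) (fun q hq => ?_)
    (fun q hq => h.snd_mem q (hmem q hq)) ?_
  · rw [opL_sub β hsh h.contDiff, opL_shift_x]
    refine (abs_sub _ _).trans ?_
    linarith [h.abs_opL_le _ (hadd q hq), h.abs_opL_le _ (hmem q hq)]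
  · refine (hshift v h.contDiff p (d / 4) (d / 2) σ t (by linarith) (by linarith) (by linarith)
      (fun q hq => (h.abs_le (hmem2 q hq)).trans (by norm_num))
      (fun q hq => h.snd_mem q (hmem2 q hq)) hσ (hσs.trans (min_le_left _ _))
      (hσs.trans ((min_le_right _ _).trans (by linarith))) ht0
      (ht.trans (min_le_left _ _))).trans (le_trans ?_ hσδ)
    rw [mul_right_comm]
    gcongr
    exact henergy v p h

lemma gradSq_segmentAverage_le {v : ℝ × Euc N → ℝ} (hv : ContDiff ℝ 1 v) (e p : ℝ × Euc N) :
    gradSq (segmentAverage e v) p ≤ ∫ θ in (0 : ℝ)..1, gradSq v (p + θ • e) := by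
  have hc : ∀ i, Continuous fun θ : ℝ => dir (eY i) v (p + θ • e) := fun i =>
    (hv.continuous_dir _).comp (by fun_prop)
  have hc2 : ∀ i, Continuous fun θ : ℝ => dir (eY i) v (p + θ • e) ^ 2 := fun i => (hc i).pow 2
  unfold gradSq
  rw [intervalIntegral.integral_finsetSum fun i _ => (hc2 i).intervalIntegrable _ _]
  refine Finset.sum_le_sum fun i _ => ?_
  rw [dir_segmentAverage hv]
  exact sq_intervalIntegral_le (hc i)

lemma UnitBounded.segmentAverage_mem {β : Euc N → ℝ} {W : Set (Euc N)} {A : ℝ}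
    {v : ℝ × Euc N → ℝ} (hβ : Continuous β)
    {p : ℝ × Euc N} {R R' h : ℝ} (hv : UnitBounded β W A v (ball p R')) (hh : 0 ≤ h)
    (hR : R + h ≤ R') : UnitBounded β W A (segmentAverage (h, 0) v) (ball p R) := by
  have hadd : ∀ q ∈ ball p R, ∀ θ ∈ Icc (0 : ℝ) 1, q + θ • ((h, 0) : ℝ × Euc N) ∈ ball p R' := by
    intro q hq θ hθ
    refine add_mem_ball_of_mem ?_ hq
    rw [norm_smul, norm_mk_zero, abs_of_nonneg hh, Real.norm_of_nonneg hθ.1]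
    nlinarith [hθ.2]
  have hcv : ∀ q, Continuous fun θ : ℝ => v (q + θ • ((h, 0) : ℝ × Euc N)) := fun q =>
    hv.contDiff.continuous.comp (by fun_prop)
  have hcL : ∀ q, Continuous fun θ : ℝ => opL β v (q + θ • ((h, 0) : ℝ × Euc N)) := fun q =>
    (continuous_opL hβ hv.contDiff).comp (by fun_prop)
  refine ⟨contDiff_segmentAverage hv.contDiff _, fun q hq => ?_, fun q hq => ?_, fun q hq => ?_,
    fun q hq => hv.snd_mem q (ball_subset_ball (by linarith) hq)⟩
  · exact intervalIntegral.integral_nonneg zero_le_one fun θ hθ => hv.nonneg _ (hadd q hq θ hθ)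
  · refine (intervalIntegral.integral_mono_on zero_le_one ((hcv q).intervalIntegrable 0 1)
      (intervalIntegrable_const (c := (1 : ℝ)))
      fun θ hθ => hv.le_one _ (hadd q hq θ hθ)).trans (by simp)
  · rw [opL_segmentAverage β hv.contDiff]
    have := intervalIntegral.norm_integral_le_of_norm_le_const (a := (0 : ℝ)) (b := 1) (C := A)
      (f := fun θ => opL β v (q + θ • ((h, 0) : ℝ × Euc N))) fun θ hθ => by
        rw [uIoc_of_le zero_le_one] at hθ
        exact hv.abs_opL_le _ (hadd q hq θ ⟨hθ.1.le, hθ.2⟩)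
    simpa using this

lemma opL_shift_y (β : Euc N → ℝ) (f : ℝ × Euc N → ℝ) (z : Euc N) (p : ℝ × Euc N) :
    opL β (fun q => f (q + (0, z))) p
      = opL β f (p + (0, z)) + (β p.2 - β (p.2 + z)) * dX f (p + (0, z)) := by
  unfold opL
  rw [lapY_shift, dX_eq, dX_eq, dir_shift]
  simp only [Prod.snd_add]
  ring

lemma BoundedDrift.abs_sub_le {β : Euc N → ℝ} {B : ℝ} (hβ : BoundedDrift β B) (y z : Euc N) :
    |β y - β z| ≤ B * ‖y - z‖ :=
  Convex.norm_image_sub_le_of_norm_fderiv_le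
    (fun x _ => (hβ.contDiff.differentiable one_ne_zero) x)
    (fun x _ => hβ.norm_fderiv_le x) convex_univ (mem_univ z) (mem_univ y)

set_option maxHeartbeats 1000000 in
lemma FiniteType.exists_modulus_y {β : Euc N → ℝ} {B : ℝ} (hβ : BoundedDrift β B)
    {W : Set (Euc N)} {Z : Finset (Euc N)} {ρ c : ℝ} {j : ℕ} (hF : FiniteType β W Z ρ c j)
    {A ε d : ℝ} (hA : 0 ≤ A) (hε : 0 < ε) (hd : 0 < d) (hd1 : d ≤ 1) :
    ∃ τ > (0 : ℝ), ∀ (v : ℝ × Euc N → ℝ) (p : ℝ × Euc N), UnitBounded β W A v (ball p d) →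
      ∀ z : Euc N, ‖z‖ ≤ τ → |v (p + (0, z)) - v p| ≤ 3 * ε := by
  have hB := hβ.one_le
  obtain ⟨δ, hδ, hsq⟩ := hF.exists_abs_le_of_setIntegral_sq_le hβ (A := 2 * A + B) (ε := ε)
    (d := d / 8) (by linarith) hε (by linarith) (by linarith)
  obtain ⟨E, hE, henergy⟩ := hβ.exists_setIntegral_energy_le W hA hd hd1
  obtain ⟨τ, hτ, hx⟩ := hF.exists_modulus_x hβ hA hε (half_pos hd) (by linarith)
  set h := min τ (d / 8) with hh
  have hh0 : 0 < h := lt_min hτ (by linarith)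
  have hhd : h ≤ d / 8 := min_le_right _ _
  obtain ⟨σ, hσ, hσs, hσδ⟩ := exists_pos_le_mul_sq_le (K := E) (δ := δ) (s := h) hE hδ hh0
  refine ⟨σ, hσ, fun v p hv z hz => ?_⟩
  have hβc := hβ.contDiff.continuous
  have hw : UnitBounded β W A (segmentAverage (h, 0) v) (ball p (d / 2)) :=
    hv.segmentAverage_mem hβc hh0.le (by linarith)
  set w := segmentAverage (h, 0) v with hwdef
  have hclose : ∀ q ∈ ball p (d / 2), |w q - v q| ≤ ε := by
    intro q hq
    have hcv : Continuous fun θ : ℝ => v (q + θ • ((h, 0) : ℝ × Euc N)) :=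
      hv.contDiff.continuous.comp (by fun_prop)
    have heq : w q - v q = ∫ θ in (0 : ℝ)..1, (v (q + θ • ((h, 0) : ℝ × Euc N)) - v q) := by
      rw [intervalIntegral.integral_sub (hcv.intervalIntegrable 0 1) intervalIntegrable_const]
      simp [hwdef, segmentAverage]
    rw [heq]
    have := intervalIntegral.norm_integral_le_of_norm_le_const (a := (0 : ℝ)) (b := 1) (C := ε)
      (f := fun θ => v (q + θ • ((h, 0) : ℝ × Euc N)) - v q) fun θ hθ => by
        rw [uIoc_of_le zero_le_one] at hθ
        have hs : θ • ((h, 0) : ℝ × Euc N) = (θ * h, 0) := by simp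
        rw [hs]
        refine hx v q (hv.mono (ball_subset_ball' ?_)) _ (mul_nonneg hθ.1.le hh0.le) ?_
        · linarith [mem_ball.1 hq]
        · exact (mul_le_of_le_one_left hh0.le hθ.2).trans (min_le_left _ _)
    simpa using this
  have hzd : ‖z‖ ≤ d / 8 := hz.trans (hσs.trans hhd)
  have hzh : ‖z‖ ≤ h := hz.trans hσs
  have hadd : ∀ q ∈ ball p (d / 8), q + (0, z) ∈ ball p (d / 4) := fun q hq =>
    add_mem_ball_of_mem (by rw [norm_zero_mk]; linarith) hq
  have h42 : ball p (d / 4) ⊆ ball p (d / 2) := ball_subset_ball (by linarith)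
  have h82 : ball p (d / 8) ⊆ ball p (d / 2) := ball_subset_ball (by linarith)
  have hsh : ContDiff ℝ 2 fun q => w (q + (0, z)) :=
    hw.contDiff.comp (contDiff_id.add contDiff_const)
  have hdX : ∀ q ∈ ball p (d / 4), |dX w q| * h ≤ 1 := by
    intro q hq
    have heq := mul_dX_segmentAverage hv.contDiff.one_of_two h q
    rw [← abs_of_pos hh0, ← abs_mul, mul_comm, heq]
    refine hv.abs_sub_le (add_mem_ball_of_mem (R := d / 4) ?_ hq)
      (ball_subset_ball (by linarith) hq)
    rw [norm_mk_zero, abs_of_pos hh0]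
    linarith
  have hmain : |w (p + (0, z)) - w p| ≤ ε := by
    refine hsq (fun q => w (q + (0, z)) - w q) (hsh.sub hw.contDiff) p
      (fun q hq => hw.abs_sub_le (h42 (hadd q hq)) (h82 hq)) (fun q hq => ?_)
      (fun q hq => hw.snd_mem q (h82 hq)) ?_
    · rw [opL_sub β hsh hw.contDiff, opL_shift_y]
      have h1 := hw.abs_opL_le _ (h42 (hadd q hq))
      have h2 := hw.abs_opL_le _ (h82 hq)
      have h3 : |(β q.2 - β (q.2 + z)) * dX w (q + (0, z))| ≤ B := by
        rw [abs_mul]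
        calc _ ≤ (B * ‖z‖) * |dX w (q + (0, z))| := by
              gcongr
              simpa using hβ.abs_sub_le q.2 (q.2 + z)
          _ ≤ (B * h) * |dX w (q + (0, z))| := by gcongr
          _ = B * (|dX w (q + (0, z))| * h) := by ring
          _ ≤ B * 1 := by gcongr; exact hdX _ (hadd q hq)
          _ = B := mul_one B
      refine (abs_sub _ _).trans ?_
      linarith [abs_add_le (opL β w (q + (0, z))) ((β q.2 - β (q.2 + z)) * dX w (q + (0, z)))]
    · have hgc := continuous_gradSq hv.contDiff.one_of_two
      refine (setIntegral_sq_shift_snd_sub_le hw.contDiff.one_of_two (R' := d / 4)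
        (by linarith)).trans (le_trans ?_ hσδ)
      have h1 : ∫ q in ball p (d / 4), gradSq w q
          ≤ ∫ q in ball p (d / 4), ∫ θ in (0 : ℝ)..1, gradSq v (q + θ • ((h, 0) : ℝ × Euc N)) := by
        refine setIntegral_ball_mono (continuous_gradSq hw.contDiff.one_of_two) ?_
          fun q _ => gradSq_segmentAverage_le hv.contDiff.one_of_two _ _
        refine intervalIntegral.continuous_parametric_intervalIntegral_of_continuous' ?_ 0 1
        simp only [Function.uncurry_def]
        exact hgc.comp (by fun_prop)
      have h2 := setIntegral_intervalIntegral_shift_le hgc (gradSq_nonneg v) (p := p)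
        (e := (h, 0)) (R := d / 4) (R' := d / 2)
        (by rw [norm_mk_zero, abs_of_pos hh0]; linarith)
      have h3 : ∫ q in ball p (d / 2), gradSq v q ≤ ∫ q in ball p (d / 2), energy β v q :=
        setIntegral_ball_mono hgc (continuous_energy hβc hv.contDiff) fun q _ => by
          linarith [sq_le_energy β v q, sq_nonneg (v q)]
      have h4 := henergy v p hv
      rw [mul_comm]
      have : ‖z‖ ^ 2 ≤ σ ^ 2 := by gcongr
      exact mul_le_mul (h1.trans (h2.trans (h3.trans h4))) this (sq_nonneg _) hE.le
  have hp1 := abs_le.1 (hclose p (mem_ball_self (half_pos hd)))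
  have hp2 := abs_le.1 (hclose (p + (0, z))
    (h42 (hadd p (mem_ball_self (by linarith)))))
  have hp3 := abs_le.1 hmain
  exact abs_le.2 ⟨by linarith [hp1.1, hp2.2, hp3.1], by linarith [hp1.2, hp2.1, hp3.2]⟩

/-- Equicontinuity of the class of bounded functions with bounded `Δ_y v + β v_x`. -/
lemma FiniteType.exists_modulus {β : Euc N → ℝ} {B : ℝ} (hβ : BoundedDrift β B)
    {W : Set (Euc N)} {Z : Finset (Euc N)} {ρ c : ℝ} {j : ℕ} (hF : FiniteType β W Z ρ c j)
    {A ε d : ℝ} (hA : 0 ≤ A) (hε : 0 < ε) (hd : 0 < d) (hd1 : d ≤ 1) :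
    ∃ r > (0 : ℝ), ∀ (v : ℝ × Euc N → ℝ) (p : ℝ × Euc N), UnitBounded β W A v (ball p d) →
      ∀ q ∈ ball p r, |v q - v p| ≤ ε := by
  obtain ⟨τ, hτ, hx⟩ := hF.exists_modulus_x hβ hA (ε := ε / 4) (by linarith) (half_pos hd)
    (by linarith)
  obtain ⟨τ', hτ', hy⟩ := hF.exists_modulus_y hβ hA (ε := ε / 4) (by linarith) hd hd1
  refine ⟨min (min τ τ') (d / 2), by positivity, fun v p hv q hq => ?_⟩
  obtain ⟨hq1, hq2⟩ := mem_ball_prod_iff.1 hq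
  simp only [lt_min_iff] at hq1 hq2
  have h1 := hy v p hv (q.2 - p.2) hq2.1.2.le
  have hp' : p + (0, q.2 - p.2) = (p.1, q.2) := by ext1 <;> simp
  rw [hp'] at h1
  have h2 : |v q - v (p.1, q.2)| ≤ ε / 4 := by
    rcases le_total p.1 q.1 with hle | hle
    · have := hx v (p.1, q.2) (hv.mono (ball_subset_ball' ?_)) (q.1 - p.1) (by linarith)
        ((le_abs_self _).trans hq1.1.1.le)
      · simpa using this
      · have : dist ((p.1, q.2) : ℝ × Euc N) p < d / 2 :=
          mem_ball.1 (mem_ball_prod_iff.2 ⟨by simpa using half_pos hd, hq2.2⟩)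
        linarith
    · have := hx v q (hv.mono (ball_subset_ball' ?_)) (p.1 - q.1) (by linarith)
        ((le_abs_self _).trans (by rw [abs_sub_comm]; exact hq1.1.1.le))
      · rw [abs_sub_comm]
        convert this using 4
        ext1 <;> simp
      · have : dist q p < d / 2 := mem_ball.1 (ball_subset_ball (min_le_right _ _) hq)
        linarith
  have := abs_add_le (v q - v (p.1, q.2)) (v (p.1, q.2) - v p)
  rw [sub_add_sub_cancel] at this
  linarith

end Modulus

section Barriers

variable {N : ℕ}

lemma deriv_deriv_nonneg_of_isLocalMin {f : ℝ → ℝ} {x : ℝ} (hc : ContinuousAt f x)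
    (h : IsLocalMin f x) : 0 ≤ deriv (deriv f) x := by
  by_contra! hneg
  have hmax := isLocalMax_of_deriv_deriv_neg hneg h.deriv_eq_zero hc
  have heq : f =ᶠ[nhds x] fun _ => f x := by
    filter_upwards [h, hmax] with y h1 h2
    exact le_antisymm h2 h1
  have := heq.deriv.deriv_eq
  simp at this
  linarith

lemma dir_dir_nonneg_of_isLocalMin {w : ℝ × Euc N → ℝ} (hw : ContDiff ℝ 2 w)
    {p : ℝ × Euc N} (h : IsLocalMin w p) (e : ℝ × Euc N) : 0 ≤ dir e (dir e w) p := by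
  have hline : ∀ t : ℝ, HasDerivAt (fun t : ℝ => p + t • e) e t := fun t => by
    simpa using ((hasDerivAt_id t).smul_const e).const_add p
  have hd : ∀ {f : ℝ × Euc N → ℝ}, ContDiff ℝ 1 f →
      deriv (fun t : ℝ => f (p + t • e)) = fun t => dir e f (p + t • e) := by
    intro f hf
    funext t
    exact ((hf.diffAt _).hasFDerivAt.comp_hasDerivAt t (hline t)).deriv
  have hc : Continuous fun t : ℝ => p + t • e := by fun_prop
  have hmin : IsLocalMin (fun t : ℝ => w (p + t • e)) 0 := by
    have := hc.tendsto 0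
    simp only [zero_smul, add_zero] at this
    have h2 := this.eventually h
    filter_upwards [h2] with t ht
    simpa using ht
  have := deriv_deriv_nonneg_of_isLocalMin (f := fun t : ℝ => w (p + t • e))
    (hw.continuous.comp hc).continuousAt hmin
  rw [hd hw.one_of_two, hd (hw.dir_one e)] at this
  simpa using this

lemma opL_nonneg_of_isLocalMin (β : Euc N → ℝ) {w : ℝ × Euc N → ℝ} (hw : ContDiff ℝ 2 w)
    {p : ℝ × Euc N} (h : IsLocalMin w p) : 0 ≤ opL β w p := by
  have hx : dX w p = 0 := by
    unfold dX
    rw [h.fderiv_eq_zero]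
    simp
  unfold opL
  rw [hx, mul_zero, add_zero, lapY_eq]
  exact Finset.sum_nonneg fun i _ => dir_dir_nonneg_of_isLocalMin hw h _

lemma isCompact_quad_nonneg {a B : ℝ} (ha : 0 < a) (hB : 0 < B) (p₀ : ℝ × Euc N) :
    IsCompact {p | 0 ≤ quad 1 a B p₀ p} := by
  refine (isCompact_closedBall p₀ (1 / a + 1 / B + 1)).of_isClosed_subset
    (isClosed_le continuous_const (contDiff_quad (n := 0) 1 a B p₀).continuous) fun p hp => ?_
  have hp' : 0 ≤ 1 - a * (p.1 - p₀.1) ^ 2 - B * ‖p.2 - p₀.2‖ ^ 2 := hp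
  have key : ∀ {k s : ℝ}, 0 < k → k * s ^ 2 ≤ 1 → |s| ≤ 1 / k + 1 := by
    intro k s hk hs
    have h1 : s ^ 2 ≤ 1 / k := by rwa [le_div_iff₀' hk]
    rw [← sq_abs] at h1
    nlinarith [sq_nonneg (|s| - 1), abs_nonneg s]
  have h1 := key ha (s := p.1 - p₀.1) (by nlinarith [mul_nonneg hB.le (sq_nonneg ‖p.2 - p₀.2‖)])
  have h2 := key hB (s := ‖p.2 - p₀.2‖) (by nlinarith [mul_nonneg ha.le (sq_nonneg (p.1 - p₀.1))])
  rw [abs_norm] at h2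
  have h3 : 0 < 1 / a := by positivity
  have h4 : 0 < 1 / B := by positivity
  exact mem_closedBall_prod_iff.2 ⟨by linarith, by linarith⟩

/-- The exponential barrier built on `q`. -/
def expBarrier (α : ℝ) (q : ℝ × Euc N → ℝ) (p : ℝ × Euc N) : ℝ := Real.exp (α * q p) - 1

lemma contDiff_expBarrier {q : ℝ × Euc N → ℝ} (hq : ContDiff ℝ 2 q) (α : ℝ) :
    ContDiff ℝ 2 (expBarrier α q) :=
  (Real.contDiff_exp.comp (contDiff_const.mul hq)).sub contDiff_const

lemma opL_expBarrier (b : Euc N → ℝ) {q : ℝ × Euc N → ℝ} (hq : ContDiff ℝ 2 q) (α : ℝ)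
    (p : ℝ × Euc N) : opL b (expBarrier α q) p
      = Real.exp (α * q p) * (α * (opL b q p + α * gradSq q p)) := by
  have hl : ∀ s : ℝ, HasDerivAt (fun s => α * s) α s := fun s => by
    simpa using (hasDerivAt_id s).const_mul α
  have h1 : ∀ s : ℝ, HasDerivAt (fun s => Real.exp (α * s) - 1) (Real.exp (α * s) * α) s :=
    fun s => (hl s).exp.sub_const 1
  have h2 : ∀ s : ℝ, HasDerivAt (fun s => Real.exp (α * s) * α) (Real.exp (α * s) * α * α) s :=
    fun s => (hl s).exp.mul_const α
  have := opL_comp b h1 h2 hq p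
  unfold expBarrier
  rw [this]
  ring

lemma exists_expBarrier {b : Euc N → ℝ} (hb : Continuous b) {M : ℝ} (hM : 0 ≤ M)
    {q : ℝ × Euc N → ℝ} (hq : ContDiff ℝ 2 q) {K : Set (ℝ × Euc N)} (hK : IsCompact K)
    (hT : ∀ p ∈ K, gradSq q p = 0 → 0 < opL b q p) :
    ∃ α > (0 : ℝ), ∀ p ∈ K, M * Real.exp (α * q p) ≤ opL b (expBarrier α q) p := by
  have hg := continuous_gradSq hq.one_of_two
  have hL := continuous_opL hb hq
  obtain ⟨δ, hδ, hδK⟩ := hK.exists_forall_le' (f := fun p => max (gradSq q p) (opL b q p))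
    (hg.max hL).continuousOn (a := 0) fun p hp => by
      rcases (gradSq_nonneg q p).eq_or_lt with h | h
      · exact lt_max_of_lt_right (hT p hp h.symm)
      · exact lt_max_of_lt_left h
  obtain ⟨Λ, hΛ⟩ := hK.exists_bound_of_continuousOn hL.continuousOn
  set α := (M + 1 + |Λ|) / δ + 1 with hα
  have hα1 : 1 ≤ α := by
    have : 0 ≤ (M + 1 + |Λ|) / δ := by positivity
    linarith
  have hαδ : M + |Λ| ≤ α * δ := by
    rw [hα, add_mul, div_mul_cancel₀ _ hδ.ne']
    linarith
  refine ⟨α, by linarith, fun p hp => ?_⟩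
  rw [opL_expBarrier b hq, mul_comm M]
  refine mul_le_mul_of_nonneg_left ?_ (Real.exp_pos _).le
  have hsum : M ≤ α * (opL b q p + α * gradSq q p) := by
    rcases le_max_iff.1 (hδK p hp) with h | h
    · have h1 : -|Λ| ≤ opL b q p := by
        have := abs_le.1 (hΛ p hp)
        linarith [this.1, le_abs_self Λ]
      have h2 : α * δ ≤ α * gradSq q p := by gcongr
      have h3 : M ≤ opL b q p + α * gradSq q p := by linarith
      nlinarith
    · have h2 : α * δ ≤ α * (opL b q p + α * gradSq q p) := by
        gcongr
        have := mul_nonneg (by linarith : 0 ≤ α) (gradSq_nonneg q p)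
        linarith
      linarith [abs_nonneg Λ]
  exact hsum

/-- Nonnegative functions satisfying `|Δ_y v + β v_x| ≤ M v` on `S`. -/
structure Admissible (β : Euc N → ℝ) (M : ℝ) (S : Set (ℝ × Euc N)) (v : ℝ × Euc N → ℝ) :
    Prop where
  contDiff : ContDiff ℝ 2 v
  nonneg : ∀ p ∈ S, 0 ≤ v p
  abs_opL_le : ∀ p ∈ S, |opL β v p| ≤ M * v p

/-- Abstract propagation relations: refining, transitive, additive in the target, and containing
the relations produced by ellipsoidal barriers for the drift `b`. -/
structure Propagates (b : Euc N → ℝ) (S : Set (ℝ × Euc N))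
    (Rel : Set (ℝ × Euc N) → Set (ℝ × Euc N) → Prop) : Prop where
  refl : ∀ A, Rel A A
  mono : ∀ {A A' B B'}, Rel A B → A ⊆ A' → B' ⊆ B → Rel A' B'
  union : ∀ {A B B'}, Rel A B → Rel A B' → Rel A (B ∪ B')
  trans : ∀ {A B C}, Rel A B → Rel B C → Rel A C
  barrier : ∀ {p₀ : ℝ × Euc N} {a k θ : ℝ} {O : Set (ℝ × Euc N)}, 0 < a → 0 < k → 0 < θ →
    IsOpen O → {p | 0 ≤ quad 1 a k p₀ p} ⊆ S →
    (∀ p, 0 ≤ quad 1 a k p₀ p → gradSq (quad 1 a k p₀) p = 0 →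
      opL b (quad 1 a k p₀) p ≤ 0 → p ∈ O) →
    Rel O {p | θ ≤ quad 1 a k p₀ p}

/-- A lower bound on `A` propagates to `B`. -/
def PointwiseRel (β : Euc N → ℝ) (M : ℝ) (S A B : Set (ℝ × Euc N)) : Prop :=
  ∃ c > (0 : ℝ), ∀ v, Admissible β M S v → ∀ l ≥ (0 : ℝ), (∀ p ∈ A, l ≤ v p) →
    ∀ p ∈ B, c * l ≤ v p

lemma quad_le_one {a k : ℝ} (ha : 0 < a) (hk : 0 < k) (p₀ p : ℝ × Euc N) :
    quad 1 a k p₀ p ≤ 1 := by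
  have h1 := mul_nonneg ha.le (sq_nonneg (p.1 - p₀.1))
  have h2 := mul_nonneg hk.le (sq_nonneg ‖p.2 - p₀.2‖)
  unfold quad
  linarith

lemma isCompact_quad_nonneg_diff {a k : ℝ} (ha : 0 < a) (hk : 0 < k) (p₀ : ℝ × Euc N)
    {O : Set (ℝ × Euc N)} (hO : IsOpen O) : IsCompact ({p | 0 ≤ quad 1 a k p₀ p} \ O) :=
  (isCompact_quad_nonneg ha hk p₀).diff hO

lemma pointwiseRel_barrier {β : Euc N → ℝ} (hβ : Continuous β) {M : ℝ} (hM : 0 < M)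
    {S : Set (ℝ × Euc N)} {p₀ : ℝ × Euc N} {a k θ : ℝ} {O : Set (ℝ × Euc N)} (ha : 0 < a)
    (hk : 0 < k) (hθ : 0 < θ) (hO : IsOpen O) (hS : {p | 0 ≤ quad 1 a k p₀ p} ⊆ S)
    (hT : ∀ p, 0 ≤ quad 1 a k p₀ p → gradSq (quad 1 a k p₀) p = 0 →
      opL β (quad 1 a k p₀) p ≤ 0 → p ∈ O) :
    PointwiseRel β M S O {p | θ ≤ quad 1 a k p₀ p} := by
  set q := quad 1 a k p₀ with hqdef
  have hq : ContDiff ℝ 2 q := contDiff_quad 1 a k p₀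
  obtain ⟨α, hα, hbar⟩ := exists_expBarrier hβ hM.le hq
    (isCompact_quad_nonneg_diff ha hk p₀ hO) fun p hp h0 => by
      by_contra! h
      exact hp.2 (hT p hp.1 h0 h)
  have hα1 : 0 < Real.exp (α * θ) - 1 := by
    have := Real.one_lt_exp_iff.2 (mul_pos hα hθ)
    linarith
  refine ⟨Real.exp (-α) * (Real.exp (α * θ) - 1), mul_pos (Real.exp_pos _) hα1,
    fun v hv l hl hvO => ?_⟩
  set κ := Real.exp (-α) * l with hκ
  have hκ0 : 0 ≤ κ := mul_nonneg (Real.exp_pos _).le hl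
  have hψ := contDiff_expBarrier hq α
  have hw : ContDiff ℝ 2 fun p => v p - κ * expBarrier α q p :=
    hv.contDiff.sub (contDiff_const.mul hψ)
  have hpos : ∀ p, 0 ≤ q p → 0 ≤ v p - κ * expBarrier α q p := by
    by_contra! hcon
    obtain ⟨p₁, hp₁, hneg⟩ := hcon
    obtain ⟨p, hp, hmin⟩ := (isCompact_quad_nonneg ha hk p₀).exists_isMinOn ⟨p₁, hp₁⟩
      hw.continuous.continuousOn
    have hpq : 0 ≤ q p := hp
    have hpneg : v p - κ * expBarrier α q p < 0 := lt_of_le_of_lt (hmin hp₁) hneg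
    have hv0 := hv.nonneg p (hS hp)
    have hq0 : 0 < q p := by
      rcases hpq.eq_or_lt with h | h
      · exfalso
        rw [expBarrier, ← h] at hpneg
        simp at hpneg
        linarith
      · exact h
    have hpO : p ∉ O := by
      intro hpO
      have h1 := hvO p hpO
      have h2 : κ * expBarrier α q p ≤ l := by
        have h3 : expBarrier α q p ≤ Real.exp α := by
          have : Real.exp (α * q p) ≤ Real.exp α :=
            Real.exp_le_exp.2 (mul_le_of_le_one_right hα.le (quad_le_one ha hk p₀ p))
          unfold expBarrier
          linarith
        calc κ * expBarrier α q p ≤ κ * Real.exp α := by gcongr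
          _ = l := by rw [hκ, mul_right_comm, ← Real.exp_add]; simp
      linarith
    have hloc : IsLocalMin (fun p => v p - κ * expBarrier α q p) p :=
      hmin.isLocalMin (Filter.mem_of_superset ((isOpen_lt continuous_const hq.continuous).mem_nhds
        hq0) fun z (hz : 0 < q z) => mem_ofPred.2 hz.le)
    have h1 := opL_nonneg_of_isLocalMin β hw hloc
    rw [opL_sub β hv.contDiff (contDiff_const.mul hψ), opL_const_mul β hψ] at h1
    have h2 := (abs_le.1 (hv.abs_opL_le p (hS hp))).2
    have h3 := hbar p ⟨hp, hpO⟩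
    have h4 : M * expBarrier α q p ≤ M * Real.exp (α * q p) := by
      unfold expBarrier
      gcongr
      linarith
    have h5 := mul_le_mul_of_nonneg_left (h4.trans h3) hκ0
    nlinarith
  intro p hp
  have hp' : θ ≤ q p := hp
  have h1 := hpos p (hθ.le.trans hp')
  have h2 : κ * (Real.exp (α * θ) - 1) ≤ κ * expBarrier α q p := by
    unfold expBarrier
    gcongr
  calc _ = κ * (Real.exp (α * θ) - 1) := by rw [hκ]; ring
    _ ≤ _ := by linarith

lemma propagates_pointwiseRel {β : Euc N → ℝ} (hβ : Continuous β) {M : ℝ} (hM : 0 < M)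
    (S : Set (ℝ × Euc N)) : Propagates β S (PointwiseRel β M S) where
  refl A := ⟨1, one_pos, fun v _ l _ h p hp => by simpa using h p hp⟩
  mono := by
    rintro A A' B B' ⟨c, hc, h⟩ hA hB
    exact ⟨c, hc, fun v hv l hl hA' p hp => h v hv l hl (fun p hp => hA' p (hA hp)) p (hB hp)⟩
  union := by
    rintro A B B' ⟨c, hc, h⟩ ⟨c', hc', h'⟩
    refine ⟨min c c', lt_min hc hc', fun v hv l hl hA p hp => ?_⟩
    rcases hp with hp | hp
    · exact (mul_le_mul_of_nonneg_right (min_le_left _ _) hl).trans (h v hv l hl hA p hp)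
    · exact (mul_le_mul_of_nonneg_right (min_le_right _ _) hl).trans (h' v hv l hl hA p hp)
  trans := by
    rintro A B C ⟨c, hc, h⟩ ⟨c', hc', h'⟩
    refine ⟨c' * c, mul_pos hc' hc, fun v hv l hl hA p hp => ?_⟩
    rw [mul_assoc]
    exact h' v hv (c * l) (mul_nonneg hc.le hl) (h v hv l hl hA) p hp
  barrier ha hk hθ hO hS hT := pointwiseRel_barrier hβ hM ha hk hθ hO hS hT

/-- The mass on `A` controls the mass on `B`. -/
def IntegralRel (β : Euc N → ℝ) (M : ℝ) (S A B : Set (ℝ × Euc N)) : Prop :=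
  ∃ C : NNReal, ∀ v, Admissible β M S v →
    ∫⁻ p in B, ENNReal.ofReal (v p) ≤ C * ∫⁻ p in A, ENNReal.ofReal (v p)

lemma opL_cube_comp (b : Euc N → ℝ) {f : ℝ × Euc N → ℝ} (hf : ContDiff ℝ 2 f) (p : ℝ × Euc N) :
    opL b (fun p => cube (f p)) p
      = 3 * max (f p) 0 ^ 2 * opL b f p + 6 * max (f p) 0 * gradSq f p :=
  opL_comp b hasDerivAt_cube hasDerivAt_cube_deriv hf p

set_option maxHeartbeats 1000000 in
lemma integralRel_barrier {β : Euc N → ℝ} (hβ : ContDiff ℝ 1 β) {M : ℝ} (hM : 0 < M)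
    {S : Set (ℝ × Euc N)} {p₀ : ℝ × Euc N} {a k θ : ℝ} {O : Set (ℝ × Euc N)} (ha : 0 < a)
    (hk : 0 < k) (hθ : 0 < θ) (hO : IsOpen O) (hS : {p | 0 ≤ quad 1 a k p₀ p} ⊆ S)
    (hT : ∀ p, 0 ≤ quad 1 a k p₀ p → gradSq (quad 1 a k p₀) p = 0 →
      opL (fun y => -β y) (quad 1 a k p₀) p ≤ 0 → p ∈ O) :
    IntegralRel β M S O {p | θ ≤ quad 1 a k p₀ p} := by
  set q := quad 1 a k p₀ with hqdef
  set b : Euc N → ℝ := fun y => -β y with hb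
  have hbc : Continuous b := hβ.continuous.neg
  have hq : ContDiff ℝ 2 q := contDiff_quad 1 a k p₀
  have hcomp : IsCompact {p | 0 ≤ q p} := isCompact_quad_nonneg ha hk p₀
  obtain ⟨α, hα, hbar⟩ := exists_expBarrier hbc (by linarith : 0 ≤ M + 1) hq
    (isCompact_quad_nonneg_diff ha hk p₀ hO) fun p hp h0 => by
      by_contra! h
      exact hp.2 (hT p hp.1 h0 h)
  set ψ := expBarrier α q with hψdef
  have hψ : ContDiff ℝ 2 ψ := contDiff_expBarrier hq α
  set φ : ℝ × Euc N → ℝ := fun p => cube (ψ p) with hφdef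
  have hφ : ContDiff ℝ 2 φ := contDiff_cube.comp hψ
  have hψneg : ∀ p, q p ≤ 0 → ψ p ≤ 0 := fun p hp => by
    have : Real.exp (α * q p) ≤ 1 :=
      Real.exp_le_one_iff.2 (mul_nonpos_of_nonneg_of_nonpos hα.le hp)
    simp only [hψdef, expBarrier]
    linarith
  have hψpos : ∀ p, 0 ≤ q p → 0 ≤ ψ p := fun p hp => by
    have : 1 ≤ Real.exp (α * q p) := Real.one_le_exp_iff.2 (mul_nonneg hα.le hp)
    simp only [hψdef, expBarrier]
    linarith
  have hoff : ∀ p, q p ≤ 0 → φ p = 0 ∧ opL b φ p = 0 := fun p hp => by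
    refine ⟨cube_of_nonpos (hψneg p hp), ?_⟩
    rw [hφdef, opL_cube_comp b hψ, max_eq_right (hψneg p hp)]
    simp
  have hφ0 : ∀ p, 0 ≤ φ p := fun p => cube_nonneg _
  have hφc : HasCompactSupport φ := HasCompactSupport.intro hcomp fun p hp =>
    (hoff p (le_of_lt (not_le.1 hp))).1
  set g : ℝ × Euc N → ℝ := fun p => opL b φ p - M * φ p with hgdef
  have hLc : Continuous (opL b φ) := continuous_opL hbc hφ
  have hgc : Continuous g := hLc.sub (continuous_const.mul hφ.continuous)
  have hgoff : ∀ p, q p ≤ 0 → g p = 0 := fun p hp => by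
    simp [hgdef, (hoff p hp).1, (hoff p hp).2]
  have hgO : ∀ p, 0 ≤ q p → p ∉ O → φ p ≤ g p := by
    intro p hp hpO
    have h1 := hbar p ⟨hp, hpO⟩
    have h0 := hψpos p hp
    have h2 : (M + 1) * ψ p ≤ opL b ψ p := by
      refine le_trans ?_ h1
      simp only [hψdef, expBarrier]
      gcongr
      linarith
    have h3 : opL b φ p = 3 * ψ p ^ 2 * opL b ψ p + 6 * ψ p * gradSq ψ p := by
      rw [hφdef, opL_cube_comp b hψ, max_eq_left h0]
    have h4 : φ p = ψ p ^ 3 := cube_of_nonneg h0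
    have h5 : 0 ≤ ψ p * gradSq ψ p := mul_nonneg h0 (gradSq_nonneg _ _)
    have h6 : ψ p ^ 2 * ((M + 1) * ψ p) ≤ ψ p ^ 2 * opL b ψ p :=
      mul_le_mul_of_nonneg_left h2 (sq_nonneg _)
    have h7 : 0 ≤ ψ p ^ 3 := pow_nonneg h0 3
    have h8 : 0 ≤ M * ψ p ^ 3 := mul_nonneg hM.le h7
    simp only [hgdef]
    rw [h3, h4]
    nlinarith
  obtain ⟨Γ, hΓ⟩ := hcomp.exists_bound_of_continuousOn hgc.continuousOn
  set κ := cube (Real.exp (α * θ) - 1) with hκ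
  have hexp : 0 < Real.exp (α * θ) - 1 := by
    have := Real.one_lt_exp_iff.2 (mul_pos hα hθ)
    linarith
  have hκ0 : 0 < κ := by
    rw [hκ, cube_of_nonneg hexp.le]
    positivity
  have hφκ : ∀ p, θ ≤ q p → κ ≤ φ p := fun p hp => by
    refine cube_mono ?_
    simp only [hψdef, expBarrier]
    gcongr
  set E : Set (ℝ × Euc N) := {p | θ ≤ q p} \ O with hE
  have hEm : MeasurableSet E :=
    (isClosed_le continuous_const hq.continuous).measurableSet.diff hO.measurableSet
  set F : Set (ℝ × Euc N) := {p | 0 ≤ q p} ∩ O with hF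
  have hFm : MeasurableSet F := hcomp.measurableSet.inter hO.measurableSet
  have hEsub : E ⊆ {p | 0 ≤ q p} := fun p hp => hθ.le.trans hp.1
  refine ⟨Real.toNNReal (|Γ| / κ) + 1, fun v hv => ?_⟩
  have hvc := hv.contDiff.continuous
  have hvS : IntegrableOn v {p | 0 ≤ q p} := hvc.continuousOn.integrableOn_compact hcomp
  have hvE : IntegrableOn v E := hvS.mono_set hEsub
  have hvF : IntegrableOn v F := hvS.mono_set inter_subset_left
  have hgcs : HasCompactSupport g := HasCompactSupport.intro hcomp fun p hp =>
    hgoff p (le_of_lt (not_le.1 hp))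
  have hvg : Integrable fun p => v p * g p :=
    (hvc.mul hgc).integrable_of_hasCompactSupport hgcs.mul_left
  have hneg : ∫ p, v p * g p ≤ 0 := by
    have hLv := continuous_opL hβ.continuous hv.contDiff
    have i1 : Integrable fun p => v p * opL b φ p :=
      (hvc.mul hLc).integrable_of_hasCompactSupport
        (HasCompactSupport.mul_left (HasCompactSupport.intro hcomp fun p hp =>
          (hoff p (le_of_lt (not_le.1 hp))).2))
    have i2 : Integrable fun p => M * (φ p * v p) :=
      ((hφ.continuous.mul hvc).integrable_of_hasCompactSupport hφc.mul_right).const_mul M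
    have i3 : Integrable fun p => φ p * opL β v p :=
      (hφ.continuous.mul hLv).integrable_of_hasCompactSupport hφc.mul_right
    have heq : ∫ p, v p * g p = ∫ p, (φ p * opL β v p - M * (φ p * v p)) := by
      rw [integral_sub i3 i2, integral_mul_opL hβ hφ hv.contDiff hφc, ← integral_sub i1 i2]
      refine integral_congr_ae (Filter.Eventually.of_forall fun p => ?_)
      simp only [hgdef]
      ring
    rw [heq]
    refine integral_nonpos fun p => ?_
    simp only [Pi.zero_apply]
    rcases le_total (q p) 0 with h | h
    · rw [(hoff p h).1]
      simp
    · have h2 := (abs_le.1 (hv.abs_opL_le p (hS h))).2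
      have := mul_le_mul_of_nonneg_left h2 (hφ0 p)
      linarith
  have hpt : ∀ p, E.indicator (fun p => κ * v p) p
      ≤ v p * g p + F.indicator (fun p => |Γ| * v p) p := by
    intro p
    by_cases hp : 0 ≤ q p
    · have hv0 := hv.nonneg p (hS hp)
      by_cases hpO : p ∈ O
      · have hpF : p ∈ F := ⟨hp, hpO⟩
        rw [indicator_of_notMem (fun h : p ∈ E => h.2 hpO), indicator_of_mem hpF]
        have h1 : -|Γ| ≤ g p := by
          have := abs_le.1 (hΓ p hp)
          linarith [this.1, le_abs_self Γ]
        nlinarith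
      · rw [indicator_of_notMem (fun h : p ∈ F => hpO h.2), add_zero]
        have h1 := mul_le_mul_of_nonneg_left (hgO p hp hpO) hv0
        have h2 : E.indicator (fun p => κ * v p) p ≤ v p * φ p := by
          by_cases hpE : p ∈ E
          · rw [indicator_of_mem hpE, mul_comm]
            exact mul_le_mul_of_nonneg_left (hφκ p hpE.1) hv0
          · rw [indicator_of_notMem hpE]
            exact mul_nonneg hv0 (hφ0 p)
        linarith
    · rw [indicator_of_notMem (fun h : p ∈ E => hp (hEsub h)),
        indicator_of_notMem (fun h : p ∈ F => hp h.1), hgoff p (le_of_lt (not_le.1 hp))]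
      simp
  have hreal : κ * ∫ p in E, v p ≤ |Γ| * ∫ p in F, v p := by
    have iE : Integrable (E.indicator fun p => κ * v p) :=
      (integrable_indicator_iff hEm).2 (hvE.const_mul κ)
    have iF : Integrable (F.indicator fun p => |Γ| * v p) :=
      (integrable_indicator_iff hFm).2 (hvF.const_mul |Γ|)
    have := integral_mono iE (hvg.add iF) hpt
    simp only [Pi.add_apply] at this
    rw [integral_add hvg iF, integral_indicator hEm, integral_indicator hFm, integral_const_mul,
      integral_const_mul] at this
    linarith
  have hlE : ∫⁻ p in E, ENNReal.ofReal (v p) = ENNReal.ofReal (∫ p in E, v p) :=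
    (ofReal_integral_eq_lintegral_ofReal hvE ((ae_restrict_iff' hEm).2
      (Filter.Eventually.of_forall fun p hp => hv.nonneg p (hS (hEsub hp))))).symm
  have hlF : ∫⁻ p in F, ENNReal.ofReal (v p) = ENNReal.ofReal (∫ p in F, v p) :=
    (ofReal_integral_eq_lintegral_ofReal hvF ((ae_restrict_iff' hFm).2
      (Filter.Eventually.of_forall fun p hp => hv.nonneg p (hS hp.1)))).symm
  have hE2 : ∫⁻ p in E, ENNReal.ofReal (v p)
      ≤ Real.toNNReal (|Γ| / κ) * ∫⁻ p in O, ENNReal.ofReal (v p) := by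
    calc _ ≤ ENNReal.ofReal (|Γ| / κ * ∫ p in F, v p) := by
          rw [hlE]
          refine ENNReal.ofReal_le_ofReal ?_
          rw [div_mul_eq_mul_div, le_div_iff₀ hκ0, mul_comm]
          exact hreal
      _ = Real.toNNReal (|Γ| / κ) * ∫⁻ p in F, ENNReal.ofReal (v p) := by
          rw [ENNReal.ofReal_mul (by positivity), hlF]
          rfl
      _ ≤ _ := by
          gcongr
          exact inter_subset_right
  calc ∫⁻ p in {p | θ ≤ q p}, ENNReal.ofReal (v p)
      ≤ ∫⁻ p in E ∪ O, ENNReal.ofReal (v p) := by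
        refine lintegral_mono_set fun p hp => ?_
        by_cases hpO : p ∈ O
        · exact Or.inr hpO
        · exact Or.inl ⟨hp, hpO⟩
    _ ≤ _ := lintegral_union_le _ _ _
    _ ≤ Real.toNNReal (|Γ| / κ) * (∫⁻ p in O, ENNReal.ofReal (v p))
          + 1 * ∫⁻ p in O, ENNReal.ofReal (v p) := by
        rw [one_mul]
        gcongr
    _ = _ := by rw [← add_mul]; simp

lemma propagates_integralRel {β : Euc N → ℝ} (hβ : ContDiff ℝ 1 β) {M : ℝ} (hM : 0 < M)
    (S : Set (ℝ × Euc N)) : Propagates (fun y => -β y) S (IntegralRel β M S) where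
  refl A := ⟨1, fun v _ => by simp⟩
  mono := by
    rintro A A' B B' ⟨C, h⟩ hA hB
    refine ⟨C, fun v hv => (lintegral_mono_set hB).trans ((h v hv).trans ?_)⟩
    gcongr
  union := by
    rintro A B B' ⟨C, h⟩ ⟨C', h'⟩
    refine ⟨C + C', fun v hv => (lintegral_union_le _ _ _).trans ?_⟩
    rw [ENNReal.coe_add, add_mul]
    exact add_le_add (h v hv) (h' v hv)
  trans := by
    rintro A B D ⟨C, h⟩ ⟨C', h'⟩
    refine ⟨C' * C, fun v hv => (h' v hv).trans ?_⟩
    rw [ENNReal.coe_mul, mul_assoc]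
    gcongr
    exact h v hv
  barrier ha hk hθ hO hS hT := integralRel_barrier hβ hM ha hk hθ hO hS hT

end Barriers

section Chain

variable {N : ℕ}

/-- The points having a neighbourhood controlled by `A`. -/
def reach (Rel : Set (ℝ × Euc N) → Set (ℝ × Euc N) → Prop) (A : Set (ℝ × Euc N)) :
    Set (ℝ × Euc N) :=
  {p | ∃ V ∈ nhds p, Rel A V}

lemma isOpen_reach (Rel : Set (ℝ × Euc N) → Set (ℝ × Euc N) → Prop) (A : Set (ℝ × Euc N)) :
    IsOpen (reach Rel A) := by
  rw [isOpen_iff_mem_nhds]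
  rintro p ⟨V, hV, h⟩
  filter_upwards [eventually_mem_nhds_iff.2 hV] with q hq
  exact ⟨V, hq, h⟩

variable {b : Euc N → ℝ} {S : Set (ℝ × Euc N)}
  {Rel : Set (ℝ × Euc N) → Set (ℝ × Euc N) → Prop}

lemma Propagates.exists_isOpen_of_isCompact (h : Propagates b S Rel) {A K : Set (ℝ × Euc N)}
    (hK : IsCompact K) (hKA : K ⊆ reach Rel A) : ∃ O, IsOpen O ∧ K ⊆ O ∧ Rel A O := by
  refine hK.induction_on (p := fun K => ∃ O, IsOpen O ∧ K ⊆ O ∧ Rel A O)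
    ⟨∅, isOpen_empty, subset_rfl, h.mono (h.refl A) subset_rfl (empty_subset _)⟩ ?_ ?_ ?_
  · rintro s t hst ⟨O, hO, hs, hr⟩
    exact ⟨O, hO, hst.trans hs, hr⟩
  · rintro s t ⟨O, hO, hs, hr⟩ ⟨O', hO', hs', hr'⟩
    exact ⟨O ∪ O', hO.union hO', union_subset_union hs hs', h.union hr hr'⟩
  · intro p hp
    obtain ⟨V, hV, hr⟩ := hKA hp
    exact ⟨interior V, mem_nhdsWithin_of_mem_nhds (interior_mem_nhds.2 hV), interior V,
      isOpen_interior, subset_rfl, h.mono hr subset_rfl interior_subset⟩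

lemma Propagates.mem_reach_of_ellipsoid {l u : ℝ} {Ω : Set (Euc N)}
    (h : Propagates b (Ioo l u ×ˢ Ω) Rel) {A : Set (ℝ × Euc N)} {x₀ w R : ℝ} {y₀ : Euc N}
    (hw : 0 < w) (hR : 0 < R) (hI : Icc (x₀ - w) (x₀ + w) ⊆ Ioo l u)
    (hΩ : closedBall y₀ R ⊆ Ω)
    (hT : ∀ x ∈ Icc (x₀ - w) (x₀ + w),
      -((N - 1 : ℕ) * w ^ 2 / R ^ 2) ≤ b y₀ * (x - x₀) → (x, y₀) ∈ reach Rel A)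
    {p : ℝ × Euc N} (hp : 0 < quad 1 (w ^ 2)⁻¹ (R ^ 2)⁻¹ (x₀, y₀) p) : p ∈ reach Rel A := by
  have ha : 0 < (w ^ 2)⁻¹ := by positivity
  have hk : 0 < (R ^ 2)⁻¹ := by positivity
  have hqc : Continuous (quad 1 (w ^ 2)⁻¹ (R ^ 2)⁻¹ (x₀, y₀)) :=
    (contDiff_quad (n := 0) _ _ _ _).continuous
  have hbd : ∀ p : ℝ × Euc N, 0 ≤ quad 1 (w ^ 2)⁻¹ (R ^ 2)⁻¹ (x₀, y₀) p →
      p.1 ∈ Icc (x₀ - w) (x₀ + w) ∧ p.2 ∈ closedBall y₀ R := by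
    intro p hp
    simp only [quad] at hp
    have h1 : 0 ≤ (w ^ 2)⁻¹ * (p.1 - x₀) ^ 2 := by positivity
    have h2 : 0 ≤ (R ^ 2)⁻¹ * ‖p.2 - y₀‖ ^ 2 := by positivity
    have h3 : (p.1 - x₀) ^ 2 ≤ w ^ 2 := by
      have : (w ^ 2)⁻¹ * (p.1 - x₀) ^ 2 ≤ 1 := by linarith
      rwa [inv_mul_le_iff₀ (by positivity), mul_one] at this
    have h4 : ‖p.2 - y₀‖ ^ 2 ≤ R ^ 2 := by
      have : (R ^ 2)⁻¹ * ‖p.2 - y₀‖ ^ 2 ≤ 1 := by linarith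
      rwa [inv_mul_le_iff₀ (by positivity), mul_one] at this
    have h5 := abs_le_of_sq_le_sq' h3 hw.le
    refine ⟨⟨by linarith [h5.1], by linarith [h5.2]⟩, ?_⟩
    rw [mem_closedBall, dist_eq_norm]
    exact abs_le_of_sq_le_sq h4 hR.le |>.trans' (le_abs_self _)
  set T : Set ℝ := {x | x ∈ Icc (x₀ - w) (x₀ + w) ∧
    -((N - 1 : ℕ) * w ^ 2 / R ^ 2) ≤ b y₀ * (x - x₀)} with hTdef
  have hTc : IsCompact T := isCompact_Icc.inter_right
    (isClosed_le continuous_const (by fun_prop) :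
      IsClosed {x : ℝ | -((N - 1 : ℕ) * w ^ 2 / R ^ 2) ≤ b y₀ * (x - x₀)})
  obtain ⟨O, hO, hTO, hr⟩ := h.exists_isOpen_of_isCompact
    (hTc.image (f := fun x => (x, y₀)) (by fun_prop)) (A := A) (by
      rintro _ ⟨x, hx, rfl⟩
      exact hT x hx.1 hx.2)
  have hbar := h.barrier (O := O) (p₀ := (x₀, y₀)) ha hk (half_pos hp) hO
    (fun p hp => ⟨hI (hbd p hp).1, hΩ (hbd p hp).2⟩) (by
      intro q hq hg hL
      rw [gradSq_quad] at hg
      have hy : q.2 = y₀ := by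
        have : ‖q.2 - y₀‖ ^ 2 = 0 := by
          rcases mul_eq_zero.1 hg with h | h
          · exact absurd h (by positivity)
          · exact h
        rw [sq_eq_zero_iff, norm_eq_zero, sub_eq_zero] at this
        exact this
      refine hTO ⟨q.1, ⟨(hbd q hq).1, ?_⟩, by rw [← hy]⟩
      rw [opL, lapY_quad, dX_eq, dir_eX_quad, hy] at hL
      simp only at hL
      have h1 : 0 ≤ w ^ 2 * (2 * (R ^ 2)⁻¹ * (N - 1 : ℕ) + b y₀ * (2 * (w ^ 2)⁻¹ * (q.1 - x₀))) :=
        mul_nonneg (by positivity) (by linarith)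
      have h2 : w ^ 2 * (2 * (R ^ 2)⁻¹ * (N - 1 : ℕ) + b y₀ * (2 * (w ^ 2)⁻¹ * (q.1 - x₀)))
          = 2 * ((N - 1 : ℕ) * w ^ 2 / R ^ 2) + 2 * (b y₀ * (q.1 - x₀)) := by
        field_simp
      linarith)
  refine ⟨_, ?_, h.trans hr hbar⟩
  exact Filter.mem_of_superset ((isOpen_lt continuous_const hqc).mem_nhds
    (half_lt_self hp : _ < quad 1 (w ^ 2)⁻¹ (R ^ 2)⁻¹ (x₀, y₀) p))
    fun z (hz : _ < quad 1 (w ^ 2)⁻¹ (R ^ 2)⁻¹ (x₀, y₀) z) => mem_ofPred.2 hz.le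

lemma exists_Icc_subset_of_mem_nhds {s : Set ℝ} {x : ℝ} (hs : s ∈ nhds x) :
    ∃ w > 0, Icc (x - w) (x + w) ⊆ s := by
  obtain ⟨w, hw, h⟩ := Metric.nhds_basis_closedBall.mem_iff.1 hs
  exact ⟨w, hw, by rwa [← Real.closedBall_eq_Icc]⟩

lemma Propagates.mem_reach_slice {l u : ℝ} {Ω : Set (Euc N)} (hΩ : IsOpen Ω)
    (hΩc : IsPreconnected Ω) (h : Propagates b (Ioo l u ×ˢ Ω) Rel) {A : Set (ℝ × Euc N)}
    {x : ℝ} (hx : x ∈ Ioo l u) {y : Euc N} (hy : y ∈ Ω) (hr : (x, y) ∈ reach Rel A) :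
    ∀ z ∈ Ω, (x, z) ∈ reach Rel A := by
  have hstep : ∀ {y : Euc N} {R : ℝ}, 0 < R → closedBall y R ⊆ Ω → (x, y) ∈ reach Rel A →
      ∀ z ∈ ball y R, (x, z) ∈ reach Rel A := by
    intro y R hR hyR hr z hz
    have hcont : Continuous fun x : ℝ => (x, y) := by fun_prop
    obtain ⟨w, hw, hwsub⟩ := exists_Icc_subset_of_mem_nhds (Filter.inter_mem
      (isOpen_Ioo.mem_nhds hx) (((isOpen_reach Rel A).preimage hcont).mem_nhds hr))
    refine h.mem_reach_of_ellipsoid hw hR (fun t ht => (hwsub ht).1) hyR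
      (fun t ht _ => (hwsub ht).2) ?_
    simp only [quad, sub_self]
    have hz' : ‖z - y‖ < R := by rwa [mem_ball, dist_eq_norm] at hz
    have : (R ^ 2)⁻¹ * ‖z - y‖ ^ 2 < 1 := by
      rw [inv_mul_lt_iff₀ (by positivity), mul_one]
      exact pow_lt_pow_left₀ hz' (norm_nonneg _) two_ne_zero
    linarith
  set G : Set (Euc N) := {z | (x, z) ∈ reach Rel A} with hG
  have hGo : IsOpen G := (isOpen_reach Rel A).preimage (by fun_prop)
  refine hΩc.subset_of_closure_inter_subset hGo ⟨y, hy, hr⟩ ?_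
  rintro z ⟨hzc, hzΩ⟩
  obtain ⟨R, hR, hRΩ⟩ := Metric.nhds_basis_closedBall.mem_iff.1 (hΩ.mem_nhds hzΩ)
  obtain ⟨y', hy', hd⟩ := Metric.mem_closure_iff.1 hzc (R / 2) (half_pos hR)
  refine hstep (half_pos hR) ((closedBall_subset_closedBall' ?_).trans hRΩ) hy' z (mem_ball.2 hd)
  rw [dist_comm]
  linarith

lemma Propagates.mem_reach_of_axis {l u : ℝ} {Ω : Set (Euc N)} (hΩ : IsOpen Ω)
    (h : Propagates b (Ioo l u ×ˢ Ω) Rel) {A : Set (ℝ × Euc N)} {y₀ : Euc N} (hy₀ : y₀ ∈ Ω)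
    (hb : b y₀ ≠ 0) : ∃ w₀ > 0, ∀ w x₀, 0 < w → w ≤ w₀ → Icc (x₀ - w) (x₀ + w) ⊆ Ioo l u →
      (∀ x ∈ Icc (x₀ - w) (x₀ + w), -(w / 2 * |b y₀|) ≤ b y₀ * (x - x₀) →
        (x, y₀) ∈ reach Rel A) →
      ∀ x ∈ Ioo (x₀ - w) (x₀ + w), (x, y₀) ∈ reach Rel A := by
  obtain ⟨R, hR, hRΩ⟩ := Metric.nhds_basis_closedBall.mem_iff.1 (hΩ.mem_nhds hy₀)
  have hb0 : 0 < |b y₀| := abs_pos.2 hb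
  refine ⟨|b y₀| * R ^ 2 / (2 * ((N - 1 : ℕ) + 1)), by positivity,
    fun w x₀ hw hw₀ hI hT x hx => ?_⟩
  refine h.mem_reach_of_ellipsoid hw hR hI hRΩ (fun t ht htb => hT t ht (le_trans ?_ htb)) ?_
  · rw [neg_le_neg_iff, div_le_iff₀ (by positivity)]
    rw [le_div_iff₀ (by positivity)] at hw₀
    have h0 : (0 : ℝ) ≤ (N - 1 : ℕ) := Nat.cast_nonneg _
    nlinarith
  · simp only [quad, sub_self, norm_zero]
    have h1 : (x - x₀) ^ 2 < w ^ 2 := sq_lt_sq' (by linarith [hx.1]) (by linarith [hx.2])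
    have : (w ^ 2)⁻¹ * (x - x₀) ^ 2 < 1 := by
      rwa [inv_mul_lt_iff₀ (by positivity), mul_one]
    simpa using this

lemma Ioo_subset_of_extension {J : Set ℝ} {l u w₀ : ℝ} (hw₀ : 0 < w₀) (hJ : IsOpen J)
    (hne : (J ∩ Ioo l u).Nonempty)
    (hleft : ∀ w x₀, 0 < w → w ≤ w₀ → Icc (x₀ - w) (x₀ + w) ⊆ Ioo l u →
      Icc (x₀ - w / 2) (x₀ + w) ⊆ J → Ioo (x₀ - w) (x₀ + w) ⊆ J)
    (hright : ∀ w x₀, 0 < w → w ≤ w₀ → Icc (x₀ - w) (x₀ + w) ⊆ Ioo l u →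
      Icc (x₀ - w) (x₀ + w / 2) ⊆ J → Ioo (x₀ - w) (x₀ + w) ⊆ J) :
    Ioo l u ⊆ J := by
  obtain ⟨x, hxJ, hxl, hxu⟩ := hne
  intro z hz
  rcases le_total x z with hxz | hzx
  · by_contra hzJ
    obtain ⟨s, ⟨⟨hs1, hs2⟩, hsJ⟩, hmin⟩ := (isCompact_Icc.diff hJ : IsCompact (Icc x z \ J)
      ).exists_isLeast ⟨z, ⟨hxz, le_rfl⟩, hzJ⟩
    have hxs : x < s := lt_of_le_of_ne hs1 (by rintro rfl; exact hsJ hxJ)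
    have hsu : s < u := hs2.trans_lt hz.2
    set w := min w₀ (min ((s - x) / 2) (u - s)) with hw
    have hwpos : 0 < w := by
      simp only [hw, lt_min_iff]
      exact ⟨hw₀, by linarith, by linarith⟩
    have hw1 : w ≤ w₀ := min_le_left _ _
    have hw2 : w ≤ (s - x) / 2 := (min_le_right _ _).trans (min_le_left _ _)
    have hw3 : w ≤ u - s := (min_le_right _ _).trans (min_le_right _ _)
    refine hsJ (hright w (s - 3 / 4 * w) hwpos hw1 ?_ ?_ ⟨by linarith, by linarith⟩)
    · exact fun t ht => ⟨by linarith [ht.1], by linarith [ht.2]⟩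
    · intro t ht
      by_contra htJ
      have := hmin ⟨⟨by linarith [ht.1], by linarith [ht.2]⟩, htJ⟩
      linarith [ht.2]
  · by_contra hzJ
    obtain ⟨s, ⟨⟨hs1, hs2⟩, hsJ⟩, hmax⟩ := (isCompact_Icc.diff hJ : IsCompact (Icc z x \ J)
      ).exists_isGreatest ⟨z, ⟨le_rfl, hzx⟩, hzJ⟩
    have hxs : s < x := lt_of_le_of_ne hs2 (by rintro rfl; exact hsJ hxJ)
    have hsu : l < s := hz.1.trans_le hs1
    set w := min w₀ (min ((x - s) / 2) (s - l)) with hw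
    have hwpos : 0 < w := by
      simp only [hw, lt_min_iff]
      exact ⟨hw₀, by linarith, by linarith⟩
    have hw1 : w ≤ w₀ := min_le_left _ _
    have hw2 : w ≤ (x - s) / 2 := (min_le_right _ _).trans (min_le_left _ _)
    have hw3 : w ≤ s - l := (min_le_right _ _).trans (min_le_right _ _)
    refine hsJ (hleft w (s + 3 / 4 * w) hwpos hw1 ?_ ?_ ⟨by linarith, by linarith⟩)
    · exact fun t ht => ⟨by linarith [ht.1], by linarith [ht.2]⟩
    · intro t ht
      by_contra htJ
      have := hmax ⟨⟨by linarith [ht.1], by linarith [ht.2]⟩, htJ⟩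
      linarith [ht.1]

/-- When the drift changes sign, every set with interior controls every compact set. -/
lemma Propagates.rel_of_isCompact {l u : ℝ} {Ω : Set (Euc N)} (hΩ : IsOpen Ω)
    (hΩc : IsPreconnected Ω) (h : Propagates b (Ioo l u ×ˢ Ω) Rel) {y₁ y₂ : Euc N}
    (hy₁ : y₁ ∈ Ω) (hy₂ : y₂ ∈ Ω) (hb₁ : 0 < b y₁) (hb₂ : b y₂ < 0)
    {A K : Set (ℝ × Euc N)} {p : ℝ × Euc N} (hp : p ∈ Ioo l u ×ˢ Ω) (hA : A ∈ nhds p)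
    (hK : IsCompact K) (hKS : K ⊆ Ioo l u ×ˢ Ω) : Rel A K := by
  set J : Set ℝ := {x | (x, y₁) ∈ reach Rel A} with hJ
  have hJo : IsOpen J := (isOpen_reach Rel A).preimage (by fun_prop)
  have hJiff : ∀ {x}, x ∈ Ioo l u → ∀ {y}, y ∈ Ω → (x, y) ∈ reach Rel A → x ∈ J :=
    fun hx _ hy hr => h.mem_reach_slice hΩ hΩc hx hy hr y₁ hy₁
  have hJmem : ∀ {x}, x ∈ Ioo l u → x ∈ J → ∀ y ∈ Ω, (x, y) ∈ reach Rel A :=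
    fun hx hxJ => h.mem_reach_slice hΩ hΩc hx hy₁ hxJ
  obtain ⟨w₁, hw₁, hax₁⟩ := h.mem_reach_of_axis hΩ (A := A) hy₁ hb₁.ne'
  obtain ⟨w₂, hw₂, hax₂⟩ := h.mem_reach_of_axis hΩ (A := A) hy₂ hb₂.ne
  have hall : Ioo l u ⊆ J := by
    refine Ioo_subset_of_extension (lt_min hw₁ hw₂) hJo
      ⟨p.1, hJiff hp.1 hp.2 ⟨A, hA, h.refl A⟩, hp.1⟩ ?_ ?_
    · intro w x₀ hw hww hI hsub x hx
      refine hax₁ w x₀ hw (hww.trans (min_le_left _ _)) hI (fun t ht htb => hsub ⟨?_, ht.2⟩) x hx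
      rw [abs_of_pos hb₁] at htb
      by_contra! hlt
      nlinarith
    · intro w x₀ hw hww hI hsub x hx
      refine hJiff (hI (Ioo_subset_Icc_self hx)) hy₂
        (hax₂ w x₀ hw (hww.trans (min_le_right _ _)) hI (fun t ht htb => ?_) x hx)
      refine hJmem (hI ht) (hsub ⟨ht.1, ?_⟩) y₂ hy₂
      rw [abs_of_neg hb₂] at htb
      by_contra! hlt
      nlinarith
  obtain ⟨O, -, hKO, hr⟩ := h.exists_isOpen_of_isCompact hK (A := A)
    fun q hq => hJmem (hKS hq).1 (hall (hKS hq).1) q.2 (hKS hq).2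
  exact h.mono hr subset_rfl hKO

end Chain

section SmoothHarnack

variable {N : ℕ}

lemma exists_uniform_lower_bound {β : Euc N → ℝ} {M r : ℝ} {S K Q : Set (ℝ × Euc N)}
    (hQ : IsCompact Q) (hr : 0 < r)
    (h : ∀ z ∈ Q, PointwiseRel β M S (ball z (r / 2)) K) :
    ∃ c > (0 : ℝ), ∀ z ∈ Q, ∀ v, Admissible β M S v → ∀ l ≥ (0 : ℝ), (∀ p ∈ ball z r, l ≤ v p) →
      ∀ p ∈ K, c * l ≤ v p := by
  refine hQ.induction_on (p := fun Q => ∃ c > (0 : ℝ), ∀ z ∈ Q, ∀ v, Admissible β M S v →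
    ∀ l ≥ (0 : ℝ), (∀ p ∈ ball z r, l ≤ v p) → ∀ p ∈ K, c * l ≤ v p) ?_ ?_ ?_ ?_
  · exact ⟨1, one_pos, fun z hz => absurd hz (notMem_empty z)⟩
  · rintro s t hst ⟨c, hc, hcs⟩
    exact ⟨c, hc, fun z hz => hcs z (hst hz)⟩
  · rintro s t ⟨c, hc, hcs⟩ ⟨c', hc', hcs'⟩
    refine ⟨min c c', lt_min hc hc', fun z hz v hv l hl hb p hp => ?_⟩
    rcases hz with hz | hz
    · exact (mul_le_mul_of_nonneg_right (min_le_left _ _) hl).trans (hcs z hz v hv l hl hb p hp)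
    · exact (mul_le_mul_of_nonneg_right (min_le_right _ _) hl).trans (hcs' z hz v hv l hl hb p hp)
  · intro z hz
    obtain ⟨c, hc, hrel⟩ := h z hz
    refine ⟨ball z (r / 2), mem_nhdsWithin_of_mem_nhds (ball_mem_nhds z (half_pos hr)), c, hc,
      fun z' hz' v hv l hl hb => hrel v hv l hl fun p hp => hb p ?_⟩
    have h1 := mem_ball.1 hz'
    have h2 := mem_ball.1 hp
    rw [dist_comm] at h1
    exact mem_ball.2 ((dist_triangle p z z').trans_lt (by linarith))

set_option maxHeartbeats 1000000 in
/-- The Harnack inequality for admissible functions on compact subsets of a cylinder. -/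
lemma FiniteType.harnack_of_isCompact {β : Euc N → ℝ} {B : ℝ} (hβ : BoundedDrift β B)
    {Ω : Set (Euc N)} {Z : Finset (Euc N)} {ρ c : ℝ} {j : ℕ} (hF : FiniteType β Ω Z ρ c j)
    (hΩ : IsOpen Ω) (hΩc : IsPreconnected Ω) {y₁ y₂ : Euc N} (hy₁ : y₁ ∈ Ω) (hy₂ : y₂ ∈ Ω)
    (hb₁ : 0 < β y₁) (hb₂ : β y₂ < 0) {M : ℝ} (hM : 0 < M) {l u : ℝ} {K : Set (ℝ × Euc N)}
    (hK : IsCompact K) (hKS : K ⊆ Ioo l u ×ˢ Ω) :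
    ∃ C > (0 : ℝ), ∀ v, Admissible β M (Ioo l u ×ˢ Ω) v → ∀ p ∈ K, ∀ q ∈ K, v p ≤ C * v q := by
  rcases K.eq_empty_or_nonempty with rfl | ⟨q₀, hq₀⟩
  · exact ⟨1, one_pos, fun v _ p hp => absurd hp (notMem_empty p)⟩
  set S := Ioo l u ×ˢ Ω with hS
  have hSo : IsOpen S := isOpen_Ioo.prod hΩ
  obtain ⟨d', hd'0, hd'S⟩ := hK.exists_cthickening_subset_open hSo hKS
  set d := min d' 1 with hd
  have hd0 : 0 < d := lt_min hd'0 one_pos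
  have hd1 : d ≤ 1 := min_le_right _ _
  set K' := cthickening d K with hK'
  have hK'c : IsCompact K' := hK.cthickening
  have hK'S : K' ⊆ S := (cthickening_mono (min_le_left _ _) K).trans hd'S
  have hballK : ∀ {p q : ℝ × Euc N}, p ∈ K → dist q p ≤ d → q ∈ K' := fun {p q} hp hq =>
    mem_cthickening_of_dist_le q p d K hp hq
  set Q := closedBall q₀ (d / 4) with hQ
  have hprI := propagates_integralRel hβ.contDiff hM S
  have hprP := propagates_pointwiseRel hβ.contDiff.continuous hM S
  obtain ⟨C₀, hC₀⟩ := hprI.rel_of_isCompact hΩ hΩc hy₂ hy₁ (neg_pos.2 hb₂) (neg_neg_iff_pos.2 hb₁)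
    (hKS hq₀) (ball_mem_nhds q₀ (by linarith : 0 < d / 4)) hK'c hK'S
  obtain ⟨C₁, hC₁0, hC₁⟩ := hF.exists_sup_bound hβ hM.le (by linarith : 0 < d / 4)
    (by linarith)
  set C₂ := C₁ * (C₀ + 1) with hC₂
  have hC₂0 : 0 < C₂ := by positivity
  set V := volume.real (ball q₀ (d / 4)) with hV
  have hV0 : 0 < V := by
    rw [hV, measureReal_ball _ (by linarith)]
    exact mul_pos (pow_pos (by linarith) _) (unitBallVolume_pos N)
  set η := (C₂ * V)⁻¹ with hη
  have hη0 : 0 < η := by positivity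
  obtain ⟨r, hr, hmod⟩ := hF.exists_modulus hβ hM.le (half_pos hη0) (half_pos hd0) (by linarith)
  have hQK : ∀ z ∈ Q, ∀ x, dist x z ≤ 3 * (d / 4) → x ∈ K' := fun z hz x hx => by
    refine hballK hq₀ ((dist_triangle x z q₀).trans ?_)
    linarith [mem_closedBall.1 hz]
  obtain ⟨c', hc', hlow⟩ := exists_uniform_lower_bound (β := β) (M := M) (S := S) (K := K)
    (Q := Q) (isCompact_closedBall _ _) hr fun z hz =>
      hprP.rel_of_isCompact hΩ hΩc hy₁ hy₂ hb₁ hb₂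
        (hK'S (hQK z hz z (by rw [dist_self]; linarith))) (ball_mem_nhds z (half_pos hr)) hK hKS
  refine ⟨C₂ * (2 * V) / c', by positivity, fun v hv p hp q hq => ?_⟩
  have hvc := hv.contDiff.continuous
  set I := ∫ x in ball q₀ (d / 4), v x with hI
  have hBK : ball q₀ (d / 4) ⊆ K' := fun x hx =>
    hballK hq₀ ((mem_ball.1 hx).le.trans (by linarith))
  have hI0 : 0 ≤ I := setIntegral_ball_nonneg fun x hx => hv.nonneg x (hK'S (hBK hx))
  have hvK' : IntegrableOn v K' := hvc.continuousOn.integrableOn_compact hK'c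
  have hupper : ∀ x, ball x (d / 4) ⊆ K' → v x ≤ C₂ * I := by
    intro x hx
    have h1 := hC₁ v hv.contDiff x (fun y hy => hv.nonneg y (hK'S (hx hy)))
      (fun y hy => hv.abs_opL_le y (hK'S (hx hy))) fun y hy => (hK'S (hx hy)).2
    have h2 : ∫ y in ball x (d / 4), v y ≤ ∫ y in K', v y :=
      setIntegral_mono_set hvK' ((ae_restrict_iff' hK'c.measurableSet).2
        (Filter.Eventually.of_forall fun y hy => hv.nonneg y (hK'S hy)))
        (LE.le.eventuallyLE hx)
    have h3 : ∫ y in K', v y ≤ C₀ * I := by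
      have e1 : ENNReal.ofReal (∫ y in K', v y) = ∫⁻ y in K', ENNReal.ofReal (v y) :=
        ofReal_integral_eq_lintegral_ofReal hvK' ((ae_restrict_iff' hK'c.measurableSet).2
          (Filter.Eventually.of_forall fun y hy => hv.nonneg y (hK'S hy)))
      have e2 : ENNReal.ofReal I = ∫⁻ y in ball q₀ (d / 4), ENNReal.ofReal (v y) :=
        ofReal_integral_eq_lintegral_ofReal (hvc.integrableOn_ball _ _)
          ((ae_restrict_iff' measurableSet_ball).2
            (Filter.Eventually.of_forall fun y hy => hv.nonneg y (hK'S (hBK hy))))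
      have e3 := hC₀ v hv
      rw [← e1, ← e2, ← ENNReal.ofReal_coe_nnreal, ← ENNReal.ofReal_mul C₀.coe_nonneg] at e3
      exact (ENNReal.ofReal_le_ofReal_iff (mul_nonneg C₀.coe_nonneg hI0)).1 e3
    calc v x ≤ C₁ * (C₀ * I) := h1.trans (by gcongr; exact h2.trans h3)
      _ ≤ C₁ * ((C₀ + 1) * I) := by gcongr; linarith
      _ = C₂ * I := by rw [hC₂]; ring
  have hpI : v p ≤ C₂ * I := hupper p fun x hx =>
    hballK hp ((mem_ball.1 hx).le.trans (by linarith))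
  rcases hI0.eq_or_lt with h0 | hIpos
  · rw [← h0, mul_zero] at hpI
    exact hpI.trans (mul_nonneg (by positivity) (hv.nonneg q (hKS hq)))
  obtain ⟨z, hz, hzle⟩ := exists_setAverage_le (μ := volume) (s := ball q₀ (d / 4)) (f := v)
    (measure_ball_pos _ _ (by linarith)).ne' measure_ball_lt_top.ne (hvc.integrableOn_ball _ _)
  rw [setAverage_eq, smul_eq_mul, ← hI, ← hV] at hzle
  have hzQ : z ∈ Q := ball_subset_closedBall hz
  set k := (C₂ * I)⁻¹ with hk
  have hk0 : 0 < k := by positivity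
  have hbz : ∀ x ∈ ball z (d / 2), x ∈ K' ∧ ball x (d / 4) ⊆ K' := fun x hx =>
    ⟨hQK z hzQ x ((mem_ball.1 hx).le.trans (by linarith)), fun y hy => hQK z hzQ y
      ((dist_triangle y x z).trans (by linarith [mem_ball.1 hx, mem_ball.1 hy]))⟩
  have hle1 : ∀ x ∈ ball z (d / 2), k * v x ≤ 1 := fun x hx => by
    rw [hk, inv_mul_le_iff₀ (by positivity), mul_one]
    exact hupper x (hbz x hx).2
  have hunit : UnitBounded β Ω M (fun x => k * v x) (ball z (d / 2)) := by
    refine ⟨contDiff_const.mul hv.contDiff,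
      fun x hx => mul_nonneg hk0.le (hv.nonneg x (hK'S (hbz x hx).1)), hle1, fun x hx => ?_,
      fun x hx => (hK'S (hbz x hx).1).2⟩
    rw [opL_const_mul β hv.contDiff, abs_mul, abs_of_pos hk0]
    calc k * |opL β v x| ≤ k * (M * v x) := by
          gcongr
          exact hv.abs_opL_le x (hK'S (hbz x hx).1)
      _ = M * (k * v x) := by ring
      _ ≤ M * 1 := by gcongr; exact hle1 x hx
      _ = M := mul_one M
  have hlowz : ∀ x ∈ ball z r, I / (2 * V) ≤ v x := by
    intro x hx
    have h1 := (abs_le.1 (hmod _ z hunit x hx)).1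
    have h2 : η ≤ k * v z := by
      calc η = k * (V⁻¹ * I) := by
            rw [hη, hk]
            field_simp
        _ ≤ k * v z := by gcongr
    have h3 : η / 2 ≤ k * v x := by linarith
    have h4 : I / (2 * V) = k⁻¹ * (η / 2) := by
      rw [hη, hk, inv_inv]
      field_simp
    rw [h4, inv_mul_le_iff₀ hk0]
    exact h3
  have hqI := hlow z hzQ v hv (I / (2 * V)) (by positivity) hlowz q hq
  calc v p ≤ C₂ * I := hpI
    _ = C₂ * (2 * V) / c' * (c' * (I / (2 * V))) := by field_simp
    _ ≤ _ := by gcongr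

lemma Admissible.shift_x {β : Euc N → ℝ} {M : ℝ} {S S' : Set (ℝ × Euc N)} {v : ℝ × Euc N → ℝ}
    (h : Admissible β M S v) {t : ℝ} (hS : ∀ p ∈ S', p + (t, 0) ∈ S) :
    Admissible β M S' fun p => v (p + (t, 0)) :=
  ⟨h.contDiff.comp (contDiff_id.add contDiff_const), fun p hp => h.nonneg _ (hS p hp),
    fun p hp => by rw [opL_shift_x]; exact h.abs_opL_le _ (hS p hp)⟩

/-- The Harnack inequality for admissible functions, uniformly in the cylinder. -/
lemma FiniteType.harnack_of_admissible {β : Euc N → ℝ} {B : ℝ} (hβ : BoundedDrift β B)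
    {Ω : Set (Euc N)} {Z : Finset (Euc N)} {ρ c : ℝ} {j : ℕ} (hF : FiniteType β Ω Z ρ c j)
    (hΩ : IsOpen Ω) (hΩc : IsPreconnected Ω) {y₁ y₂ : Euc N} (hy₁ : y₁ ∈ Ω) (hy₂ : y₂ ∈ Ω)
    (hb₁ : 0 < β y₁) (hb₂ : β y₂ < 0) {M : ℝ} (hM : 0 < M) {K : Set (Euc N)}
    (hK : IsCompact K) (hKΩ : K ⊆ Ω) {δ L : ℝ} (hδ : 0 < δ) :
    ∃ C > (0 : ℝ), ∀ a a' b' b : ℝ, a + δ ≤ a' → b' + δ ≤ b → b' - a' ≤ L →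
      ∀ v, Admissible β M (Ioo a b ×ˢ Ω) v → ∀ p ∈ Icc a' b' ×ˢ K, ∀ q ∈ Icc a' b' ×ˢ K,
        v p ≤ C * v q := by
  obtain ⟨C, hC, hloc⟩ := hF.harnack_of_isCompact hβ hΩ hΩc hy₁ hy₂ hb₁ hb₂ hM
    (l := -δ) (u := δ) ((isCompact_Icc (a := -(δ / 2)) (b := δ / 2)).prod hK)
    (prod_mono (Icc_subset_Ioo (by linarith) (by linarith)) hKΩ)
  obtain ⟨n, hn⟩ := exists_nat_gt (L / (δ / 2))
  rw [div_lt_iff₀ (by linarith)] at hn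
  refine ⟨C ^ (n + 1), by positivity, fun a a' b' b ha hb hL v hv p hp q hq => ?_⟩
  have hstep : ∀ p ∈ Icc a' b' ×ˢ K, ∀ q ∈ Icc a' b' ×ˢ K, |p.1 - q.1| ≤ δ / 2 →
      v p ≤ C * v q := by
    intro p hp q hq hpq
    have hsh : Admissible β M (Ioo (-δ) δ ×ˢ Ω) fun x => v (x + (q.1, 0)) := by
      refine hv.shift_x fun x hx => ⟨⟨?_, ?_⟩, by simpa using hx.2⟩
      · have := hx.1.1
        simp only [Prod.fst_add]
        linarith [hq.1.1]
      · have := hx.1.2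
        simp only [Prod.fst_add]
        linarith [hq.1.2]
    have := hloc _ hsh (p.1 - q.1, p.2) ⟨abs_le.1 hpq, hp.2⟩ (0, q.2)
      ⟨⟨by linarith, by linarith⟩, hq.2⟩
    simpa using this
  have hchain : ∀ n : ℕ, ∀ p ∈ Icc a' b' ×ˢ K, ∀ q ∈ Icc a' b' ×ˢ K,
      |p.1 - q.1| ≤ (n + 1) * (δ / 2) → v p ≤ C ^ (n + 1) * v q := by
    intro n
    induction n with
    | zero =>
      intro p hp q hq hpq
      simpa using hstep p hp q hq (by simpa using hpq)
    | succ n ih =>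
      intro p hp q hq hpq
      push_cast at hpq
      set x := p.1 + (q.1 - p.1) / (n + 2) with hx
      have hn2 : (0 : ℝ) < n + 2 := by positivity
      have hx1 : p.1 - x = (p.1 - q.1) / (n + 2) := by rw [hx]; ring
      have hx2 : x - q.1 = (p.1 - q.1) * ((n + 1) / (n + 2)) := by
        rw [hx]
        field_simp
        ring
      have h1 : |p.1 - x| ≤ δ / 2 := by
        rw [hx1, abs_div, abs_of_pos hn2, div_le_iff₀ hn2]
        linarith
      have h2 : |x - q.1| ≤ (n + 1) * (δ / 2) := by
        rw [hx2, abs_mul, abs_of_nonneg (by positivity : (0 : ℝ) ≤ (n + 1) / (n + 2)),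
          ← mul_div_assoc, div_le_iff₀ hn2]
        have : (0 : ℝ) ≤ n + 1 := by positivity
        nlinarith
      have hxmem : x ∈ Icc a' b' := by
        have hcx : x = (1 - 1 / ((n : ℝ) + 2)) • p.1 + (1 / ((n : ℝ) + 2)) • q.1 := by
          rw [hx, smul_eq_mul, smul_eq_mul]
          field_simp
          ring
        rw [hcx]
        have : 1 / ((n : ℝ) + 2) ≤ 1 := by
          rw [div_le_one hn2]
          linarith [(Nat.cast_nonneg n : (0 : ℝ) ≤ n)]
        exact convex_Icc a' b' hp.1 hq.1 (by linarith) (by positivity) (by ring)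
      have hm : (x, q.2) ∈ Icc a' b' ×ˢ K := ⟨hxmem, hq.2⟩
      calc v p ≤ C * v (x, q.2) := hstep p hp _ hm h1
        _ ≤ C * (C ^ (n + 1) * v q) := by gcongr; exact ih _ hm q hq h2
        _ = C ^ (n + 1 + 1) * v q := by ring
  refine hchain n p hp q hq ?_
  have h1 : |p.1 - q.1| ≤ b' - a' :=
    abs_sub_le_iff.2 ⟨by linarith [hp.1.2, hq.1.1], by linarith [hq.1.2, hp.1.1]⟩
  linarith

end SmoothHarnack

section FiniteTypeConditions

variable {N : ℕ}

lemma ContDiff.partialsAlong {f : Euc N → ℝ} (hf : ContDiff ℝ (⊤ : ℕ∞) f)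
    (l : List (Fin (N - 1))) : ContDiff ℝ (⊤ : ℕ∞) (partialsAlong f l) := by
  induction l with
  | nil => exact hf
  | cons i l ih => exact (ih.fderiv_right le_rfl).clm_apply contDiff_const

lemma partialsAlong_neg (f : Euc N → ℝ) (l : List (Fin (N - 1))) :
    partialsAlong (fun y => - f y) l = fun y => - partialsAlong f l y := by
  induction l with
  | nil => rfl
  | cons i l ih =>
    funext y
    simp only [partialsAlong, ih, fderiv_fun_neg, neg_apply]

lemma partialsAlong_shift_sub {f : Euc N → ℝ} (hf : ContDiff ℝ (⊤ : ℕ∞) f) (s : Euc N)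
    (l : List (Fin (N - 1))) :
    partialsAlong (fun y => f (y + s) - f y) l =
      fun y => partialsAlong f l (y + s) - partialsAlong f l y := by
  induction l with
  | nil => rfl
  | cons i l ih =>
    have hd := (hf.partialsAlong l).differentiable (by simp)
    funext y
    simp only [partialsAlong, ih]
    have hs : DifferentiableAt ℝ (fun y => partialsAlong f l (y + s)) y :=
      (differentiableAt_comp_add_right s).2 (hd (y + s))
    rw [fderiv_fun_sub hs (hd y), fderiv_comp_add_right]
    rfl

lemma partialsAlong_congr {f g : Euc N → ℝ} {U : Set (Euc N)} (hU : IsOpen U)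
    (h : EqOn f g U) (l : List (Fin (N - 1))) :
    EqOn (partialsAlong f l) (partialsAlong g l) U := by
  induction l with
  | nil => exact h
  | cons i l ih =>
    intro y hy
    have := (ih.eventuallyEq_of_mem (hU.mem_nhds hy)).fderiv_eq (𝕜 := ℝ)
    simp only [partialsAlong, this]

/-- A lower bound for an iterated partial derivative yields, at every scale, a nearby point at
which the function is large. -/
lemma exists_le_of_partialsAlong_ge (l : List (Fin (N - 1))) :
    ∃ Z : Finset (Euc N), (∀ ζ ∈ Z, ‖ζ‖ ≤ l.length) ∧
      ∀ f : Euc N → ℝ, ContDiff ℝ (⊤ : ℕ∞) f → ∀ (y : Euc N) (σ c : ℝ), 0 < σ →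
        (∀ z, dist z y ≤ l.length * σ → c ≤ partialsAlong f l z) →
        ∃ ζ ∈ Z, c * (σ / 2) ^ l.length ≤ |f (y + σ • ζ)| := by
  classical
  induction l with
  | nil =>
    refine ⟨{0}, by simp, fun f _ y σ c _ h => ⟨0, by simp, ?_⟩⟩
    have := h y (by simp)
    simpa [partialsAlong] using this.trans (le_abs_self _)
  | cons i l ih =>
    obtain ⟨Z, hZ, H⟩ := ih
    set e : Euc N := EuclideanSpace.single i (1 : ℝ) with he
    have hen : ‖e‖ = 1 := by simp [he]
    refine ⟨Z ∪ Z.image (· + e), ?_, fun f hf y σ c hσ h => ?_⟩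
    · intro ζ hζ
      rw [List.length_cons]
      push_cast
      rcases Finset.mem_union.1 hζ with hζ | hζ
      · linarith [hZ ζ hζ]
      · obtain ⟨ξ, hξ, rfl⟩ := Finset.mem_image.1 hζ
        linarith [norm_add_le ξ e, hZ ξ hξ]
    · have hd := (hf.partialsAlong l).differentiable (by simp)
      have hkey : ∀ z, dist z y ≤ l.length * σ →
          c * σ ≤ partialsAlong (fun w => f (w + σ • e) - f w) l z := by
        intro z hz
        rw [partialsAlong_shift_sub hf]
        have hder : ∀ t : ℝ, HasDerivAt (fun t : ℝ => partialsAlong f l (z + t • e))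
            (fderiv ℝ (partialsAlong f l) (z + t • e) e) t := by
          intro t
          have h1 : HasDerivAt (fun t : ℝ => z + t • e) e t := by
            simpa using ((hasDerivAt_id t).smul_const e).const_add z
          exact (hd (z + t • e)).hasFDerivAt.comp_hasDerivAt t h1
        obtain ⟨t, ht, hte⟩ := exists_hasDerivAt_eq_slope _ _ hσ
          (fun t _ => (hder t).continuousAt.continuousWithinAt) (fun t _ => hder t)
        have h2 : c ≤ fderiv ℝ (partialsAlong f l) (z + t • e) e := by
          refine h (z + t • e) ?_
          rw [List.length_cons]
          push_cast
          have : dist (z + t • e) z ≤ σ := by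
            rw [dist_eq_norm, add_sub_cancel_left, norm_smul, hen, mul_one, Real.norm_eq_abs,
              abs_of_pos ht.1]
            exact ht.2.le
          linarith [dist_triangle (z + t • e) z y]
        rw [hte, sub_zero, le_div_iff₀ hσ, zero_smul, add_zero] at h2
        exact h2
      obtain ⟨ζ, hζ, hle⟩ := H (fun w => f (w + σ • e) - f w)
        ((hf.comp (contDiff_id.add contDiff_const)).sub hf) y σ (c * σ) hσ hkey
      have h3 : c * (σ / 2) ^ (l.length + 1) = (c * σ * (σ / 2) ^ l.length) / 2 := by ring
      rw [List.length_cons, h3]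
      by_cases hcase : c * σ * (σ / 2) ^ l.length / 2 ≤ |f (y + σ • ζ)|
      · exact ⟨ζ, Finset.mem_union_left _ hζ, hcase⟩
      · refine ⟨ζ + e, Finset.mem_union_right _ (Finset.mem_image_of_mem _ hζ), ?_⟩
        rw [smul_add, ← add_assoc]
        have := abs_sub (f (y + σ • ζ + σ • e)) (f (y + σ • ζ))
        linarith

lemma FiniteType.mono {β : Euc N → ℝ} {W W' : Set (Euc N)} {Z : Finset (Euc N)} {ρ c : ℝ} {j : ℕ}
    (h : FiniteType β W Z ρ c j) (hW : W' ⊆ W) : FiniteType β W' Z ρ c j :=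
  ⟨h.rho_pos, h.rho_le, h.c_pos, h.norm_le, fun y hy => h.exists_le y (hW hy)⟩

lemma exists_finiteType_nhds {f : Euc N → ℝ} (hf : ContDiff ℝ (⊤ : ℕ∞) f) {y₀ : Euc N}
    {l : List (Fin (N - 1))} (hl : 0 < partialsAlong f l y₀) :
    ∃ r > 0, ∃ Z ρ c j, FiniteType f (ball y₀ r) Z ρ c j := by
  classical
  obtain ⟨Z, hZ, H⟩ := exists_le_of_partialsAlong_ge l
  set c := partialsAlong f l y₀ / 2 with hc
  have hc0 : 0 < c := by positivity
  have hev : ∀ᶠ z in nhds y₀, c < partialsAlong f l z :=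
    (hf.partialsAlong l).continuous.continuousAt.eventually (lt_mem_nhds (by linarith))
  obtain ⟨r, hr, hball⟩ := Metric.eventually_nhds_iff.1 hev
  set k : ℝ := l.length + 1 with hk
  have hk0 : 0 < k := by positivity
  refine ⟨r / 2, by positivity, Z.image (fun ζ => k⁻¹ • ζ), min 1 (r / 2 / 2),
    c * ((2 * k)⁻¹) ^ l.length, l.length,
    by positivity, min_le_left _ _, by positivity, ?_, ?_⟩
  · intro ζ hζ
    obtain ⟨ξ, hξ, rfl⟩ := Finset.mem_image.1 hζ
    rw [norm_smul, norm_inv, Real.norm_eq_abs, abs_of_pos hk0, inv_mul_le_iff₀ hk0]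
    linarith [hZ ξ hξ]
  · intro y hy σ hσ
    have hσr : σ ≤ r / 2 / 2 := hσ.2.trans (min_le_right _ _)
    obtain ⟨ζ, hζ, hle⟩ := H f hf y (σ / k) c (div_pos hσ.1 hk0) fun z hz => by
      refine (hball ?_).le
      have h1 : l.length * (σ / k) ≤ σ := by
        rw [mul_div_assoc', div_le_iff₀ hk0]
        nlinarith [hσ.1]
      linarith [dist_triangle z y y₀, mem_ball.1 hy]
    refine ⟨k⁻¹ • ζ, Finset.mem_image_of_mem _ hζ, ?_⟩
    rw [smul_smul, ← div_eq_mul_inv]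
    refine le_trans (le_of_eq ?_) hle
    rw [mul_assoc, ← mul_pow]
    congr 2
    field_simp

lemma FiniteType.neg {β : Euc N → ℝ} {W : Set (Euc N)} {Z : Finset (Euc N)} {ρ c : ℝ} {j : ℕ}
    (h : FiniteType (fun y => - β y) W Z ρ c j) : FiniteType β W Z ρ c j :=
  ⟨h.rho_pos, h.rho_le, h.c_pos, h.norm_le, fun y hy σ hσ => by
    simpa only [abs_neg] using h.exists_le y hy σ hσ⟩

lemma FiniteType.union {β : Euc N → ℝ} {W₁ W₂ : Set (Euc N)} {Z₁ Z₂ : Finset (Euc N)}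
    {ρ₁ c₁ ρ₂ c₂ : ℝ} {j₁ j₂ : ℕ} [DecidableEq (Euc N)] (h₁ : FiniteType β W₁ Z₁ ρ₁ c₁ j₁)
    (h₂ : FiniteType β W₂ Z₂ ρ₂ c₂ j₂) :
    FiniteType β (W₁ ∪ W₂) (Z₁ ∪ Z₂) (min ρ₁ ρ₂) (min c₁ c₂) (max j₁ j₂) := by
  have hm := h₁.rho_pos
  have hm' := h₂.rho_pos
  have hc := h₁.c_pos
  have hc' := h₂.c_pos
  refine ⟨by positivity, (min_le_left _ _).trans h₁.rho_le, by positivity, ?_, ?_⟩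
  · intro ζ hζ
    rcases Finset.mem_union.1 hζ with h | h
    exacts [h₁.norm_le ζ h, h₂.norm_le ζ h]
  · rintro y hy σ ⟨hσ0, hσ⟩
    have hσ1 : σ ≤ 1 := hσ.trans ((min_le_left _ _).trans h₁.rho_le)
    rcases hy with hy | hy
    · obtain ⟨ζ, hζ, h⟩ := h₁.exists_le y hy σ ⟨hσ0, hσ.trans (min_le_left _ _)⟩
      exact ⟨ζ, Finset.mem_union_left _ hζ, le_trans (mul_le_mul (min_le_left _ _)
        (pow_le_pow_of_le_one hσ0.le hσ1 (le_max_left _ _)) (by positivity) hc.le) h⟩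
    · obtain ⟨ζ, hζ, h⟩ := h₂.exists_le y hy σ ⟨hσ0, hσ.trans (min_le_right _ _)⟩
      exact ⟨ζ, Finset.mem_union_right _ hζ, le_trans (mul_le_mul (min_le_right _ _)
        (pow_le_pow_of_le_one hσ0.le hσ1 (le_max_right _ _)) (by positivity) hc'.le) h⟩

/-- The Hörmander-type condition at every point of a compact set gives a uniform finite type
condition on it. -/
lemma exists_finiteType {f : Euc N → ℝ} (hf : ContDiff ℝ (⊤ : ℕ∞) f) {K : Set (Euc N)}
    (hK : IsCompact K) (h : ∀ y ∈ K, ∃ l, partialsAlong f l y ≠ 0) :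
    ∃ Z ρ c j, FiniteType f K Z ρ c j := by
  classical
  refine hK.induction_on (p := fun s => ∃ Z ρ c j, FiniteType f s Z ρ c j) ?_ ?_ ?_ ?_
  · exact ⟨∅, 1, 1, 0, by norm_num, le_rfl, by norm_num, by simp, by simp⟩
  · rintro s t hst ⟨Z, ρ, c, j, h⟩
    exact ⟨Z, ρ, c, j, h.mono hst⟩
  · rintro s t ⟨Z₁, ρ₁, c₁, j₁, h₁⟩ ⟨Z₂, ρ₂, c₂, j₂, h₂⟩
    exact ⟨_, _, _, _, h₁.union h₂⟩
  · intro y hy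
    obtain ⟨l, hl⟩ := h y hy
    rcases hl.lt_or_gt with hl | hl
    · obtain ⟨r, hr, Z, ρ, c, j, H⟩ := exists_finiteType_nhds hf.neg (y₀ := y) (l := l) (by
        have := congrFun (partialsAlong_neg f l) y
        exact this ▸ neg_pos.2 hl)
      exact ⟨ball y r, mem_nhdsWithin_of_mem_nhds (ball_mem_nhds y hr), Z, ρ, c, j, H.neg⟩
    · obtain ⟨r, hr, H⟩ := exists_finiteType_nhds hf hl
      exact ⟨ball y r, mem_nhdsWithin_of_mem_nhds (ball_mem_nhds y hr), H⟩

lemma exists_partialsAlong_ne_zero {r : ℕ} {β : Euc N → ℝ} {y : Euc N}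
    (h : 0 < hormanderSum N r β y) : ∃ l, partialsAlong β l y ≠ 0 := by
  obtain ⟨ζ, -, hζ⟩ := Finset.exists_ne_zero_of_sum_ne_zero h.ne'
  exact ⟨_, abs_ne_zero.1 hζ⟩

end FiniteTypeConditions

section Localization

open scoped Manifold ContDiff

variable {N : ℕ}

lemma isPreconnected_thickening {T : Set (Euc N)} (hT : IsPreconnected T) {δ : ℝ} (hδ : 0 < δ) :
    IsPreconnected (thickening δ T) := by
  rcases T.eq_empty_or_nonempty with rfl | ⟨t₀, ht₀⟩
  · simpa using isPreconnected_empty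
  refine isPreconnected_of_forall t₀ fun y hy => ?_
  obtain ⟨t, ht, hyt⟩ := mem_thickening_iff.1 hy
  refine ⟨T ∪ ball t δ, union_subset (self_subset_thickening hδ T)
    (fun z hz => mem_thickening_iff.2 ⟨t, ht, mem_ball.1 hz⟩), Or.inl ht₀, Or.inr (mem_ball.2 hyt),
    hT.union t ht (mem_ball_self hδ) (convex_ball t δ).isPreconnected⟩

/-- A compact subset of an open connected set is contained in a relatively compact open
preconnected subset. -/
lemma exists_isPreconnected_between {D K : Set (Euc N)} (hD : IsOpen D) (hDc : IsConnected D)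
    (hK : IsCompact K) (hKD : K ⊆ D) :
    ∃ Ω : Set (Euc N), IsOpen Ω ∧ IsPreconnected Ω ∧ K ⊆ Ω ∧ IsCompact (closure Ω) ∧
      closure Ω ⊆ D := by
  have hpc := hD.isConnected_iff_isPathConnected.1 hDc
  obtain ⟨y₀, hy₀⟩ := hDc.nonempty
  have hloc : ∀ y ∈ D, ∃ Ω : Set (Euc N), IsOpen Ω ∧ IsPreconnected Ω ∧ y₀ ∈ Ω ∧ y ∈ Ω ∧
      IsCompact (closure Ω) ∧ closure Ω ⊆ D := by
    intro y hy
    obtain ⟨γ, hγ⟩ := hpc.joinedIn y₀ hy₀ y hy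
    have hTc : IsCompact (range γ) := isCompact_range γ.continuous
    obtain ⟨δ, hδ, hsub⟩ := hTc.exists_cthickening_subset_open hD (range_subset_iff.2 hγ)
    have hcl := closure_thickening_subset_cthickening δ (range γ)
    exact ⟨thickening δ (range γ), isOpen_thickening,
      isPreconnected_thickening (isPreconnected_range γ.continuous) hδ,
      self_subset_thickening hδ _ ⟨0, γ.source⟩, self_subset_thickening hδ _ ⟨1, γ.target⟩,
      (hTc.cthickening).of_isClosed_subset isClosed_closure hcl, hcl.trans hsub⟩
  obtain ⟨Ω, h1, h2, -, h⟩ := hK.induction_on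
    (p := fun s => ∃ Ω : Set (Euc N), IsOpen Ω ∧ IsPreconnected Ω ∧ y₀ ∈ Ω ∧ s ⊆ Ω ∧
      IsCompact (closure Ω) ∧ closure Ω ⊆ D) (by
      obtain ⟨Ω, h1, h2, h3, -, h⟩ := hloc y₀ hy₀
      exact ⟨Ω, h1, h2, h3, empty_subset _, h⟩)
    (by
      rintro s t hst ⟨Ω, h1, h2, h3, h4, h⟩
      exact ⟨Ω, h1, h2, h3, hst.trans h4, h⟩)
    (by
      rintro s t ⟨Ω, h1, h2, h3, h4, h5, h6⟩ ⟨Ω', h1', h2', h3', h4', h5', h6'⟩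
      refine ⟨Ω ∪ Ω', h1.union h1', h2.union y₀ h3 h3' h2', Or.inl h3,
        union_subset_union h4 h4', ?_⟩
      rw [closure_union]
      exact ⟨h5.union h5', union_subset h6 h6'⟩)
    (by
      intro y hy
      obtain ⟨Ω, h1, h2, h3, h4, h⟩ := hloc y (hKD hy)
      exact ⟨Ω, mem_nhdsWithin_of_mem_nhds (h1.mem_nhds h4), Ω, h1, h2, h3, subset_rfl, h⟩)
  exact ⟨Ω, h1, h2, h⟩

/-- A smooth function on an open set agrees near a compact subset with a compactly supported
smooth function. -/
lemma exists_compactly_supported_extension {β : Euc N → ℝ} {D K : Set (Euc N)} (hD : IsOpen D)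
    (hβ : ContDiffOn ℝ (⊤ : ℕ∞) β D) (hK : IsCompact K) (hKD : K ⊆ D) :
    ∃ b : Euc N → ℝ, ContDiff ℝ (⊤ : ℕ∞) b ∧ HasCompactSupport b ∧
      ∃ U, IsOpen U ∧ K ⊆ U ∧ EqOn b β U := by
  obtain ⟨δ, hδ, hsub⟩ := hK.exists_cthickening_subset_open hD hKD
  obtain ⟨χ, h1, h0, -⟩ := exists_contMDiffMap_one_nhds_of_subset_interior (n := ⊤)
    𝓘(ℝ, Euc N) hK.isClosed
    ((self_subset_thickening hδ K).trans (interior_maximal (thickening_subset_cthickening δ K)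
      isOpen_thickening))
  have hχ : ContDiff ℝ (⊤ : ℕ∞) χ := χ.contMDiff.contDiff
  have hts : tsupport χ ⊆ cthickening δ K :=
    closure_minimal (fun y hy => by_contra fun h => hy (h0 y h)) isClosed_cthickening
  obtain ⟨U, hU, hKU, hU1⟩ := eventually_nhdsSet_iff_exists.1 h1
  refine ⟨fun y => χ y * β y, ?_, ?_, U, hU, hKU, fun y hy => ?_⟩
  · refine contDiff_iff_contDiffAt.2 fun y => ?_
    by_cases hy : y ∈ tsupport χ
    · exact hχ.contDiffAt.mul (hβ.contDiffAt (hD.mem_nhds (hsub (hts hy))))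
    · have : (fun y => χ y * β y) =ᶠ[nhds y] fun _ => 0 := by
        filter_upwards [notMem_tsupport_iff_eventuallyEq.1 hy] with z hz
        simp [hz]
      exact contDiffAt_const.congr_of_eventuallyEq this
  · exact HasCompactSupport.mul_right (hK.cthickening.of_isClosed_subset (isClosed_tsupport _) hts)
  · simp [hU1 y hy]

lemma exists_boundedDrift {b : Euc N → ℝ} (hb : ContDiff ℝ (⊤ : ℕ∞) b) (hc : HasCompactSupport b) :
    ∃ B, BoundedDrift b B := by
  obtain ⟨B₁, h₁⟩ := hb.continuous.bounded_above_of_compact_support hc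
  obtain ⟨B₂, h₂⟩ := (hb.continuous_fderiv (by simp)).bounded_above_of_compact_support
    (hc.fderiv (𝕜 := ℝ))
  exact ⟨max 1 (max B₁ B₂), hb.of_le (by exact_mod_cast le_top), le_max_left _ _,
    fun y => (h₁ y).trans ((le_max_left _ _).trans (le_max_right _ _)),
    fun y => (h₂ y).trans ((le_max_right _ _).trans (le_max_right _ _))⟩

end Localization

section Mollification

variable {N : ℕ}

/-- The convolution of the kernel `k` with `g`. -/
def mollify (k g : ℝ × Euc N → ℝ) (z : ℝ × Euc N) : ℝ :=
  ∫ t, k t * g (z - t)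

lemma mollify_eq_convolution (k g : ℝ × Euc N → ℝ) :
    mollify k g = convolution k g (ContinuousLinearMap.lsmul ℝ ℝ) volume := rfl

lemma contDiff_mollify {k g : ℝ × Euc N → ℝ} (hk : ContDiff ℝ (⊤ : ℕ∞) k)
    (hkc : HasCompactSupport k) (hg : LocallyIntegrable g) :
    ContDiff ℝ (⊤ : ℕ∞) (mollify k g) :=
  hkc.contDiff_convolution_left (ContinuousLinearMap.lsmul ℝ ℝ) hk hg

lemma integrable_mollify {k g : ℝ × Euc N → ℝ} (hk : Continuous k)
    (hkc : HasCompactSupport k) (hg : LocallyIntegrable g) (z : ℝ × Euc N) :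
    Integrable fun t => k t * g (z - t) :=
  hkc.convolutionExists_left (ContinuousLinearMap.lsmul ℝ ℝ) hk hg z

lemma dir_mollify {k g : ℝ × Euc N → ℝ} (hk : ContDiff ℝ 1 k) (hkc : HasCompactSupport k)
    (hg : LocallyIntegrable g) (e : ℝ × Euc N) :
    dir e (mollify k g) = mollify (dir e k) g := by
  funext z
  have h := hkc.hasFDerivAt_convolution_left (ContinuousLinearMap.lsmul ℝ ℝ) hk hg z
  have hi := (hkc.fderiv (𝕜 := ℝ)).convolutionExists_left
    ((ContinuousLinearMap.lsmul ℝ ℝ).precompL (ℝ × Euc N)) (hk.continuous_fderiv one_ne_zero) hg z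
  rw [dir, mollify_eq_convolution, h.fderiv, convolution_def, ContinuousLinearMap.integral_apply hi]
  rfl

lemma integrable_lapY_mollify {k g : ℝ × Euc N → ℝ} (hk : ContDiff ℝ 2 k)
    (hkc : HasCompactSupport k) (hg : LocallyIntegrable g) (z : ℝ × Euc N) :
    Integrable fun t => lapY k t * g (z - t) := by
  simp only [lapY_eq, Finset.sum_mul]
  exact integrable_finsetSum _ fun i _ =>
    integrable_mollify ((hk.dir_one _).continuous_dir _) ((hkc.dir _).dir _) hg z

lemma opL_mollify (b : Euc N → ℝ) {k g : ℝ × Euc N → ℝ} (hk : ContDiff ℝ 2 k)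
    (hkc : HasCompactSupport k) (hg : LocallyIntegrable g) (z : ℝ × Euc N) :
    opL b (mollify k g) z = ∫ t, (lapY k t + b z.2 * dX k t) * g (z - t) := by
  have hk1 := hk.one_of_two
  have hi : ∀ i, Integrable fun t => dir (eY i) (dir (eY i) k) t * g (z - t) := fun i =>
    integrable_mollify ((hk.dir_one _).continuous_dir _) ((hkc.dir _).dir _) hg z
  have hx : Integrable fun t => b z.2 * (dir eX k t * g (z - t)) :=
    (integrable_mollify (hk1.continuous_dir _) (hkc.dir _) hg z).const_mul _
  have hlap : lapY (mollify k g) z = ∫ t, lapY k t * g (z - t) := by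
    simp only [lapY_eq, Finset.sum_mul]
    rw [integral_finsetSum _ fun i _ => hi i]
    refine Finset.sum_congr rfl fun i _ => ?_
    rw [dir_mollify hk1 hkc hg, dir_mollify (hk.dir_one _) (hkc.dir _) hg]
    rfl
  rw [opL, hlap, dX_eq, dir_mollify hk1 hkc hg, mollify, ← integral_const_mul,
    ← integral_add (integrable_lapY_mollify hk hkc hg z) hx]
  simp only [dX_eq]
  congr 1 with t
  ring

lemma dir_reflect (k : ℝ × Euc N → ℝ) (z p e : ℝ × Euc N) :
    dir e (fun q => k (z - q)) p = - dir e k (z - p) := by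
  have h := (ContinuousLinearEquiv.neg ℝ (M := ℝ × Euc N)).comp_right_fderiv
    (f := fun w => k (z + w)) (x := p)
  have h2 : (fun w => k (z + w)) ∘ ContinuousLinearEquiv.neg ℝ = fun q => k (z - q) :=
    funext fun q => congrArg k (sub_eq_add_neg z q).symm
  rw [h2, fderiv_comp_add_left] at h
  rw [dir, dir, h, sub_eq_add_neg z p]
  simp

lemma lapY_reflect (k : ℝ × Euc N → ℝ) (z p : ℝ × Euc N) :
    lapY (fun q => k (z - q)) p = lapY k (z - p) := by
  simp only [lapY_eq]
  refine Finset.sum_congr rfl fun i _ => ?_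
  have h : dir (eY i) (fun q => k (z - q)) = fun p => - dir (eY i) k (z - p) :=
    funext fun p => dir_reflect k z p (eY i)
  have h2 : dir (eY i) (fun p => - dir (eY i) k (z - p)) p
      = - dir (eY i) (fun p => dir (eY i) k (z - p)) p := by
    rw [dir, fderiv_fun_neg]
    rfl
  rw [h, h2, dir_reflect, neg_neg]

/-- Smooth probability kernels concentrated near the origin, so thin in the `y`-variables that
their `x`-derivative is small when weighted by `‖y‖`. -/
structure IsKernel (δ : ℝ) (k : ℝ × Euc N → ℝ) : Prop where
  contDiff : ContDiff ℝ (⊤ : ℕ∞) k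
  nonneg : ∀ t, 0 ≤ k t
  tsupport_subset : tsupport k ⊆ closedBall 0 δ
  integral_eq_one : ∫ t, k t = 1
  integral_le : ∫ t, ‖t.2‖ * |dX k t| ≤ δ

lemma IsKernel.hasCompactSupport {δ : ℝ} {k : ℝ × Euc N → ℝ} (hk : IsKernel δ k) :
    HasCompactSupport k :=
  (isCompact_closedBall 0 δ).of_isClosed_subset (isClosed_tsupport k) hk.tsupport_subset

lemma exists_isKernel {δ : ℝ} (hδ : 0 < δ) : ∃ k : ℝ × Euc N → ℝ, IsKernel δ k := by
  obtain ⟨η₁, hr₁⟩ : ∃ η : ContDiffBump (0 : ℝ), η.rOut = δ :=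
    ⟨⟨δ / 2, δ, by positivity, by linarith⟩, rfl⟩
  set f₁ := η₁.normed volume with hf₁
  have hs₁ : ContDiff ℝ (⊤ : ℕ∞) f₁ := η₁.contDiff_normed
  have hc₁ : HasCompactSupport f₁ := η₁.hasCompactSupport_normed
  set A := ∫ s, |deriv f₁ s| with hA
  have hA0 : 0 ≤ A := integral_nonneg fun s => abs_nonneg _
  set δ' := min δ (δ / (A + 1)) with hδ'
  have hδ'0 : 0 < δ' := by positivity
  have hδ'A : δ' * A ≤ δ := by
    calc δ' * A ≤ δ / (A + 1) * (A + 1) := by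
          gcongr
          · exact min_le_right _ _
          · linarith
      _ = δ := by field_simp
  obtain ⟨η₂, hr₂⟩ : ∃ η : ContDiffBump (0 : Euc N), η.rOut = δ' :=
    ⟨⟨δ' / 2, δ', by positivity, by linarith⟩, rfl⟩
  set f₂ := η₂.normed volume with hf₂
  have hs₂ : ContDiff ℝ (⊤ : ℕ∞) f₂ := η₂.contDiff_normed
  have hc₂ : HasCompactSupport f₂ := η₂.hasCompactSupport_normed
  have h0₁ : ∀ s, 0 ≤ f₁ s := fun s => η₁.nonneg_normed s
  have h0₂ : ∀ w, 0 ≤ f₂ w := fun w => η₂.nonneg_normed w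
  have hd : Continuous (deriv f₁) := hs₁.continuous_deriv (by simp)
  have hdX : ∀ t : ℝ × Euc N, dX (fun t => f₁ t.1 * f₂ t.2) t = deriv f₁ t.1 * f₂ t.2 := by
    intro t
    have h1 : HasFDerivAt (fun t : ℝ × Euc N => f₁ t.1) _ t :=
      ((hs₁.differentiable (by simp) t.1).hasFDerivAt).comp t hasFDerivAt_fst
    have h2 : HasFDerivAt (fun t : ℝ × Euc N => f₂ t.2) _ t :=
      ((hs₂.differentiable (by simp) t.2).hasFDerivAt).comp t hasFDerivAt_snd
    rw [dX, (h1.fun_mul h2).fderiv]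
    simp [mul_comm]
  have hsmooth : ContDiff ℝ (⊤ : ℕ∞) fun t : ℝ × Euc N => f₁ t.1 * f₂ t.2 :=
    (hs₁.comp contDiff_fst).mul (hs₂.comp contDiff_snd)
  have hnonneg : ∀ t : ℝ × Euc N, 0 ≤ f₁ t.1 * f₂ t.2 := fun t => mul_nonneg (h0₁ t.1) (h0₂ t.2)
  refine ⟨fun t => f₁ t.1 * f₂ t.2, hsmooth, hnonneg, ?_, ?_, ?_⟩
  · rw [tsupport]
    apply closure_minimal _ isClosed_closedBall
    intro t ht
    have ht' := Function.mem_support.1 ht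
    have h1 := Function.mem_support.2 (left_ne_zero_of_mul ht')
    have h2 := Function.mem_support.2 (right_ne_zero_of_mul ht')
    rw [hf₁, η₁.support_normed_eq, hr₁, mem_ball_zero_iff] at h1
    rw [hf₂, η₂.support_normed_eq, hr₂, mem_ball_zero_iff] at h2
    rw [mem_closedBall_zero_iff, Prod.norm_def]
    exact max_le h1.le (h2.le.trans (min_le_left _ _))
  · rw [Measure.volume_eq_prod, integral_prod_mul, η₁.integral_normed, η₂.integral_normed, one_mul]
  · simp only [hdX]
    have hi : Integrable fun t : ℝ × Euc N => |deriv f₁ t.1| * f₂ t.2 := by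
      have hi₁ : Integrable fun s => |deriv f₁ s| :=
        (hd.integrable_of_hasCompactSupport hc₁.deriv).abs
      have hi₂ : Integrable f₂ := η₂.integrable_normed
      exact hi₁.mul_prod hi₂
    have hle : ∀ t : ℝ × Euc N,
        ‖t.2‖ * |deriv f₁ t.1 * f₂ t.2| ≤ δ' * (|deriv f₁ t.1| * f₂ t.2) := by
      intro t
      rw [abs_mul, abs_of_nonneg (h0₂ t.2)]
      by_cases ht : t.2 ∈ Function.support f₂
      · rw [hf₂, η₂.support_normed_eq, hr₂, mem_ball_zero_iff] at ht
        exact mul_le_mul_of_nonneg_right ht.le (mul_nonneg (abs_nonneg _) (h0₂ _))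
      · rw [Function.notMem_support.1 ht]
        simp
    calc ∫ t : ℝ × Euc N, ‖t.2‖ * |deriv f₁ t.1 * f₂ t.2|
        ≤ ∫ t : ℝ × Euc N, δ' * (|deriv f₁ t.1| * f₂ t.2) :=
          integral_mono_of_nonneg
            (ae_of_all _ fun t => mul_nonneg (norm_nonneg t.2) (abs_nonneg _))
            (hi.const_mul δ') (ae_of_all _ hle)
      _ = δ' * A := by
          rw [integral_const_mul, Measure.volume_eq_prod, integral_prod_mul
            (fun s => |deriv f₁ s|) f₂, η₂.integral_normed, mul_one]
      _ ≤ δ := hδ'A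

end Mollification

section Approximation

variable {N : ℕ}

lemma locallyIntegrable_of_bounded {g : ℝ × Euc N → ℝ} (hg : Measurable g) {K : ℝ}
    (hK : ∀ p, |g p| ≤ K) : LocallyIntegrable g :=
  (locallyIntegrable_const K).mono hg.aestronglyMeasurable
    (ae_of_all _ fun p => (hK p).trans (le_abs_self K))

lemma mollify_nonneg {k g : ℝ × Euc N → ℝ} (hk : ∀ t, 0 ≤ k t) (hg : ∀ p, 0 ≤ g p)
    (z : ℝ × Euc N) : 0 ≤ mollify k g z :=
  integral_nonneg fun t => mul_nonneg (hk t) (hg _)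

set_option maxHeartbeats 1000000 in
/-- Mollifying a distributional solution produces an approximate classical one. -/
lemma IsKernel.abs_opL_mollify_le {S : Set (ℝ × Euc N)} {β b : Euc N → ℝ} {γ u : ℝ × Euc N → ℝ}
    {B K M δ : ℝ} {k : ℝ × Euc N → ℝ} (hk : IsKernel δ k) (hb : BoundedDrift b B)
    (hS : MeasurableSet S) (hγ : Measurable γ) (hγM : ∀ᵐ p ∂(volume.restrict S), |γ p| ≤ M)
    (hu : Measurable u) (hu0 : ∀ p ∈ S, 0 ≤ u p) (huK : ∀ p ∈ S, u p ≤ K) (hK : 0 ≤ K)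
    (hsol : IsDistribSolution S β γ u) {z : ℝ × Euc N}
    (hz : ∀ t ∈ closedBall (0 : ℝ × Euc N) δ, z - t ∈ S ∧ b (z - t).2 = β (z - t).2) :
    |opL b (mollify k (S.indicator u)) z| ≤ M * mollify k (S.indicator u) z + B * K * δ := by
  have hB := hb.one_le
  have hkc := hk.hasCompactSupport
  have hk2 : ContDiff ℝ 2 k := contDiff_infty.1 hk.contDiff 2
  have hk1 := hk2.one_of_two
  set g := S.indicator u with hgdef
  have hgm : Measurable g := hu.indicator hS
  have hg0 : ∀ p, 0 ≤ g p := fun p => indicator_nonneg hu0 p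
  have hgK : ∀ p, g p ≤ K := fun p => indicator_le' huK (fun _ _ => hK) p
  have hgl : LocallyIntegrable g :=
    locallyIntegrable_of_bounded hgm fun p => by rw [abs_of_nonneg (hg0 p)]; exact hgK p
  have hdX0 : ∀ t, t ∉ tsupport k → dX k t = 0 := fun t ht => by
    have h : fderiv ℝ k t = 0 := by_contra fun h => ht (support_fderiv_subset ℝ h)
    rw [dX, h]
    rfl
  -- the equation, tested against the reflected kernel
  have hφ : ∫ t, (lapY k t + b (z - t).2 * dX k t + γ (z - t) * k t) * g (z - t) = 0 := by
    have h := hsol (fun q => k (z - q)) (hk.contDiff.comp (contDiff_const.sub contDiff_id))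
      (hkc.comp_homeomorph (Homeomorph.subLeft z)) fun q hq => by
        have hq' : z - q ∈ tsupport k :=
          tsupport_comp_subset_preimage k (continuous_const.sub continuous_id) hq
        simpa using (hz _ (hk.tsupport_subset hq')).1
    rw [← integral_indicator hS, ← integral_sub_left_eq_self _ volume z] at h
    refine Eq.trans (integral_congr_ae (ae_of_all _ fun t => ?_)) h
    by_cases hzt : z - t ∈ S
    · have h3 : b (z - t).2 * dX k t = β (z - t).2 * dX k t := by
        by_cases ht : t ∈ tsupport k
        · rw [(hz t (hk.tsupport_subset ht)).2]
        · rw [hdX0 t ht, mul_zero, mul_zero]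
      simp only [hgdef, indicator_of_mem hzt, lapY_reflect, dX_eq, dir_reflect, sub_sub_cancel]
      rw [dX_eq] at h3
      rw [h3]
      ring
    · simp only [hgdef, indicator_of_notMem hzt, mul_zero]
  have hγ' : ∀ᵐ t, |γ (z - t) * k t * g (z - t)| ≤ M * (k t * g (z - t)) := by
    have h1 := (ae_restrict_iff' hS).1 hγM
    have h2 := (Measure.measurePreserving_sub_left volume z).quasiMeasurePreserving.ae h1
    filter_upwards [h2] with t ht
    rw [abs_mul, abs_mul, abs_of_nonneg (hk.nonneg t), abs_of_nonneg (hg0 _), mul_assoc]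
    by_cases hzt : z - t ∈ S
    · exact mul_le_mul_of_nonneg_right (ht hzt) (mul_nonneg (hk.nonneg t) (hg0 _))
    · simp [hgdef, indicator_of_notMem hzt]
  have hsub : Measurable fun t : ℝ × Euc N => z - t := measurable_const.sub measurable_id
  have ikg := integrable_mollify hk1.continuous hkc hgl z
  have ilap := integrable_lapY_mollify hk2 hkc hgl z
  have hdc : Continuous (dX k) := by rw [dX_eq]; exact hk1.continuous_dir _
  have hdk : HasCompactSupport (dX k) := by rw [dX_eq]; exact hkc.dir _
  have idX := integrable_mollify hdc hdk hgl z
  have hbc : Continuous b := hb.contDiff.continuous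
  have ibdX : Integrable fun t => b (z - t).2 * (dX k t * g (z - t)) :=
    idX.bdd_mul (c := B) (by fun_prop) (ae_of_all _ fun t => hb.abs_le _)
  have iγ : Integrable fun t => γ (z - t) * k t * g (z - t) :=
    (ikg.const_mul M).mono' (((hγ.comp hsub).mul hk1.continuous.measurable).mul
      (hgm.comp hsub)).aestronglyMeasurable hγ'
  have iF₂ : Integrable fun t =>
      (lapY k t + b (z - t).2 * dX k t + γ (z - t) * k t) * g (z - t) := by
    refine ((ilap.add ibdX).add iγ).congr (ae_of_all _ fun t => ?_)
    simp only [Pi.add_apply]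
    ring
  have iF₁ : Integrable fun t => (lapY k t + b z.2 * dX k t) * g (z - t) := by
    refine (ilap.add (idX.const_mul (b z.2))).congr (ae_of_all _ fun t => ?_)
    simp only [Pi.add_apply]
    ring
  have iR : Integrable fun t : ℝ × Euc N => B * K * (‖t.2‖ * |dX k t|) :=
    (((continuous_snd.norm.mul hdc.abs).integrable_of_hasCompactSupport
      (hdk.abs.mul_left)).const_mul _)
  have hmain : opL b (mollify k g) z = ∫ t, ((lapY k t + b z.2 * dX k t) * g (z - t) -
      (lapY k t + b (z - t).2 * dX k t + γ (z - t) * k t) * g (z - t)) := by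
    rw [integral_sub iF₁ iF₂, hφ, sub_zero, opL_mollify b hk2 hkc hgl]
  calc |opL b (mollify k g) z|
      ≤ ∫ t, (B * K * (‖t.2‖ * |dX k t|) + M * (k t * g (z - t))) := by
        rw [hmain, ← Real.norm_eq_abs]
        refine norm_integral_le_of_norm_le (iR.add (ikg.const_mul M)) ?_
        filter_upwards [hγ'] with t ht
        have e : (lapY k t + b z.2 * dX k t) * g (z - t) -
            (lapY k t + b (z - t).2 * dX k t + γ (z - t) * k t) * g (z - t) =
            (b z.2 - b (z - t).2) * (dX k t * g (z - t)) - γ (z - t) * k t * g (z - t) := by ring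
        have h1 : |b z.2 - b (z - t).2| ≤ B * ‖t.2‖ := by
          have := hb.abs_sub_le z.2 (z - t).2
          rwa [Prod.snd_sub, sub_sub_cancel] at this
        have h2 : |(b z.2 - b (z - t).2) * (dX k t * g (z - t))| ≤
            B * K * (‖t.2‖ * |dX k t|) := by
          rw [abs_mul, abs_mul, abs_of_nonneg (hg0 _)]
          calc |b z.2 - b (z - t).2| * (|dX k t| * g (z - t))
              ≤ B * ‖t.2‖ * (|dX k t| * K) := by
                gcongr
                · exact mul_nonneg (abs_nonneg _) (hg0 _)
                · exact hgK _
            _ = B * K * (‖t.2‖ * |dX k t|) := by ring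
        rw [Real.norm_eq_abs, e]
        exact (abs_sub _ _).trans (add_le_add h2 ht)
    _ = B * K * (∫ t, ‖t.2‖ * |dX k t|) + M * mollify k g z := by
        rw [integral_add iR (ikg.const_mul M), integral_const_mul, integral_const_mul, mollify]
    _ ≤ M * mollify k g z + B * K * δ := by
        have := hk.integral_le
        rw [add_comm]
        gcongr

end Approximation

section Limit

open Filter Topology

variable {N : ℕ}

lemma mollify_swap {θ k g : ℝ × Euc N → ℝ} (hθ : Continuous θ) (hθc : HasCompactSupport θ)
    (hk : Continuous k) (hkc : HasCompactSupport k) (hg : Measurable g) {K : ℝ}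
    (hK : ∀ p, |g p| ≤ K) (z : ℝ × Euc N) :
    mollify θ (mollify k g) z = mollify k (mollify θ g) z := by
  have hinteg : Integrable (fun q : (ℝ × Euc N) × (ℝ × Euc N) =>
      g (z - q.1 - q.2) * (θ q.1 * k q.2)) (volume.prod volume) := by
    have h1 : Integrable θ := hθ.integrable_of_hasCompactSupport hθc
    have h2 : Integrable k := hk.integrable_of_hasCompactSupport hkc
    refine (h1.mul_prod h2).bdd_mul (c := K) ?_ (ae_of_all _ fun q => hK _)
    exact (hg.comp ((measurable_const.sub measurable_fst).sub measurable_snd)).aestronglyMeasurable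
  have h := integral_integral_swap (f := fun s w => g (z - s - w) * (θ s * k w)) hinteg
  have e1 : mollify θ (mollify k g) z = ∫ s, ∫ w, g (z - s - w) * (θ s * k w) := by
    simp only [mollify]
    refine integral_congr_ae (ae_of_all _ fun s => ?_)
    dsimp only
    rw [← integral_const_mul]
    refine integral_congr_ae (ae_of_all _ fun w => ?_)
    dsimp only
    ring
  have e2 : mollify k (mollify θ g) z = ∫ w, ∫ s, g (z - s - w) * (θ s * k w) := by
    simp only [mollify]
    refine integral_congr_ae (ae_of_all _ fun w => ?_)
    dsimp only
    rw [← integral_const_mul]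
    refine integral_congr_ae (ae_of_all _ fun s => ?_)
    dsimp only
    rw [sub_right_comm]
    ring
  rw [e1, e2]
  exact h

/-- If all sufficiently fine mollifications of `g` obey a Harnack inequality up to a vanishing
error, then so does `g` at almost all points. -/
lemma exists_ae_le_of_mollify_le {g : ℝ × Euc N → ℝ} (hg : Measurable g) {K : ℝ}
    (hK : ∀ p, |g p| ≤ K) {A : Set (ℝ × Euc N)} (hA : IsOpen A) {C C' δ₀ : ℝ} (hδ₀ : 0 < δ₀)
    (H : ∀ δ ∈ Ioo 0 δ₀, ∀ k : ℝ × Euc N → ℝ, IsKernel δ k → ∀ p ∈ A, ∀ q ∈ A,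
      mollify k g p ≤ C * mollify k g q + C' * δ) :
    ∃ G : Set (ℝ × Euc N), (∀ᵐ p, p ∈ G) ∧ ∀ p ∈ G ∩ A, ∀ q ∈ G ∩ A, g p ≤ C * g q := by
  have hgl := locallyIntegrable_of_bounded hg hK
  have hex : ∀ n : ℕ, ∃ η : ContDiffBump (0 : ℝ × Euc N),
      η.rOut = 1 / ((n : ℝ) + 1) ∧ η.rOut ≤ 2 * η.rIn := fun n =>
    ⟨⟨1 / ((n : ℝ) + 1) / 2, 1 / ((n : ℝ) + 1), by positivity, half_lt_self (by positivity)⟩,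
      rfl, by dsimp only; linarith⟩
  choose η hη hη2 using hex
  have hlim : Tendsto (fun n : ℕ => 1 / ((n : ℝ) + 1)) atTop (𝓝 0) :=
    tendsto_one_div_add_atTop_nhds_zero_nat
  have hηlim : Tendsto (fun n => (η n).rOut) atTop (𝓝 0) := by simpa only [hη] using hlim
  choose k hk using fun n : ℕ =>
    exists_isKernel (N := N) (δ := 1 / ((n : ℝ) + 1)) (by positivity)
  refine ⟨{p | Tendsto (fun n => mollify ((η n).normed volume) g p) atTop (𝓝 (g p))},
    ContDiffBump.ae_convolution_tendsto_right_of_locallyIntegrable hηlim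
      (Eventually.of_forall hη2) hgl, ?_⟩
  rintro p ⟨hpG, hpA⟩ q ⟨hqG, hqA⟩
  refine le_of_tendsto_of_tendsto hpG (hqG.const_mul C) ?_
  have hin : ∀ x ∈ A, ∀ᶠ n in atTop, ∀ s ∈ ball (0 : ℝ × Euc N) (η n).rOut, x - s ∈ A := by
    intro x hx
    obtain ⟨ε, hε, hεA⟩ := Metric.isOpen_iff.1 hA x hx
    filter_upwards [hηlim.eventually (gt_mem_nhds hε)] with n hn s hs
    refine hεA ?_
    rw [mem_ball, dist_eq_norm, sub_sub_cancel_left, norm_neg]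
    exact (mem_ball_zero_iff.1 hs).trans hn
  filter_upwards [hin p hpA, hin q hqA] with n hpn hqn
  set θ := (η n).normed volume with hθ
  have hθs : ContDiff ℝ (⊤ : ℕ∞) θ := (η n).contDiff_normed
  have hθc : HasCompactSupport θ := (η n).hasCompactSupport_normed
  have hθ0 : ∀ s, 0 ≤ θ s := fun s => (η n).nonneg_normed s
  have hW : Continuous (mollify θ g) := (contDiff_mollify hθs hθc hgl).continuous
  have hsupp : Tendsto (fun m => Function.support (k m)) atTop (𝓝 (0 : ℝ × Euc N)).smallSets := by
    refine tendsto_smallSets_iff.2 fun t ht => ?_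
    obtain ⟨ε, hε, hεt⟩ := Metric.mem_nhds_iff.1 ht
    filter_upwards [hlim.eventually (gt_mem_nhds hε)] with m hm s hs
    refine hεt (mem_ball_zero_iff.2 (lt_of_le_of_lt ?_ hm))
    exact mem_closedBall_zero_iff.1 ((hk m).tsupport_subset (subset_closure hs))
  have htend : ∀ x, Tendsto (fun m => mollify (k m) (mollify θ g) x) atTop
      (𝓝 (mollify θ g x)) := fun x =>
    convolution_tendsto_right (Eventually.of_forall fun m => (hk m).nonneg)
      (Eventually.of_forall fun m => (hk m).integral_eq_one) hsupp
      (Eventually.of_forall fun _ => hW.aestronglyMeasurable)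
      ((hW.tendsto x).comp tendsto_snd) tendsto_const_nhds
  have hR := ((htend q).const_mul C).add (hlim.const_mul C')
  rw [mul_zero, add_zero] at hR
  refine le_of_tendsto_of_tendsto (htend p) hR ?_
  filter_upwards [hlim.eventually (gt_mem_nhds hδ₀)] with m hm
  have hkc := (hk m).hasCompactSupport
  have hkcont := (hk m).contDiff.continuous
  have hv : Continuous (mollify (k m) g) := (contDiff_mollify (hk m).contDiff hkc hgl).continuous
  have hi := integrable_mollify hθs.continuous hθc hv.locallyIntegrable
  have hθi : Integrable θ := (η n).integrable_normed
  have hθ1 : ∫ s, θ s = 1 := (η n).integral_normed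
  rw [← mollify_swap hθs.continuous hθc hkcont hkc hg hK,
    ← mollify_swap hθs.continuous hθc hkcont hkc hg hK]
  have e : C * mollify θ (mollify (k m) g) q + C' * (1 / ((m : ℝ) + 1)) =
      ∫ s, (C * (θ s * mollify (k m) g (q - s)) + θ s * (C' * (1 / ((m : ℝ) + 1)))) := by
    rw [integral_add ((hi q).const_mul C) (hθi.mul_const _), integral_const_mul,
      integral_mul_const, hθ1, one_mul]
    rfl
  rw [e]
  refine integral_mono (hi p) (((hi q).const_mul C).add (hθi.mul_const _)) fun s => ?_
  by_cases hs : s ∈ Function.support θ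
  · rw [hθ, (η n).support_normed_eq] at hs
    have h1 := H _ ⟨by positivity, hm⟩ (k m) (hk m) _ (hpn s hs) _ (hqn s hs)
    calc θ s * mollify (k m) g (p - s)
        ≤ θ s * (C * mollify (k m) g (q - s) + C' * (1 / ((m : ℝ) + 1))) :=
          mul_le_mul_of_nonneg_left h1 (hθ0 s)
      _ = _ := by ring
  · simp [Function.notMem_support.1 hs]

lemma essSup_le_mul_essInf {α : Type*} [MeasurableSpace α] {μ : Measure α} {u : α → ℝ} {C K : ℝ}
    (hC : 0 < C) {G : Set α} (hG : ∀ᵐ p ∂μ, p ∈ G) (h0 : ∀ p ∈ G, 0 ≤ u p) (hK : ∀ p ∈ G, u p ≤ K)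
    (h : ∀ p ∈ G, ∀ q ∈ G, u p ≤ C * u q) : essSup u μ ≤ C * essInf u μ := by
  rcases eq_or_ne μ 0 with rfl | hμ
  · simp [essSup, essInf, limsup, liminf, limsSup, limsInf]
  have : (ae μ).NeBot := ae_neBot.2 hμ
  have hsup : ∀ q ∈ G, essSup u μ ≤ C * u q := fun q hq =>
    limsup_le_of_le (IsCoboundedUnder.of_frequently_ge (a := 0)
      (hG.mono fun p hp => h0 p hp).frequently) (hG.mono fun p hp => h p hp q hq)
  have hinf : C⁻¹ * essSup u μ ≤ essInf u μ :=
    le_liminf_of_le (IsCoboundedUnder.of_frequently_le (a := K)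
      (hG.mono fun p hp => hK p hp).frequently) (hG.mono fun q hq => by
        rw [inv_mul_le_iff₀ hC]; exact hsup q hq)
  rwa [inv_mul_le_iff₀ hC] at hinf

end Limit

section Conclusion

variable {N : ℕ}

lemma opL_add_const (β : Euc N → ℝ) (f : ℝ × Euc N → ℝ) (c : ℝ) (p : ℝ × Euc N) :
    opL β (fun q => f q + c) p = opL β f p := by
  simp only [opL, lapY, dX, fderiv_add_const]

/-- A mollified solution becomes admissible after adding a small constant. -/
lemma IsKernel.admissible_mollify {D Ω U : Set (Euc N)} {β b : Euc N → ℝ}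
    {γ u : ℝ × Euc N → ℝ} {B K M δ h l r : ℝ} {k : ℝ × Euc N → ℝ} (hk : IsKernel δ k)
    (hb : BoundedDrift b B) (hD : IsOpen D) (hM : 0 < M) (hδ : 0 < δ) (hδh : δ ≤ h)
    (hU : cthickening δ (closure Ω) ⊆ U ∩ D) (hbβ : EqOn b β U) (hγ : Measurable γ)
    (hγM : ∀ᵐ p ∂(volume.restrict (Ioo l r ×ˢ D)), |γ p| ≤ M) (hu : Measurable u)
    (hu0 : ∀ p ∈ Ioo l r ×ˢ D, 0 ≤ u p) (huK : ∀ p ∈ Ioo l r ×ˢ D, u p ≤ K) (hK : 0 ≤ K)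
    (hsol : IsDistribSolution (Ioo l r ×ˢ D) β γ u) :
    Admissible b M (Ioo (l + h) (r - h) ×ˢ Ω)
      fun q => mollify k ((Ioo l r ×ˢ D).indicator u) q + B * K * δ / M := by
  have hS : MeasurableSet (Ioo l r ×ˢ D) := measurableSet_Ioo.prod hD.measurableSet
  have hg0 : ∀ p, 0 ≤ (Ioo l r ×ˢ D).indicator u p := indicator_nonneg hu0
  have hgK : ∀ p, |(Ioo l r ×ˢ D).indicator u p| ≤ K := fun p => by
    rw [abs_of_nonneg (hg0 p)]
    exact indicator_le' (g := fun _ => K) huK (fun _ _ => hK) p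
  have hB : 0 ≤ B := zero_le_one.trans hb.one_le
  refine ⟨?_, fun p _ => ?_, fun z hz => ?_⟩
  · exact ((contDiff_mollify hk.contDiff hk.hasCompactSupport
      (locallyIntegrable_of_bounded (hu.indicator hS) hgK)).of_le
        (WithTop.coe_le_coe.2 le_top : ((2 : ℕ∞) : WithTop ℕ∞) ≤ _)).add contDiff_const
  · have := mollify_nonneg hk.nonneg hg0 p
    positivity
  · rw [opL_add_const, mul_add, mul_div_cancel₀ _ hM.ne']
    refine hk.abs_opL_mollify_le hb hS hγ hγM hu hu0 huK hK hsol fun t ht => ?_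
    rw [mem_closedBall_zero_iff] at ht
    have h1 : |t.1| ≤ δ := (norm_fst_le t).trans ht
    have h2 : ‖t.2‖ ≤ δ := (norm_snd_le t).trans ht
    obtain ⟨h3, h4⟩ := abs_le.1 h1
    have hy : (z - t).2 ∈ U ∩ D := hU (mem_cthickening_of_dist_le _ z.2 _ _
      (subset_closure hz.2) (by rwa [dist_eq_norm, Prod.snd_sub, sub_sub_cancel_left, norm_neg]))
    refine ⟨⟨⟨?_, ?_⟩, hy.2⟩, hbβ hy.1⟩
    · rw [Prod.fst_sub]
      linarith [hz.1.1]
    · rw [Prod.fst_sub]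
      linarith [hz.1.2]

end Conclusion

/-- **The Harnack inequality for a class of degenerate elliptic operators**
(Hamel–Zlatoš, Theorem 1.1).  Let `N ≥ 2`, `r ∈ ℕ`, `D ⊆ ℝ^{N-1}` open and connected, and
`β ∈ C^∞(D)` with `inf_D β < 0 < sup_D β` and `Σ_{0≤|ζ|≤r} |D^ζ β(y)| > 0` for all `y ∈ D`.
Fix a bounded open `D'` with `closure D' ⊆ D` and `M > 0`.  Then there is `C > 0` such that for
all `a < a' < b' < b` with `(a'-a)⁻¹, (b-b')⁻¹, b'-a' ≤ M`, every measurable `γ` with `|γ| ≤ M`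
a.e. and every bounded nonnegative distributional solution `u` of
`Δ_y u + β(y) u_x + γ(x,y) u = 0` on `(a,b) × D`, one has
`ess sup_{(a',b')×D'} u ≤ C · ess inf_{(a',b')×D'} u`. -/
theorem harnack_degenerate_elliptic
    (N r : ℕ) (hN : 2 ≤ N)
    (D : Set (Euc N)) (hDopen : IsOpen D) (hDconn : IsConnected D)
    (β : Euc N → ℝ) (hβsmooth : ContDiffOn ℝ (⊤ : ℕ∞) β D)
    (hβneg : ∃ y ∈ D, β y < 0) (hβpos : ∃ y ∈ D, 0 < β y)
    (hβhor : ∀ y ∈ D, 0 < hormanderSum N r β y)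
    (D' : Set (Euc N)) (hD'open : IsOpen D') (hD'bdd : Bornology.IsBounded D')
    (hD'cl : closure D' ⊆ D)
    (M : ℝ) (hM : 0 < M) :
    ∃ C > (0 : ℝ), ∀ a a' b' b : ℝ,
      a < a' → a' < b' → b' < b →
      (a' - a)⁻¹ ≤ M → (b - b')⁻¹ ≤ M → b' - a' ≤ M →
      ∀ γ : ℝ × Euc N → ℝ, Measurable γ →
        (∀ᵐ p ∂(volume.restrict (Ioo a b ×ˢ D)), |γ p| ≤ M) →
      ∀ u : ℝ × Euc N → ℝ, Measurable u →
        (∀ p ∈ Ioo a b ×ˢ D, 0 ≤ u p) →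
        (∃ K : ℝ, ∀ p ∈ Ioo a b ×ˢ D, u p ≤ K) →
        IsDistribSolution (Ioo a b ×ˢ D) β γ u →
        essSup u (volume.restrict (Ioo a' b' ×ˢ D'))
          ≤ C * essInf u (volume.restrict (Ioo a' b' ×ˢ D')) := by
  obtain ⟨y₂, hy₂, hb₂⟩ := hβneg
  obtain ⟨y₁, hy₁, hb₁⟩ := hβpos
  have hD'c : IsCompact (closure D') := hD'bdd.isCompact_closure
  obtain ⟨Ω, hΩ, hΩc, hKΩ, hΩk, hΩD⟩ := exists_isPreconnected_between hDopen hDconn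
    (hD'c.union ((Set.finite_singleton y₂).insert y₁).isCompact)
    (union_subset hD'cl (insert_subset hy₁ (singleton_subset_iff.2 hy₂)))
  have hD'Ω : closure D' ⊆ Ω := subset_union_left.trans hKΩ
  have hy₁Ω : y₁ ∈ Ω := hKΩ (Or.inr (Or.inl rfl))
  have hy₂Ω : y₂ ∈ Ω := hKΩ (Or.inr (Or.inr rfl))
  obtain ⟨b, hb, hbc, U, hU, hΩU, hbβ⟩ :=
    exists_compactly_supported_extension hDopen hβsmooth hΩk hΩD
  obtain ⟨B, hB⟩ := exists_boundedDrift hb hbc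
  have hB0 : 0 ≤ B := zero_le_one.trans hB.one_le
  obtain ⟨Z, ρ, c, j, hF⟩ := exists_finiteType hb hΩk fun y hy => by
    obtain ⟨l, hl⟩ := exists_partialsAlong_ne_zero (hβhor y (hΩD hy))
    exact ⟨l, by rwa [partialsAlong_congr hU hbβ l (hΩU hy)]⟩
  obtain ⟨δ₁, hδ₁, hδ₁U⟩ := hΩk.exists_cthickening_subset_open (hU.inter hDopen)
    (subset_inter hΩU hΩD)
  have hh : 0 < 1 / (2 * M) := by positivity
  obtain ⟨C, hC, H⟩ := (hF.mono subset_closure).harnack_of_admissible hB hΩ hΩc hy₁Ω hy₂Ω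
    (by rwa [hbβ (hΩU (subset_closure hy₁Ω))]) (by rwa [hbβ (hΩU (subset_closure hy₂Ω))])
    hM hD'c hD'Ω hh (L := M)
  refine ⟨C, hC, fun a a' b' b₀ haa' hab hbb' hMa hMb hL γ hγ hγM u hu hu0 ⟨K₀, hK₀⟩ hsol => ?_⟩
  set S := Ioo a b₀ ×ˢ D with hS
  have hSm : MeasurableSet S := measurableSet_Ioo.prod hDopen.measurableSet
  set A := Ioo a' b' ×ˢ D' with hA
  have hAo : IsOpen A := isOpen_Ioo.prod hD'open
  have hAS : A ⊆ S := prod_mono (Ioo_subset_Ioo haa'.le hbb'.le) (subset_closure.trans hD'cl)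
  have hAI : A ⊆ Icc a' b' ×ˢ closure D' := prod_mono Ioo_subset_Icc_self subset_closure
  have hsplit : 1 / M = 1 / (2 * M) + 1 / (2 * M) := by field_simp; norm_num
  have ha : 1 / M ≤ a' - a := by
    rw [one_div]
    exact inv_le_of_inv_le₀ (by linarith) hMa
  have hb' : 1 / M ≤ b₀ - b' := by
    rw [one_div]
    exact inv_le_of_inv_le₀ (by linarith) hMb
  have hK : (0 : ℝ) ≤ max K₀ 0 := le_max_right _ _
  have huK : ∀ p ∈ S, u p ≤ max K₀ 0 := fun p hp => (hK₀ p hp).trans (le_max_left _ _)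
  have hg0 : ∀ p, 0 ≤ S.indicator u p := indicator_nonneg hu0
  have hgK : ∀ p, |S.indicator u p| ≤ max K₀ 0 := fun p => by
    rw [abs_of_nonneg (hg0 p)]
    exact indicator_le' (g := fun _ => max K₀ 0) huK (fun _ _ => hK) p
  obtain ⟨G, hG, hGC⟩ := exists_ae_le_of_mollify_le (C := C) (C' := C * (B * max K₀ 0 / M))
    (hu.indicator hSm) hgK hAo (lt_min hh hδ₁) fun δ hδ k hk p hp q hq => by
      have hadm := hk.admissible_mollify hB hDopen hM hδ.1 (hδ.2.le.trans (min_le_left _ _))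
        ((cthickening_mono (hδ.2.le.trans (min_le_right _ _)) _).trans hδ₁U) hbβ hγ hγM hu hu0
        huK hK hsol
      have key := H _ a' b' _ (by linarith) (by linarith) hL _ hadm p (hAI hp) q (hAI hq)
      have he : 0 ≤ B * max K₀ 0 * δ / M := by
        have := hδ.1
        positivity
      calc mollify k (S.indicator u) p
          ≤ mollify k (S.indicator u) p + B * max K₀ 0 * δ / M := le_add_of_nonneg_right he
        _ ≤ C * (mollify k (S.indicator u) q + B * max K₀ 0 * δ / M) := key
        _ = _ := by ring
  have hGA : ∀ᵐ p ∂(volume.restrict A), p ∈ G ∩ A :=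
    (ae_restrict_of_ae hG).and (ae_restrict_mem hAo.measurableSet)
  refine essSup_le_mul_essInf hC hGA (fun p hp => hu0 p (hAS hp.2))
    (fun p hp => huK p (hAS hp.2)) fun p hp q hq => ?_
  have := hGC p hp q hq
  rwa [indicator_of_mem (hAS hp.2), indicator_of_mem (hAS hq.2)] at this
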